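/- If G is a finite connected simple graph in which every vertex has degree 2 or degree 3, then 10·γ_r(G) ≤ 5·n_2(G) + 4·n_3(G) + 5, where n_2(G) and n_3(G) denote the numbers of vertices of degree 2 and degree 3 in G. -/

import Mathlib

/-- `S` is a restrained dominating set of `G`: every vertex not in `S` has a
neighbor in `S` (domination) and also a neighbor not in `S` (restraint). -/
def IsRestrainedDomSet {V : Type*} (G : SimpleGraph V) (S : Set V) : Prop :=
  (∀ v ∉ S, ∃ u ∈ S, G.Adj v u) ∧ (∀ v ∉ S, ∃ u ∉ S, G.Adj v u)

/-- The restrained domination number of a finite graph: the minimum cardinality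
of a restrained dominating set. -/
noncomputable def restrainedDominationNumber {V : Type*} [Fintype V] (G : SimpleGraph V) : ℕ :=
  sInf {n : ℕ | ∃ S : Set V, IsRestrainedDomSet G S ∧ S.ncard = n}

namespace RD
section
open scoped Classical
set_option linter.unusedSectionVars false
set_option linter.unusedVariables false
set_option linter.unusedSimpArgs false
variable {V : Type*} [Fintype V]

/-- Degree of a vertex. -/
noncomputable def dg (G : SimpleGraph V) (v : V) : ℕ := (Finset.univ.filter (fun z => G.Adj v z)).card

/-- Number of neighbours inside `X`. -/
noncomputable def io (G : SimpleGraph V) (X : Finset V) (v : V) : ℕ := (X.filter (fun z => G.Adj v z)).card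

noncomputable def wt (G : SimpleGraph V) (U : Finset V) : ℤ := ∑ v ∈ U, (7 - (dg G v : ℤ))

structure Good (U : Finset V) (G : SimpleGraph V) : Prop where
  sub : ∀ u v, G.Adj u v → u ∈ U
  deg : ∀ v ∈ U, dg G v = 2 ∨ dg G v = 3
  ne : U.Nonempty
  conn : ∀ W ⊆ U, W.Nonempty → (∀ u ∈ W, ∀ v, G.Adj u v → v ∈ W) → W = U

/-- Restrained dominating sets of the graph `G` on `U`. -/
def RDS (U : Finset V) (G : SimpleGraph V) (S : Finset V) : Prop :=
  S ⊆ U ∧ ∀ v ∈ U, v ∉ S → (∃ u ∈ S, G.Adj v u) ∧ (∃ u, u ∉ S ∧ G.Adj v u)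

def Bd (U : Finset V) (G : SimpleGraph V) (m : ℤ) : Prop :=
  ∃ S, RDS U G S ∧ 10 * (S.card : ℤ) ≤ wt G U + m

def IH (U : Finset V) : Prop := ∀ (U' : Finset V) (G' : SimpleGraph V), U'.card < U.card → Good U' G' → Bd U' G' 5

theorem Bd.mono {U : Finset V} {G : SimpleGraph V} {m m' : ℤ} (h : Bd U G m) (hm : m ≤ m') : Bd U G m' := by
  obtain ⟨S, hS, hc⟩ := h
  exact ⟨S, hS, by linarith⟩

/-- Delete `X`, then join `p` and `q` (nothing is added if `p = q`). -/
def red (G : SimpleGraph V) (X : Finset V) (p q : V) : SimpleGraph V where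
  Adj u v := u ∉ X ∧ v ∉ X ∧ (G.Adj u v ∨ (p ≠ q ∧ (u = p ∧ v = q ∨ u = q ∧ v = p)))
  symm := ⟨by
    rintro u v ⟨h1, h2, h3⟩
    refine ⟨h2, h1, ?_⟩
    rcases h3 with h | ⟨h, h'⟩
    · exact Or.inl h.symm
    · exact Or.inr ⟨h, by tauto⟩⟩
  loopless := ⟨by
    rintro u ⟨h1, h2, h3⟩
    rcases h3 with h | ⟨h, h'⟩
    · exact G.loopless.irrefl u h
    · rcases h' with ⟨a, b⟩ | ⟨a, b⟩
      · exact h (a.symm.trans b)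
      · exact h (b.symm.trans a)⟩

noncomputable def nw (p q v : V) : ℕ := if p ≠ q ∧ (v = p ∨ v = q) then 1 else 0

theorem red_dg {U X : Finset V} {G : SimpleGraph V} {p q v : V}
    (hpq : p ≠ q → p ∉ X ∧ q ∉ X ∧ ¬ G.Adj p q) (hv : v ∉ X) :
    dg (red G X p q) v + io G X v = dg G v + nw p q v := by
  have h1 : dg G v = (Finset.univ.filter (fun z => z ∉ X ∧ G.Adj v z)).card + io G X v := by
    unfold dg io
    rw [← Finset.card_union_of_disjoint]
    · congr 1; ext z; simp; tauto
    · rw [Finset.disjoint_left]; intro z; simp; tauto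
  have h2 : dg (red G X p q) v = (Finset.univ.filter (fun z => z ∉ X ∧ G.Adj v z)).card + nw p q v := by
    unfold dg nw
    by_cases hne : p = q
    · subst hne
      simp only [red]
      simp [hv]
    · obtain ⟨hp, hq, hn⟩ := hpq hne
      by_cases hvp : v = p
      · subst hvp
        rw [if_pos ⟨hne, Or.inl rfl⟩]
        have : Finset.univ.filter (fun z => (red G X v q).Adj v z) =
            insert q (Finset.univ.filter (fun z => z ∉ X ∧ G.Adj v z)) := by
          ext z; simp [red, hv, hne]
          constructor
          · rintro ⟨a, b | b | b⟩ <;> tauto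
          · rintro (b | b)
            · subst b; tauto
            · tauto
        rw [this, Finset.card_insert_of_notMem]
        simp [hn]
      · by_cases hvq : v = q
        · subst hvq
          rw [if_pos ⟨hne, Or.inr rfl⟩]
          have : Finset.univ.filter (fun z => (red G X p v).Adj v z) =
              insert p (Finset.univ.filter (fun z => z ∉ X ∧ G.Adj v z)) := by
            ext z; simp [red, hv, hne]
            constructor
            · rintro ⟨a, b | b | b⟩ <;> tauto
            · rintro (b | b)
              · subst b; tauto
              · tauto
          rw [this, Finset.card_insert_of_notMem]
          simp [G.adj_comm v p, hn]
        · rw [if_neg (by tauto)]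
          simp only [red]
          simp [hv, hvp, hvq]
  omega

theorem sum_io_comm (G : SimpleGraph V) (X Y : Finset V) :
    ∑ v ∈ Y, io G X v = ∑ x ∈ X, io G Y x := by
  unfold io
  simp only [Finset.card_filter]
  rw [Finset.sum_comm]
  refine Finset.sum_congr rfl fun x _ => Finset.sum_congr rfl fun y _ => ?_
  simp [G.adj_comm]

theorem sum_nw {p q : V} {U : Finset V} (h : p ≠ q → p ∈ U ∧ q ∈ U) :
    ∑ v ∈ U, nw p q v = if p = q then 0 else 2 := by
  unfold nw
  by_cases hne : p = q
  · simp [hne]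
  · obtain ⟨hp, hq⟩ := h hne
    rw [← Finset.card_filter]
    have : U.filter (fun v => p ≠ q ∧ (v = p ∨ v = q)) = {p, q} := by
      ext z; simp [hne]
      rintro (h | h) <;> subst h <;> tauto
    rw [this, Finset.card_pair hne]; simp [hne]

theorem red_wt {U X : Finset V} {G : SimpleGraph V} {p q : V} (hX : X ⊆ U)
    (hpq : p ≠ q → p ∈ U \ X ∧ q ∈ U \ X ∧ ¬ G.Adj p q) :
    wt (red G X p q) (U \ X) = wt G U - (∑ x ∈ X, (7 - (dg G x : ℤ) - (io G (U \ X) x : ℤ)))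
      - (if p = q then 0 else 2) := by
  have h0 : wt G U = wt G (U \ X) + wt G X := by
    unfold wt; rw [Finset.sum_sdiff hX]
  have h1 : wt (red G X p q) (U \ X) =
      ∑ v ∈ U \ X, ((7 - (dg G v : ℤ)) + (io G X v : ℤ) - (nw p q v : ℤ)) := by
    unfold wt
    refine Finset.sum_congr rfl fun v hv => ?_
    have := red_dg (G := G) (X := X) (p := p) (q := q) (v := v) (U := U)
      (fun h => by have := hpq h; simp at this; tauto) (by simp at hv; tauto)
    omega
  have h2 := sum_io_comm G X (U \ X)
  have h3 := sum_nw (p := p) (q := q) (U := U \ X) (fun h => ⟨(hpq h).1, (hpq h).2.1⟩)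
  rw [h1, h0]
  simp only [Finset.sum_add_distrib, Finset.sum_sub_distrib, wt]
  have h2' : (∑ v ∈ U \ X, (io G X v : ℤ)) = ∑ x ∈ X, (io G (U \ X) x : ℤ) := by exact_mod_cast h2
  have h3' : (∑ v ∈ U \ X, (nw p q v : ℤ)) = if p = q then 0 else 2 := by exact_mod_cast h3
  rw [h2', h3']; ring

theorem red_good {U X : Finset V} {G : SimpleGraph V} {p q : V} (hG : Good U G)
    (hne : (U \ X).Nonempty)
    (hpq : p ≠ q → p ∈ U \ X ∧ q ∈ U \ X ∧ ¬ G.Adj p q)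
    (hdeg : ∀ v ∈ U, v ∉ X → 2 + io G X v ≤ dg G v + nw p q v ∧ dg G v + nw p q v ≤ 3 + io G X v)
    (hconn : ∀ W ⊆ U \ X, W.Nonempty → (∀ u ∈ W, ∀ v, v ∉ X → G.Adj u v → v ∈ W) →
      (p ≠ q → (p ∈ W ↔ q ∈ W)) → W = U \ X) :
    Good (U \ X) (red G X p q) where
  sub := by
    rintro u v ⟨h1, h2, h3⟩
    rcases h3 with h | ⟨h, h'⟩
    · simp [h1, hG.sub u v h]
    · have := hpq h
      rcases h' with ⟨a, b⟩ | ⟨a, b⟩ <;> subst a <;> tauto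
  deg := by
    intro v hv
    simp at hv
    have := red_dg (G := G) (X := X) (p := p) (q := q) (v := v) (U := U)
      (fun h => by have := hpq h; simp at this; tauto) hv.2
    have := hdeg v hv.1 hv.2
    omega
  ne := hne
  conn := by
    intro W hW hWn hcl
    apply hconn W hW hWn
    · intro u hu v hv huv
      apply hcl u hu v
      have := hW hu; simp at this
      exact ⟨this.2, hv, Or.inl huv⟩
    · intro h
      have h3 := hpq h; simp at h3
      constructor
      · intro hp; apply hcl p hp q; simp [red]; tauto
      · intro hp; apply hcl q hp p; simp [red]; tauto

/-- Extension property. -/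
def Ext (G : SimpleGraph V) (X : Finset V) (p q : V) (c : ℕ) : Prop :=
  ∀ S : Finset V, (∀ v ∈ S, v ∉ X) → ∃ Sx ⊆ X, Sx.card ≤ c ∧
    (∀ v ∈ X, v ∉ Sx → (∃ u, (u ∈ S ∨ u ∈ Sx) ∧ G.Adj v u) ∧ (∃ u, (u ∉ S ∧ u ∉ Sx) ∧ G.Adj v u)) ∧
    (p ≠ q → p ∉ S → (q ∈ S → ∃ u ∈ Sx, G.Adj p u) ∧ (q ∉ S → ∃ u ∈ X, u ∉ Sx ∧ G.Adj p u)) ∧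
    (p ≠ q → q ∉ S → (p ∈ S → ∃ u ∈ Sx, G.Adj q u) ∧ (p ∉ S → ∃ u ∈ X, u ∉ Sx ∧ G.Adj q u))

theorem red_bd {U X : Finset V} {G : SimpleGraph V} {p q : V} {c : ℕ} (hX : X ⊆ U)
    (hpq : p ≠ q → p ∈ U \ X ∧ q ∈ U \ X ∧ ¬ G.Adj p q)
    (hext : Ext G X p q c) {m m' : ℤ} (hb : Bd (U \ X) (red G X p q) m)
    (hm : m + 10 * c ≤ m' + (∑ x ∈ X, (7 - (dg G x : ℤ) - (io G (U \ X) x : ℤ)))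
      + (if p = q then 0 else 2)) : Bd U G m' := by
  obtain ⟨S, hS, hc⟩ := hb
  have hSX : ∀ v ∈ S, v ∉ X := fun v hv => by have := hS.1 hv; simp at this; exact this.2
  obtain ⟨Sx, hSx, hcard, hin, hp, hq⟩ := hext S hSX
  refine ⟨S ∪ Sx, ⟨?_, ?_⟩, ?_⟩
  · apply Finset.union_subset
    · exact hS.1.trans Finset.sdiff_subset
    · exact hSx.trans hX
  · intro v hv hvS
    simp only [Finset.mem_union, not_or] at hvS ⊢
    by_cases hvX : v ∈ X
    · obtain ⟨⟨u, hu, hu'⟩, ⟨w, hw, hw'⟩⟩ := hin v hvX hvS.2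
      exact ⟨⟨u, hu, hu'⟩, ⟨w, hw, hw'⟩⟩
    · obtain ⟨⟨u, hu, hu'⟩, ⟨w, hw, hw'⟩⟩ := hS.2 v (by simp [hv, hvX]) hvS.1
      constructor
      · rcases hu'.2.2 with h | ⟨hne, ⟨h1, h2⟩ | ⟨h1, h2⟩⟩
        · exact ⟨u, Or.inl hu, h⟩
        · subst h1 h2
          obtain ⟨z, hz, hz'⟩ := (hp hne hvS.1).1 hu
          exact ⟨z, Or.inr hz, hz'⟩
        · subst h1 h2
          obtain ⟨z, hz, hz'⟩ := (hq hne hvS.1).1 hu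
          exact ⟨z, Or.inr hz, hz'⟩
      · rcases hw'.2.2 with h | ⟨hne, ⟨h1, h2⟩ | ⟨h1, h2⟩⟩
        · exact ⟨w, ⟨hw, fun h' => hw'.2.1 (hSx h')⟩, h⟩
        · subst h1 h2
          obtain ⟨z, hz, hz', hz''⟩ := (hp hne hvS.1).2 hw
          exact ⟨z, ⟨fun h => hSX z h hz, hz'⟩, hz''⟩
        · subst h1 h2
          obtain ⟨z, hz, hz', hz''⟩ := (hq hne hvS.1).2 hw
          exact ⟨z, ⟨fun h => hSX z h hz, hz'⟩, hz''⟩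
  · have h1 := Finset.card_union_le S Sx
    have h2 := red_wt (G := G) hX hpq
    have h3 : ((S ∪ Sx).card : ℤ) ≤ S.card + c := by exact_mod_cast h1.trans (by omega)
    rw [h2] at hc
    linarith

noncomputable def cnt {α : Type*} (P : α → Prop) : List α → ℕ
  | [] => 0
  | a :: l => (if P a then 1 else 0) + cnt P l

theorem cnt_append {α : Type*} (P : α → Prop) (l m : List α) : cnt P (l ++ m) = cnt P l + cnt P m := by
  induction l with
  | nil => simp [cnt]
  | cons a l ih => simp [cnt, ih]; ring

theorem cnt_map {α β : Type*} (P : β → Prop) (f : α → β) (l : List α) :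
    cnt P (l.map f) = cnt (fun a => P (f a)) l := by
  induction l with
  | nil => simp [cnt]
  | cons a l ih => simp [cnt, ih]

theorem cnt_pos {α : Type*} (P : α → Prop) {l : List α} {a : α} (ha : a ∈ l) (h : P a) : 1 ≤ cnt P l := by
  induction l with
  | nil => simp at ha
  | cons b l ih =>
    simp only [cnt]
    rcases List.mem_cons.1 ha with h' | h'
    · subst h'; simp [h]
    · have := ih h'; omega

theorem cnt_two {α : Type*} (P : α → Prop) {l : List α} {a b : α} (ha : a ∈ l) (hb : b ∈ l) (hab : a ≠ b)
    (h : P a) (h' : P b) : 2 ≤ cnt P l := by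
  induction l with
  | nil => simp at ha
  | cons c l ih =>
    simp only [cnt]
    rcases List.mem_cons.1 ha with h1 | h1 <;> rcases List.mem_cons.1 hb with h2 | h2
    · exact absurd (h1.trans h2.symm) hab
    · subst h1; have := cnt_pos P h2 h'; simp [h]; omega
    · subst h2; have := cnt_pos P h1 h; simp [h']; omega
    · have := ih h1 h2; omega

theorem cnt_nodup {l : List V} (hl : l.Nodup) (z : V) : cnt (· = z) l = if z ∈ l then 1 else 0 := by
  induction l with
  | nil => simp [cnt]
  | cons a l ih =>
    rw [List.nodup_cons] at hl
    simp only [cnt, ih hl.2, List.mem_cons]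
    by_cases h : a = z
    · subst h; simp [hl.1]
    · simp [h, Ne.symm h, eq_comm]

/-- Neighbourhood given by a list. -/
def NL (G : SimpleGraph V) (v : V) (l : List V) : Prop := l.Nodup ∧ ∀ z, G.Adj v z ↔ z ∈ l

theorem NL.dg {G : SimpleGraph V} {v : V} {l : List V} (h : NL G v l) : dg G v = l.length := by
  unfold RD.dg
  rw [← List.toFinset_card_of_nodup h.1]
  congr 1; ext z; simp [h.2]

abbrev Pt (V : Type*) := List (V × List V × List V)

/-- Vertices of a patch. -/
def vs (D : Pt V) : List V := D.map (fun d => d.1)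
/-- Half-edges of a patch. -/
def hf (D : Pt V) : List V := D.flatMap (fun d => d.2.2)
/-- Vertex set of a patch. -/
noncomputable def VS (D : Pt V) : Finset V := (vs D).toFinset

def drop : Pt V → ℤ
  | [] => 0
  | d :: D => (7 - (d.2.1.length : ℤ) - 2 * (d.2.2.length : ℤ)) + drop D

structure Patch (G : SimpleGraph V) (D : Pt V) : Prop where
  nd : (vs D).Nodup
  h : ∀ d ∈ D, NL G d.1 (d.2.1 ++ d.2.2) ∧ d.2.1 ≠ [] ∧ (∀ z ∈ d.2.1, z ∈ vs D) ∧ (∀ z ∈ d.2.2, z ∉ vs D)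

theorem mem_VS {D : Pt V} {z : V} : z ∈ VS D ↔ z ∈ vs D := by simp [VS]

theorem sum_VS {D : Pt V} (hD : (vs D).Nodup) {M : Type*} [AddCommMonoid M] (f : V → M) :
    ∑ x ∈ VS D, f x = (D.map (fun d => f d.1)).sum := by
  unfold VS
  rw [List.sum_toFinset f hD]
  simp [vs, List.map_map, Function.comp_def]

theorem Patch.io {G : SimpleGraph V} {D : Pt V} (hD : Patch G D) {z : V} (hz : z ∉ VS D) :
    io G (VS D) z = cnt (· = z) (hf D) := by
  unfold RD.io
  rw [Finset.card_filter, sum_VS hD.nd]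
  rw [mem_VS] at hz
  have h := hD.h
  have key : ∀ E : Pt V, (∀ d ∈ E, d ∈ D) →
      (E.map (fun d => if G.Adj z d.1 then 1 else 0)).sum = cnt (· = z) (hf E) := by
    intro E hE
    induction E with
    | nil => simp [hf, cnt]
    | cons d E ih =>
      have h1 := ih (fun d hd => hE d (List.mem_cons_of_mem _ hd))
      have h2 := h d (hE d (by simp))
      have h3 : hf (d :: E) = d.2.2 ++ hf E := by simp [hf]
      rw [List.map_cons, List.sum_cons, h1, h3, cnt_append, cnt_nodup (List.Nodup.of_append_right h2.1.1)]
      congr 1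
      have h4 : G.Adj z d.1 ↔ z ∈ d.2.2 := by
        rw [G.adj_comm, h2.1.2, List.mem_append]
        constructor
        · rintro (h5 | h5)
          · exact absurd (h2.2.2.1 z h5) hz
          · exact h5
        · exact Or.inr
      by_cases h5 : z ∈ d.2.2
      · rw [if_pos h5, if_pos (h4.2 h5)]
      · rw [if_neg h5, if_neg (fun h => h5 (h4.1 h))]
  exact key D (fun d hd => hd)

theorem Patch.sub {U : Finset V} {G : SimpleGraph V} {D : Pt V} (hG : Good U G) (hD : Patch G D) : VS D ⊆ U := by
  intro z hz
  rw [mem_VS] at hz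
  simp only [vs, List.mem_map] at hz
  obtain ⟨d, hd, rfl⟩ := hz
  obtain ⟨h1, h2, -⟩ := hD.h d hd
  obtain ⟨y, hy⟩ := List.exists_mem_of_ne_nil _ h2
  exact hG.sub d.1 y ((h1.2 y).2 (by simp [hy]))

theorem Patch.drop {U : Finset V} {G : SimpleGraph V} {D : Pt V} (hG : Good U G) (hD : Patch G D) :
    ∑ x ∈ VS D, (7 - (dg G x : ℤ) - (RD.io G (U \ VS D) x : ℤ)) = RD.drop D := by
  rw [sum_VS hD.nd]
  have key : ∀ E : Pt V, (∀ d ∈ E, d ∈ D) →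
      (E.map (fun d => (7 - (dg G d.1 : ℤ) - (RD.io G (U \ VS D) d.1 : ℤ)))).sum = RD.drop E := by
    intro E hE
    induction E with
    | nil => simp [RD.drop]
    | cons d E ih =>
      have h1 := ih (fun d hd => hE d (List.mem_cons_of_mem _ hd))
      obtain ⟨h2, h3, h4, h5⟩ := hD.h d (hE d (by simp))
      rw [List.map_cons, List.sum_cons, h1, RD.drop]
      have h6 : RD.io G (U \ VS D) d.1 = d.2.2.length := by
        unfold RD.io
        rw [← List.toFinset_card_of_nodup (List.Nodup.of_append_right h2.1)]
        congr 1; ext z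
        simp only [Finset.mem_filter, Finset.mem_sdiff, mem_VS, List.mem_toFinset, h2.2, List.mem_append]
        constructor
        · rintro ⟨⟨a, b⟩, c | c⟩
          · exact absurd (h4 z c) b
          · exact c
        · intro hz
          refine ⟨⟨?_, h5 z hz⟩, Or.inr hz⟩
          exact hG.sub z d.1 ((G.adj_comm _ _).1 ((h2.2 z).2 (by simp [hz])))
      rw [h6, h2.dg, List.length_append]
      push_cast; ring
  exact key D (fun d hd => hd)

theorem Patch.hf_mem {U : Finset V} {G : SimpleGraph V} {D : Pt V} (hG : Good U G) (hD : Patch G D) {z : V}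
    (hz : z ∈ hf D) : z ∈ U \ VS D := by
  simp only [hf, List.mem_flatMap] at hz
  obtain ⟨d, hd, hz⟩ := hz
  obtain ⟨h2, h3, h4, h5⟩ := hD.h d hd
  rw [Finset.mem_sdiff, mem_VS]
  exact ⟨hG.sub z d.1 ((G.adj_comm _ _).1 ((h2.2 z).2 (by simp [hz]))), h5 z hz⟩

theorem Patch.hf_of_adj {G : SimpleGraph V} {D : Pt V} (hD : Patch G D) {x z : V} (hx : x ∈ VS D)
    (hz : z ∉ VS D) (h : G.Adj x z) : (x, z) ∈ D.flatMap (fun d => d.2.2.map (Prod.mk d.1)) := by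
  rw [mem_VS] at hx hz
  simp only [vs, List.mem_map] at hx
  obtain ⟨d, hd, rfl⟩ := hx
  obtain ⟨h2, h3, h4, h5⟩ := hD.h d hd
  have := (h2.2 z).1 h
  rw [List.mem_append] at this
  have hz2 : z ∈ d.2.2 := by
    rcases this with h | h
    · exact absurd (h4 z h) hz
    · exact h
  simp only [List.mem_flatMap, List.mem_map]
  exact ⟨d, hd, z, hz2, rfl⟩

theorem cnt_hf (P : V → Prop) (D : Pt V) :
    cnt P (hf D) = cnt (fun e : V × V => P e.2) (D.flatMap (fun d => d.2.2.map (Prod.mk d.1))) := by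
  induction D with
  | nil => simp [hf, cnt]
  | cons d D ih =>
    have h3 : hf (d :: D) = d.2.2 ++ hf D := by simp [hf]
    rw [h3, cnt_append, ih, List.flatMap_cons, cnt_append, cnt_map]

theorem Patch.two {G : SimpleGraph V} {D : Pt V} (hD : Patch G D) (P : V → Prop) {x z x' z' : V}
    (hx : x ∈ VS D) (hz : z ∉ VS D) (h : G.Adj x z) (hx' : x' ∈ VS D) (hz' : z' ∉ VS D) (h' : G.Adj x' z')
    (hne : ¬ (x = x' ∧ z = z')) (hP : P z) (hP' : P z') : 2 ≤ cnt P (hf D) := by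
  rw [cnt_hf]
  refine cnt_two _ (hD.hf_of_adj hx hz h) (hD.hf_of_adj hx' hz' h') ?_ hP hP'
  simpa using hne

/-- conclusions of a reduction with a patch -/
theorem Patch.good {U : Finset V} {G : SimpleGraph V} (hG : Good U G) {D : Pt V} (hD : Patch G D)
    (hh : hf D ≠ []) (p q : V)
    (hpq : p ≠ q → p ∈ hf D ∧ q ∈ hf D ∧ ¬ G.Adj p q)
    (hdeg : ∀ z ∈ hf D, 2 + cnt (· = z) (hf D) ≤ dg G z + nw p q z)
    (hconn : ∀ W ⊆ U \ VS D, W.Nonempty → W ≠ U \ VS D →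
      (∀ u ∈ W, ∀ v, v ∉ VS D → G.Adj u v → v ∈ W) → (p ≠ q → (p ∈ W ↔ q ∈ W)) → False) :
    Good (U \ VS D) (red G (VS D) p q) := by
  have hne : (U \ VS D).Nonempty := by
    obtain ⟨z, hz⟩ := List.exists_mem_of_ne_nil _ hh
    exact ⟨z, hD.hf_mem hG hz⟩
  refine red_good hG hne (fun h => ⟨hD.hf_mem hG (hpq h).1, hD.hf_mem hG (hpq h).2.1, (hpq h).2.2⟩) ?_ ?_
  · intro v hv hvX
    rw [hD.io hvX]
    by_cases hvh : v ∈ hf D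
    · have h1 := hdeg v hvh
      have h2 := cnt_pos (· = v) hvh rfl
      refine ⟨h1, ?_⟩
      have := hG.deg v hv
      have : nw p q v ≤ 1 := by unfold nw; split_ifs <;> omega
      omega
    · have h2 : cnt (· = v) (hf D) = 0 := by
        clear hdeg hpq hh
        generalize hf D = l at hvh
        induction l with
        | nil => rfl
        | cons a l ih => simp at hvh; simp only [cnt]; rw [ih hvh.2, if_neg (fun h => hvh.1 h.symm)]
      have h3 : nw p q v = 0 := by
        unfold nw
        rw [if_neg]
        rintro ⟨h, h' | h'⟩
        · subst h'; exact hvh (hpq h).1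
        · subst h'; exact hvh (hpq h).2.1
      have := hG.deg v hv
      omega
  · intro W h1 h2 h3 h4
    by_contra h5
    exact hconn W h1 h2 h5 h3 h4

theorem card_lt {U : Finset V} {G : SimpleGraph V} (hG : Good U G) {D : Pt V} (hD : Patch G D)
    (hh : hf D ≠ []) : (U \ VS D).card < U.card := by
  apply Finset.card_lt_card
  refine ⟨Finset.sdiff_subset, ?_⟩
  intro h
  obtain ⟨d, hd⟩ : ∃ d, d ∈ D := by
    obtain ⟨z, hz⟩ := List.exists_mem_of_ne_nil _ hh
    simp only [hf, List.mem_flatMap] at hz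
    exact ⟨hz.choose, hz.choose_spec.1⟩
  have h1 : d.1 ∈ VS D := by rw [mem_VS]; simp only [vs, List.mem_map]; exact ⟨d, hd, rfl⟩
  have := h (hD.sub hG h1)
  simp at this
  exact this.2 h1

theorem step {U : Finset V} {G : SimpleGraph V} (hG : Good U G) (ih : IH U) {D : Pt V} (hD : Patch G D)
    (hh : hf D ≠ []) (p q : V) (c : ℕ)
    (hpq : p ≠ q → p ∈ hf D ∧ q ∈ hf D ∧ ¬ G.Adj p q)
    (hdeg : ∀ z ∈ hf D, 2 + cnt (· = z) (hf D) ≤ dg G z + nw p q z)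
    (hconn : ∀ W ⊆ U \ VS D, W.Nonempty → W ≠ U \ VS D →
      (∀ u ∈ W, ∀ v, v ∉ VS D → G.Adj u v → v ∈ W) → (p ≠ q → (p ∈ W ↔ q ∈ W)) → False)
    (hext : Ext G (VS D) p q c)
    (hdrop : 10 * (c : ℤ) + 1 ≤ drop D + if p = q then 0 else 2) : Bd U G 4 := by
  have h1 := Patch.good hG hD hh p q hpq hdeg hconn
  have h2 := ih _ _ (card_lt hG hD hh) h1
  refine red_bd (hD.sub hG) (fun h => ⟨hD.hf_mem hG (hpq h).1, hD.hf_mem hG (hpq h).2.1, (hpq h).2.2⟩)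
    hext h2 ?_
  rw [hD.drop hG]
  linarith

/-- At most one edge leaves `M`. -/
def cut1 (G : SimpleGraph V) (M : Finset V) : Prop :=
  ∀ u v u' v', u ∈ M → v ∉ M → G.Adj u v → u' ∈ M → v' ∉ M → G.Adj u' v' → u = u' ∧ v = v'

structure MinL (U : Finset V) (G : SimpleGraph V) (L : Finset V) : Prop where
  sub : L ⊆ U
  ne : L.Nonempty
  cut : cut1 G L
  min : ∀ M ⊆ L, M.Nonempty → M ≠ L → ¬ cut1 G M

theorem exists_minL {U : Finset V} {G : SimpleGraph V} (M : Finset V) (hMU : M ⊆ U) (hM : M.Nonempty) (hc : cut1 G M) :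
    ∃ L ⊆ M, MinL U G L := by
  induction h : M.card using Nat.strong_induction_on generalizing M with
  | _ n ih =>
    by_cases hx : ∃ M' ⊆ M, M'.Nonempty ∧ M' ≠ M ∧ cut1 G M'
    · obtain ⟨M', h1, h2, h3, h4⟩ := hx
      obtain ⟨L, hL, hL'⟩ := ih M'.card (by rw [← h]; exact Finset.card_lt_card (lt_of_le_of_ne h1 h3)) M' (h1.trans hMU) h2 h4 rfl
      exact ⟨L, hL.trans h1, hL'⟩
    · push Not at hx
      exact ⟨M, Finset.Subset.refl _, hMU, hM, hc, fun M' h1 h2 h3 => hx M' h1 h2 h3⟩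

/-- The patch lies in the interior of `L`. -/
def Int (L : Finset V) (D : Pt V) : Prop := (∀ z ∈ vs D, z ∈ L) ∧ ∀ z ∈ hf D, z ∈ L

theorem CL0 {U L : Finset V} {G : SimpleGraph V} (hG : Good U G) (hL : MinL U G L) {D : Pt V} (hD : Patch G D)
    (hI : Int L D) (hn : D ≠ []) {W : Finset V} (hW : W ⊆ U \ VS D) (hWn : W.Nonempty) (hWp : W ≠ U \ VS D)
    (hcl : ∀ u ∈ W, ∀ v, v ∉ VS D → G.Adj u v → v ∈ W) (hWL : W ⊆ L) :
    2 ≤ cnt (· ∈ W) (hf D) ∧ 2 ≤ cnt (· ∉ W) (hf D) := by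
  have hXL : VS D ⊆ L := fun z hz => hI.1 z (mem_VS.1 hz)
  have hXn : (VS D).Nonempty := by
    obtain ⟨d, hd⟩ := List.exists_mem_of_ne_nil _ hn
    exact ⟨d.1, by rw [mem_VS]; simp only [vs, List.mem_map]; exact ⟨d, hd, rfl⟩⟩
  have hWX : ∀ z ∈ W, z ∉ VS D := fun z hz => (Finset.mem_sdiff.1 (hW hz)).2
  have hXout : ∀ x ∈ VS D, ∀ z, G.Adj x z → z ∈ L := by
    intro x hx z hxz
    by_cases hz : z ∈ VS D
    · exact hXL hz
    · have := hD.hf_of_adj hx hz hxz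
      simp only [List.mem_flatMap, List.mem_map, Prod.mk.injEq] at this
      obtain ⟨d, hd, y, hy, rfl, rfl⟩ := this
      exact hI.2 y (by simp only [hf, List.mem_flatMap]; exact ⟨d, hd, hy⟩)
  constructor
  · have h1 : W ≠ L := by
      intro h
      obtain ⟨x, hx⟩ := hXn
      exact hWX x (h ▸ hXL hx) hx
    have h2 := hL.min W hWL hWn h1
    unfold cut1 at h2
    push Not at h2
    obtain ⟨u, v, u', v', a1, a2, a3, a4, a5, a6, a7⟩ := h2
    have b1 : v ∈ VS D := by by_contra h; exact a2 (hcl u a1 v h a3)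
    have b2 : v' ∈ VS D := by by_contra h; exact a5 (hcl u' a4 v' h a6)
    exact hD.two _ b1 (hWX u a1) a3.symm b2 (hWX u' a4) a6.symm (by tauto) a1 a4
  · have h1 : W ∪ VS D ≠ L := by
      intro h
      have : L = U := by
        apply hG.conn L hL.sub hL.ne
        intro u hu v huv
        rw [← h, Finset.mem_union] at hu
        rcases hu with hu | hu
        · by_cases hv : v ∈ VS D
          · exact hXL hv
          · exact hWL (hcl u hu v hv huv)
        · exact hXout u hu v huv
      apply hWp
      apply Finset.Subset.antisymm hW
      intro z hz
      rw [Finset.mem_sdiff, ← this, ← h, Finset.mem_union] at hz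
      tauto
    have h2 := hL.min _ (Finset.union_subset hWL hXL) (hWn.mono Finset.subset_union_left) h1
    unfold cut1 at h2
    push Not at h2
    obtain ⟨u, v, u', v', a1, a2, a3, a4, a5, a6, a7⟩ := h2
    rw [Finset.mem_union] at a1 a4
    rw [Finset.mem_union, not_or] at a2 a5
    have b1 : u ∈ VS D := by
      rcases a1 with h | h
      · exact absurd (hcl u h v a2.2 a3) a2.1
      · exact h
    have b2 : u' ∈ VS D := by
      rcases a4 with h | h
      · exact absurd (hcl u' h v' a5.2 a6) a5.1
      · exact h
    exact hD.two _ b1 a2.2 a3 b2 a5.2 a6 (by tauto) a2.1 a5.1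

theorem CL {U L : Finset V} {G : SimpleGraph V} (hG : Good U G) (hL : MinL U G L) {D : Pt V} (hD : Patch G D)
    (hI : Int L D) (hn : D ≠ []) {W : Finset V} (hW : W ⊆ U \ VS D) (hWn : W.Nonempty) (hWp : W ≠ U \ VS D)
    (hcl : ∀ u ∈ W, ∀ v, v ∉ VS D → G.Adj u v → v ∈ W) :
    2 ≤ cnt (· ∈ W) (hf D) ∧ 2 ≤ cnt (· ∉ W) (hf D) := by
  have hXL : VS D ⊆ L := fun z hz => hI.1 z (mem_VS.1 hz)
  have hXn : (VS D).Nonempty := by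
    obtain ⟨d, hd⟩ := List.exists_mem_of_ne_nil _ hn
    exact ⟨d.1, by rw [mem_VS]; simp only [vs, List.mem_map]; exact ⟨d, hd, rfl⟩⟩
  have hXout : ∀ x ∈ VS D, ∀ z, G.Adj x z → z ∈ L := by
    intro x hx z hxz
    by_cases hz : z ∈ VS D
    · exact hXL hz
    · have := hD.hf_of_adj hx hz hxz
      simp only [List.mem_flatMap, List.mem_map, Prod.mk.injEq] at this
      obtain ⟨d, hd, y, hy, rfl, rfl⟩ := this
      exact hI.2 y (by simp only [hf, List.mem_flatMap]; exact ⟨d, hd, hy⟩)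
  by_cases hWL : W ⊆ L
  · exact CL0 hG hL hD hI hn hW hWn hWp hcl hWL
  · set W' := (U \ VS D) \ W with hW'
    have hcl' : ∀ u ∈ W', ∀ v, v ∉ VS D → G.Adj u v → v ∈ W' := by
      intro u hu v hv huv
      rw [hW', Finset.mem_sdiff, Finset.mem_sdiff] at hu ⊢
      refine ⟨⟨hG.sub v u huv.symm, hv⟩, fun h => hu.2 (hcl v h u hu.1.2 huv.symm)⟩
    have hW'n : W'.Nonempty := by
      rw [hW', Finset.sdiff_nonempty]
      exact fun h => hWp (Finset.Subset.antisymm hW h)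
    -- a crossing edge of L inside any closed set not contained in L
    have cross : ∀ Z : Finset V, Z ⊆ U \ VS D → (∀ u ∈ Z, ∀ v, v ∉ VS D → G.Adj u v → v ∈ Z) → ¬ Z ⊆ L →
        ∃ u v, u ∈ Z ∧ v ∈ Z ∧ u ∈ L ∧ v ∉ L ∧ G.Adj u v := by
      intro Z hZ hZc hZL
      by_contra hno
      push Not at hno
      have : Z \ L = U := by
        apply hG.conn
        · exact Finset.sdiff_subset.trans (hZ.trans Finset.sdiff_subset)
        · rwa [Finset.sdiff_nonempty]
        · intro u hu v huv
          rw [Finset.mem_sdiff] at hu ⊢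
          have hvX : v ∉ VS D := fun h => hu.2 (hXout v h u huv.symm)
          have hvZ := hZc u hu.1 v hvX huv
          exact ⟨hvZ, fun h => hno v u hvZ hu.1 h hu.2 huv.symm⟩
      obtain ⟨x, hx⟩ := hXn
      have h1 : x ∈ Z \ L := this ▸ hL.sub (hXL hx)
      exact (Finset.mem_sdiff.1 h1).2 (hXL hx)
    have hW'L : W' ⊆ L := by
      by_contra h
      obtain ⟨u, v, a1, a2, a3, a4, a5⟩ := cross W hW hcl hWL
      obtain ⟨u', v', b1, b2, b3, b4, b5⟩ := cross W' Finset.sdiff_subset hcl' h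
      have := (hL.cut u v u' v' a3 a4 a5 b3 b4 b5).1
      rw [hW', Finset.mem_sdiff] at b1
      exact b1.2 (this ▸ a1)
    have hW'p : W' ≠ U \ VS D := by
      intro h
      obtain ⟨z, hz⟩ := hWn
      have : z ∈ W' := h ▸ hW hz
      rw [hW', Finset.mem_sdiff] at this
      exact this.2 hz
    have key := CL0 hG hL hD hI hn Finset.sdiff_subset hW'n hW'p hcl' hW'L
    have cc : ∀ (P Q : V → Prop) (l : List V), (∀ z ∈ l, P z ↔ Q z) → cnt P l = cnt Q l := by
      intro P Q l hl
      induction l with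
      | nil => rfl
      | cons a l ih =>
        simp only [cnt]
        rw [ih (fun z hz => hl z (List.mem_cons_of_mem _ hz))]
        simp [hl a (by simp)]
    have e1 := cc (· ∈ W') (· ∉ W) (hf D) (fun z hz => by
      have := hD.hf_mem hG hz
      rw [hW']; simp only [Finset.mem_sdiff] at this ⊢; tauto)
    have e2 := cc (· ∉ W') (· ∈ W) (hf D) (fun z hz => by
      have := hD.hf_mem hG hz
      rw [hW']; simp only [Finset.mem_sdiff] at this ⊢; tauto)
    rw [← e1, ← e2]
    exact ⟨key.2, key.1⟩

theorem stepL {U L : Finset V} {G : SimpleGraph V} (hG : Good U G) (ih : IH U) (hL : MinL U G L)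
    {D : Pt V} (hD : Patch G D) (hI : Int L D)
    (hh : hf D ≠ []) (p q : V) (c : ℕ)
    (hpq : p ≠ q → p ∈ hf D ∧ q ∈ hf D ∧ ¬ G.Adj p q)
    (hdeg : ∀ z ∈ hf D, 2 + cnt (· = z) (hf D) ≤ dg G z + nw p q z)
    (hconn : ∀ W : Finset V, 2 ≤ cnt (· ∈ W) (hf D) → 2 ≤ cnt (· ∉ W) (hf D) →
      (∀ u v, u ∉ VS D → v ∉ VS D → G.Adj u v → (u ∈ W ↔ v ∈ W)) → (p ≠ q → (p ∈ W ↔ q ∈ W)) → False)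
    (hext : Ext G (VS D) p q c)
    (hdrop : 10 * (c : ℤ) + 1 ≤ drop D + if p = q then 0 else 2) : Bd U G 4 := by
  refine step hG ih hD hh p q c hpq hdeg ?_ hext hdrop
  intro W h1 h2 h3 h4 h5
  have hn : D ≠ [] := by rintro rfl; simp [hf] at hh
  obtain ⟨k1, k2⟩ := CL hG hL hD hI hn h1 h2 h3 h4
  refine hconn W k1 k2 ?_ h5
  intro u v hu hv huv
  exact ⟨fun h => h4 u h v hv huv, fun h => h4 v h u hu huv.symm⟩

theorem NL.adj {G : SimpleGraph V} {v : V} {l : List V} (h : NL G v l) {z : V} (hz : z ∈ l) : G.Adj v z :=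
  (h.2 z).2 hz

theorem NL.perm {G : SimpleGraph V} {v : V} {l l' : List V} (h : NL G v l) (hp : l.Perm l') : NL G v l' :=
  ⟨hp.nodup_iff.1 h.1, fun z => by rw [h.2, hp.mem_iff]⟩

theorem NL.r21 {G : SimpleGraph V} {v a b : V} (h : NL G v [a, b]) : NL G v [b, a] :=
  h.perm (List.Perm.swap b a [])
theorem NL.r213 {G : SimpleGraph V} {v a b c : V} (h : NL G v [a, b, c]) : NL G v [b, a, c] :=
  h.perm (List.Perm.swap b a [c])
theorem NL.r132 {G : SimpleGraph V} {v a b c : V} (h : NL G v [a, b, c]) : NL G v [a, c, b] :=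
  h.perm ((List.Perm.swap c b []).cons a)
theorem NL.r231 {G : SimpleGraph V} {v a b c : V} (h : NL G v [a, b, c]) : NL G v [b, c, a] := h.r213.r132
theorem NL.r312 {G : SimpleGraph V} {v a b c : V} (h : NL G v [a, b, c]) : NL G v [c, a, b] := h.r132.r213
theorem NL.r321 {G : SimpleGraph V} {v a b c : V} (h : NL G v [a, b, c]) : NL G v [c, b, a] := h.r213.r132.r213

theorem NL.f2 {G : SimpleGraph V} {v a b : V} (h : NL G v [a, b]) :
    (v ≠ a ∧ v ≠ b ∧ a ≠ b) ∧ RD.dg G v = 2 ∧ G.Adj v a ∧ G.Adj v b ∧ ∀ z, G.Adj v z ↔ z = a ∨ z = b := by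
  have h1 := h.dg
  have h2 := h.1
  simp at h2 h1
  have h3 := h.adj (z := a) (by simp)
  have h4 := h.adj (z := b) (by simp)
  exact ⟨⟨h3.ne, h4.ne, h2⟩, h1, h3, h4, by simpa using h.2⟩

theorem NL.f3 {G : SimpleGraph V} {v a b c : V} (h : NL G v [a, b, c]) :
    (v ≠ a ∧ v ≠ b ∧ v ≠ c ∧ a ≠ b ∧ a ≠ c ∧ b ≠ c) ∧ RD.dg G v = 3 ∧ G.Adj v a ∧ G.Adj v b ∧ G.Adj v c ∧
    ∀ z, G.Adj v z ↔ z = a ∨ z = b ∨ z = c := by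
  have h1 := h.dg
  have h2 := h.1
  simp at h2 h1
  have h3 := h.adj (z := a) (by simp)
  have h4 := h.adj (z := b) (by simp)
  have h5 := h.adj (z := c) (by simp)
  exact ⟨⟨h3.ne, h4.ne, h5.ne, h2.1.1, h2.1.2, h2.2⟩, h1, h3, h4, h5, by simpa using h.2⟩

theorem Good.nl {U : Finset V} {G : SimpleGraph V} (hG : Good U G) {v : V} (hv : v ∈ U) :
    (∃ a b, NL G v [a, b]) ∨ ∃ a b c, NL G v [a, b, c] := by
  rcases hG.deg v hv with h | h
  · left
    unfold dg at h
    rw [Finset.card_eq_two] at h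
    obtain ⟨a, b, hab, h⟩ := h
    refine ⟨a, b, by simp [hab], fun z => ?_⟩
    have : z ∈ Finset.univ.filter (fun z => G.Adj v z) ↔ z ∈ ({a, b} : Finset V) := by rw [h]
    simpa using this
  · right
    unfold dg at h
    rw [Finset.card_eq_three] at h
    obtain ⟨a, b, c, hab, hac, hbc, h⟩ := h
    refine ⟨a, b, c, by simp [hab, hac, hbc], fun z => ?_⟩
    have : z ∈ Finset.univ.filter (fun z => G.Adj v z) ↔ z ∈ ({a, b, c} : Finset V) := by rw [h]
    simpa using this

theorem Good.nl1 {U : Finset V} {G : SimpleGraph V} (hG : Good U G) {v a : V} (h : G.Adj v a) :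
    (∃ b, NL G v [a, b]) ∨ ∃ b c, NL G v [a, b, c] := by
  rcases hG.nl (hG.sub v a h) with ⟨x, y, hx⟩ | ⟨x, y, z, hx⟩
  · left
    have := (hx.2 a).1 h
    simp at this
    rcases this with rfl | rfl
    · exact ⟨y, hx⟩
    · exact ⟨x, hx.r21⟩
  · right
    have := (hx.2 a).1 h
    simp at this
    rcases this with rfl | rfl | rfl
    · exact ⟨_, _, hx⟩
    · exact ⟨_, _, hx.r213⟩
    · exact ⟨_, _, hx.r312⟩

theorem Good.nl2 {U : Finset V} {G : SimpleGraph V} (hG : Good U G) {v a b : V} (h : G.Adj v a) (h' : G.Adj v b)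
    (hab : a ≠ b) : NL G v [a, b] ∨ ∃ c, NL G v [a, b, c] := by
  rcases hG.nl1 h with ⟨x, hx⟩ | ⟨x, y, hx⟩
  · left
    have := (hx.2 b).1 h'
    simp at this
    rcases this with rfl | rfl
    · exact absurd rfl hab
    · exact hx
  · right
    have := (hx.2 b).1 h'
    simp at this
    rcases this with rfl | rfl | rfl
    · exact absurd rfl hab
    · exact ⟨_, hx⟩
    · exact ⟨_, hx.r132⟩

theorem Good.d2 {U : Finset V} {G : SimpleGraph V} (hG : Good U G) {v a : V} (h : G.Adj v a) (hd : dg G v = 2) :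
    ∃ b, NL G v [a, b] := by
  rcases hG.nl1 h with h1 | ⟨b, c, h1⟩
  · exact h1
  · have := h1.dg; simp at this; omega

theorem Good.d3 {U : Finset V} {G : SimpleGraph V} (hG : Good U G) {v a : V} (h : G.Adj v a) (hd : dg G v = 3) :
    ∃ b c, NL G v [a, b, c] := by
  rcases hG.nl1 h with ⟨b, h1⟩ | h1
  · have := h1.dg; simp at this; omega
  · exact h1

/-- Core extension for a path on three vertices. -/
theorem ext_P3 {G : SimpleGraph V} {X : Finset V} {a v b a1 b1 p q : V} (hX : ∀ z, z ∈ X ↔ z = a ∨ z = v ∨ z = b)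
    (hav : G.Adj a v) (hvb : G.Adj v b) (hab : a ≠ b) (ha1 : G.Adj a a1) (hb1 : G.Adj b b1)
    (hpq : p = q ∨ p = a1 ∧ q = b1 ∨ p = b1 ∧ q = a1) (ha : a1 ∉ X) (hb : b1 ∉ X) : Ext G X p q 1 := by
  intro S hS
  have e1 := hav.ne
  have e2 := hvb.ne
  have e3 := hav.symm
  have e4 := hvb.symm
  have e5 := ha1.symm
  have e6 := hb1.symm
  have e7 := hS a
  have e8 := hS v
  have e9 := hS b
  simp only [hX] at ha hb hS e7 e8 e9 ⊢
  by_cases h1 : a1 ∈ S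
  · refine ⟨{b}, by intro z; simp [hX]; tauto, by simp, ?_, ?_, ?_⟩
    all_goals grind
  · by_cases h2 : b1 ∈ S
    · refine ⟨{a}, by intro z; simp [hX]; tauto, by simp, ?_, ?_, ?_⟩
      all_goals grind
    · refine ⟨{v}, by intro z; simp [hX]; tauto, by simp, ?_, ?_, ?_⟩
      all_goals grind

theorem cnt_compl (P : V → Prop) (l : List V) : cnt P l + cnt (fun z => ¬ P z) l = l.length := by
  induction l with
  | nil => rfl
  | cons a l ih =>
    simp only [cnt, List.length_cons]
    by_cases h : P a <;> simp [h] <;> omega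

theorem small_conn {l : List V} (hl : l.length ≤ 3) (W : Finset V) (h1 : 2 ≤ cnt (· ∈ W) l)
    (h2 : 2 ≤ cnt (· ∉ W) l) : False := by
  have := cnt_compl (· ∈ W) l
  omega

/-- Path patch. -/
def DP (a v b : V) (A C B : List V) : Pt V := [(a, [v], A), (v, [a, b], C), (b, [v], B)]
/-- Triangle patch. -/
def DT (a v b : V) (A C B : List V) : Pt V := [(a, [v, b], A), (v, [a, b], C), (b, [v, a], B)]

theorem patch_DP {G : SimpleGraph V} {a v b : V} {A C B : List V} (ha : NL G a (v :: A)) (hv : NL G v (a :: b :: C))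
    (hb : NL G b (v :: B)) (hn : ¬ G.Adj a b) : Patch G (DP a v b A C B) := by
  have a1 := ha.adj (z := v) (by simp)
  have a2 := hv.adj (z := b) (by simp)
  have n1 := ha.1
  have n2 := hv.1
  have n3 := hb.1
  simp only [List.nodup_cons, List.mem_cons, not_or] at n1 n2 n3
  have m1 : ∀ z ∈ A, z ≠ a := fun z hz h => (ha.adj (z := z) (by simp [hz])).ne h.symm
  have m2 : ∀ z ∈ B, z ≠ b := fun z hz h => (hb.adj (z := z) (by simp [hz])).ne h.symm
  have m3 : ∀ z ∈ C, z ≠ v := fun z hz h => (hv.adj (z := z) (by simp [hz])).ne h.symm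
  have m4 : ∀ z ∈ A, z ≠ b := by rintro z hz rfl; exact hn (ha.adj (by simp [hz]))
  have m5 : ∀ z ∈ B, z ≠ a := by rintro z hz rfl; exact hn (hb.adj (by simp [hz])).symm
  have m6 : ∀ z ∈ A, z ≠ v := by rintro z hz rfl; exact n1.1 hz
  have m7 : ∀ z ∈ B, z ≠ v := by rintro z hz rfl; exact n3.1 hz
  have m8 : ∀ z ∈ C, z ≠ a := by rintro z hz rfl; exact n2.1.2 hz
  have m9 : ∀ z ∈ C, z ≠ b := by rintro z hz rfl; exact n2.2.1 hz
  constructor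
  · simp [DP, vs, a1.ne, a2.ne, n2.1.1]
  · simp only [DP, vs, List.mem_cons, List.not_mem_nil, or_false, List.map_cons, List.map_nil]
    rintro d (rfl | rfl | rfl)
    · exact ⟨ha, by simp, by simp, fun z hz => by simp [m1 z hz, m6 z hz, m4 z hz]⟩
    · exact ⟨hv, by simp, by simp, fun z hz => by simp [m3 z hz, m8 z hz, m9 z hz]⟩
    · exact ⟨hb, by simp, by simp, fun z hz => by simp [m2 z hz, m7 z hz, m5 z hz]⟩

theorem patch_DT {G : SimpleGraph V} {a v b : V} {A C B : List V} (ha : NL G a (v :: b :: A)) (hv : NL G v (a :: b :: C))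
    (hb : NL G b (v :: a :: B)) : Patch G (DT a v b A C B) := by
  have a1 := ha.adj (z := v) (by simp)
  have a2 := hv.adj (z := b) (by simp)
  have n1 := ha.1
  have n2 := hv.1
  have n3 := hb.1
  simp only [List.nodup_cons, List.mem_cons, not_or] at n1 n2 n3
  have m1 : ∀ z ∈ A, z ≠ a := fun z hz h => (ha.adj (z := z) (by simp [hz])).ne h.symm
  have m2 : ∀ z ∈ B, z ≠ b := fun z hz h => (hb.adj (z := z) (by simp [hz])).ne h.symm
  have m3 : ∀ z ∈ C, z ≠ v := fun z hz h => (hv.adj (z := z) (by simp [hz])).ne h.symm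
  have m4 : ∀ z ∈ A, z ≠ b := by rintro z hz rfl; exact n1.2.1 hz
  have m5 : ∀ z ∈ B, z ≠ a := by rintro z hz rfl; exact n3.2.1 hz
  have m6 : ∀ z ∈ A, z ≠ v := by rintro z hz rfl; exact n1.1.2 hz
  have m7 : ∀ z ∈ B, z ≠ v := by rintro z hz rfl; exact n3.1.2 hz
  have m8 : ∀ z ∈ C, z ≠ a := by rintro z hz rfl; exact n2.1.2 hz
  have m9 : ∀ z ∈ C, z ≠ b := by rintro z hz rfl; exact n2.2.1 hz
  constructor
  · simp [DT, vs, a1.ne, a2.ne, n2.1.1]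
  · simp only [DT, vs, List.mem_cons, List.not_mem_nil, or_false, List.map_cons, List.map_nil]
    rintro d (rfl | rfl | rfl)
    · exact ⟨ha, by simp, by simp, fun z hz => by simp [m1 z hz, m6 z hz, m4 z hz]⟩
    · exact ⟨hv, by simp, by simp, fun z hz => by simp [m3 z hz, m8 z hz, m9 z hz]⟩
    · exact ⟨hb, by simp, by simp, fun z hz => by simp [m2 z hz, m7 z hz, m5 z hz]⟩

theorem hf_DP (a v b : V) (A C B : List V) : hf (DP a v b A C B) = A ++ (C ++ B) := by simp [hf, DP]
theorem hf_DT (a v b : V) (A C B : List V) : hf (DT a v b A C B) = A ++ (C ++ B) := by simp [hf, DT]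
theorem VS_DP (a v b : V) (A C B : List V) (z : V) : z ∈ VS (DP a v b A C B) ↔ z = a ∨ z = v ∨ z = b := by
  simp [VS, vs, DP]
theorem VS_DT (a v b : V) (A C B : List V) (z : V) : z ∈ VS (DT a v b A C B) ↔ z = a ∨ z = v ∨ z = b := by
  simp [VS, vs, DT]

theorem ext_DP {G : SimpleGraph V} {a v b : V} {A C B : List V} (ha : NL G a (v :: A)) (hv : NL G v (a :: b :: C))
    (hb : NL G b (v :: B)) (hn : ¬ G.Adj a b) (hA : A ≠ []) (hB : B ≠ []) {p q : V}
    (hpq : p ≠ q → p ∈ A ∧ q ∈ B) : Ext G (VS (DP a v b A C B)) p q 1 := by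
  have hD := patch_DP ha hv hb hn
  have hab : a ≠ b := by
    have := hv.1
    simp only [List.nodup_cons, List.mem_cons, not_or] at this
    exact this.1.1
  have out : ∀ z, z ∈ A ∨ z ∈ B → z ∉ VS (DP a v b A C B) := by
    intro z hz
    rw [mem_VS]
    rcases hz with hz | hz
    · exact (hD.h (a, [v], A) (by simp [DP])).2.2.2 z hz
    · exact (hD.h (b, [v], B) (by simp [DP])).2.2.2 z hz
  by_cases h : p = q
  · obtain ⟨x, hx⟩ := List.exists_mem_of_ne_nil _ hA
    obtain ⟨y, hy⟩ := List.exists_mem_of_ne_nil _ hB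
    exact ext_P3 (VS_DP a v b A C B) (ha.adj (by simp)) (hv.adj (by simp)) hab (ha.adj (z := x) (by simp [hx]))
      (hb.adj (z := y) (by simp [hy])) (Or.inl h) (out x (Or.inl hx)) (out y (Or.inr hy))
  · exact ext_P3 (VS_DP a v b A C B) (ha.adj (by simp)) (hv.adj (by simp)) hab (ha.adj (z := p) (by simp [hpq h]))
      (hb.adj (z := q) (by simp [hpq h])) (Or.inr (Or.inl ⟨rfl, rfl⟩)) (out p (Or.inl (hpq h).1)) (out q (Or.inr (hpq h).2))

theorem ext_DT {G : SimpleGraph V} {a v b : V} {A C B : List V} (ha : NL G a (v :: b :: A)) (hv : NL G v (a :: b :: C))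
    (hb : NL G b (v :: a :: B)) (hA : A ≠ []) (hB : B ≠ []) {p q : V}
    (hpq : p ≠ q → p ∈ A ∧ q ∈ B) : Ext G (VS (DT a v b A C B)) p q 1 := by
  have hD := patch_DT ha hv hb
  have hab : a ≠ b := by
    have := hv.1
    simp only [List.nodup_cons, List.mem_cons, not_or] at this
    exact this.1.1
  have out : ∀ z, z ∈ A ∨ z ∈ B → z ∉ VS (DT a v b A C B) := by
    intro z hz
    rw [mem_VS]
    rcases hz with hz | hz
    · exact (hD.h (a, [v, b], A) (by simp [DT])).2.2.2 z hz
    · exact (hD.h (b, [v, a], B) (by simp [DT])).2.2.2 z hz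
  by_cases h : p = q
  · obtain ⟨x, hx⟩ := List.exists_mem_of_ne_nil _ hA
    obtain ⟨y, hy⟩ := List.exists_mem_of_ne_nil _ hB
    exact ext_P3 (VS_DT a v b A C B) (ha.adj (by simp)) (hv.adj (by simp)) hab (ha.adj (z := x) (by simp [hx]))
      (hb.adj (z := y) (by simp [hy])) (Or.inl h) (out x (Or.inl hx)) (out y (Or.inr hy))
  · exact ext_P3 (VS_DT a v b A C B) (ha.adj (by simp)) (hv.adj (by simp)) hab (ha.adj (z := p) (by simp [hpq h]))
      (hb.adj (z := q) (by simp [hpq h])) (Or.inr (Or.inl ⟨rfl, rfl⟩)) (out p (Or.inl (hpq h).1)) (out q (Or.inr (hpq h).2))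

/-- Interior vertices of `L`. -/
def In (G : SimpleGraph V) (L : Finset V) (v : V) : Prop := v ∈ L ∧ ∀ z, G.Adj v z → z ∈ L

theorem int_of_In {G : SimpleGraph V} {L : Finset V} {D : Pt V} (hD : Patch G D) (h : ∀ z ∈ vs D, In G L z) : Int L D := by
  refine ⟨fun z hz => (h z hz).1, fun z hz => ?_⟩
  simp only [hf, List.mem_flatMap] at hz
  obtain ⟨d, hd, hz⟩ := hz
  refine (h d.1 (by simp only [vs, List.mem_map]; exact ⟨d, hd, rfl⟩)).2 z ?_
  exact ((hD.h d hd).1.2 z).2 (by simp [hz])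

/-- Path reduction, no new edge or one new edge, at most three half edges. -/
theorem P3L {U L : Finset V} {G : SimpleGraph V} (hG : Good U G) (ih : IH U) (hL : MinL U G L)
    {a v b : V} {A C B : List V} (ha : NL G a (v :: A)) (hv : NL G v (a :: b :: C))
    (hb : NL G b (v :: B)) (hn : ¬ G.Adj a b) (hA : A ≠ []) (hB : B ≠ [])
    (ia : In G L a) (iv : In G L v) (ib : In G L b) (p q : V)
    (hpq : p ≠ q → p ∈ A ∧ q ∈ B ∧ ¬ G.Adj p q)
    (hlen : A.length + (C.length + B.length) ≤ 3)
    (hdeg : ∀ z ∈ A ++ (C ++ B), 2 + cnt (· = z) (A ++ (C ++ B)) ≤ dg G z + nw p q z) : Bd U G 4 := by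
  have hD := patch_DP ha hv hb hn
  refine stepL hG ih hL hD ?_ (by rw [hf_DP]; simp [hA]) p q 1 ?_ (by rw [hf_DP]; exact hdeg) ?_
    (ext_DP ha hv hb hn hA hB (fun h => ⟨(hpq h).1, (hpq h).2.1⟩)) ?_
  · apply int_of_In hD
    simp [DP, vs, ia, iv, ib]
  · intro h; rw [hf_DP]; simp [hpq h]
  · intro W h1 h2 _ _
    rw [hf_DP] at h1 h2
    exact small_conn (by simpa using hlen) W h1 h2
  · simp only [DP, drop, List.length_cons, List.length_nil]
    split_ifs <;> push_cast <;> omega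

/-- Path reduction with four half edges and a new edge. -/
theorem P3L4 {U L : Finset V} {G : SimpleGraph V} (hG : Good U G) (ih : IH U) (hL : MinL U G L)
    {a v b : V} {A C B : List V} (ha : NL G a (v :: A)) (hv : NL G v (a :: b :: C))
    (hb : NL G b (v :: B)) (hn : ¬ G.Adj a b) (p q : V) (hA : p ∈ A) (hB : q ∈ B) (hne : p ≠ q) (hnpq : ¬ G.Adj p q)
    (hlen : A.length + (C.length + B.length) ≤ 4)
    (hdeg : ∀ z ∈ A ++ (C ++ B), 2 + cnt (· = z) (A ++ (C ++ B)) ≤ dg G z + nw p q z)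
    (hconn : ∀ W ⊆ U \ VS (DP a v b A C B), W.Nonempty → W ≠ U \ VS (DP a v b A C B) →
      (∀ u ∈ W, ∀ v', v' ∉ VS (DP a v b A C B) → G.Adj u v' → v' ∈ W) → (p ∈ W ↔ q ∈ W) → False) :
    Bd U G 4 := by
  have hD := patch_DP ha hv hb hn
  have hA' : A ≠ [] := List.ne_nil_of_mem hA
  have hB' : B ≠ [] := List.ne_nil_of_mem hB
  refine step hG ih hD (by rw [hf_DP]; simp [hA']) p q 1 ?_ (by rw [hf_DP]; exact hdeg) ?_
    (ext_DP ha hv hb hn hA' hB' (fun h => ⟨hA, hB⟩)) ?_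
  · intro h; rw [hf_DP]; simp [hA, hB, hnpq]
  · intro W h1 h2 h3 h4 h5
    exact hconn W h1 h2 h3 h4 (h5 hne)
  · simp only [DP, drop, List.length_cons, List.length_nil]
    simp [hne]; omega

/-- Triangle reduction. -/
theorem TRL {U L : Finset V} {G : SimpleGraph V} (hG : Good U G) (ih : IH U) (hL : MinL U G L)
    {a v b : V} {A C B : List V} (ha : NL G a (v :: b :: A)) (hv : NL G v (a :: b :: C))
    (hb : NL G b (v :: a :: B)) (hA : A ≠ []) (hB : B ≠ [])
    (ia : In G L a) (iv : In G L v) (ib : In G L b) (p q : V)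
    (hpq : p ≠ q → p ∈ A ∧ q ∈ B ∧ ¬ G.Adj p q)
    (hlen : A.length + (C.length + B.length) ≤ if p = q then 2 else 3)
    (hdeg : ∀ z ∈ A ++ (C ++ B), 2 + cnt (· = z) (A ++ (C ++ B)) ≤ dg G z + nw p q z) : Bd U G 4 := by
  have hD := patch_DT ha hv hb
  refine stepL hG ih hL hD ?_ (by rw [hf_DT]; simp [hA]) p q 1 ?_ (by rw [hf_DT]; exact hdeg) ?_
    (ext_DT ha hv hb hA hB (fun h => ⟨(hpq h).1, (hpq h).2.1⟩)) ?_
  · apply int_of_In hD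
    simp [DT, vs, ia, iv, ib]
  · intro h; rw [hf_DT]; simp [hpq h]
  · intro W h1 h2 _ _
    rw [hf_DT] at h1 h2
    refine small_conn (l := A ++ (C ++ B)) ?_ W h1 h2
    simp only [List.length_append]
    split_ifs at hlen <;> omega
  · simp only [DT, drop, List.length_cons, List.length_nil]
    split_ifs at hlen ⊢ <;> push_cast <;> omega

theorem deg_simp_test {G : SimpleGraph V} {a b p q : V} (ha : dg G a = 3) (hb : dg G b = 3) (hab : a ≠ b) :
    ∀ z ∈ [a] ++ ([] ++ [b]), 2 + cnt (· = z) ([a] ++ ([] ++ [b])) ≤ dg G z + nw p p z := by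
  simp [cnt, nw, ha, hb, hab, hab.symm]

noncomputable def nbl (G : SimpleGraph V) (v : V) : List V := (Finset.univ.filter (fun z => G.Adj v z)).toList

theorem nbl_NL (G : SimpleGraph V) (v : V) : NL G v (nbl G v) :=
  ⟨Finset.nodup_toList _, fun z => by simp [nbl]⟩

/-- Patch of a set all of whose neighbours are removed. -/
noncomputable def LP (G : SimpleGraph V) (W : Finset V) : Pt V := W.toList.map (fun v => (v, nbl G v, []))

theorem vs_LP (G : SimpleGraph V) (W : Finset V) : vs (LP G W) = W.toList := by
  simp [vs, LP, Function.comp_def]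

theorem hf_LP (G : SimpleGraph V) (W : Finset V) : hf (LP G W) = [] := by
  simp [hf, LP]

theorem hf_cons (d : V × List V × List V) (D : Pt V) : hf (d :: D) = d.2.2 ++ hf D := by simp [hf]
theorem vs_cons (d : V × List V × List V) (D : Pt V) : vs (d :: D) = d.1 :: vs D := by simp [vs]

theorem drop_LP (G : SimpleGraph V) (W : Finset V) : drop (LP G W) = wt G W := by
  have : wt G W = (W.toList.map (fun v => 7 - (dg G v : ℤ))).sum := by
    unfold wt; rw [Finset.sum_map_toList]
  rw [this]
  unfold LP
  induction W.toList with
  | nil => rfl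
  | cons a l ih =>
    simp only [List.map_cons, drop, ih, List.sum_cons, (nbl_NL G a).dg]
    simp

theorem Good.nbl_ne {U : Finset V} {G : SimpleGraph V} (hG : Good U G) {v : V} (hv : v ∈ U) : nbl G v ≠ [] := by
  intro h
  have h1 := (nbl_NL G v).dg
  rw [h] at h1
  have := hG.deg v hv
  simp at h1; omega

/-- Patch made of an explicit part `E` and a set `W`. -/
theorem patch_LP {U : Finset V} {G : SimpleGraph V} (hG : Good U G) {W : Finset V} (hW : W ⊆ U) {E : Pt V}
    (hE : (vs E).Nodup) (hdis : ∀ z ∈ vs E, z ∉ W)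
    (hcl : ∀ v ∈ W, ∀ z, G.Adj v z → z ∈ W ∨ z ∈ vs E)
    (h : ∀ d ∈ E, NL G d.1 (d.2.1 ++ d.2.2) ∧ d.2.1 ≠ [] ∧ (∀ z ∈ d.2.1, z ∈ W ∨ z ∈ vs E) ∧
      (∀ z ∈ d.2.2, z ∉ W ∧ z ∉ vs E)) : Patch G (E ++ LP G W) := by
  have e : vs (E ++ LP G W) = vs E ++ W.toList := by rw [← vs_LP G W]; simp [vs]
  constructor
  · rw [e, List.nodup_append]
    refine ⟨hE, Finset.nodup_toList _, ?_⟩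
    intro a ha b hb hab
    subst hab
    exact hdis a ha (by simpa using hb)
  · intro d hd
    rw [List.mem_append] at hd
    rcases hd with hd | hd
    · obtain ⟨h1, h2, h3, h4⟩ := h d hd
      refine ⟨h1, h2, ?_, ?_⟩
      · intro z hz; rw [e]; have := h3 z hz; simp; tauto
      · intro z hz; rw [e]; have := h4 z hz; simp; tauto
    · simp only [LP, List.mem_map, Finset.mem_toList] at hd
      obtain ⟨v, hv, rfl⟩ := hd
      refine ⟨by simpa using nbl_NL G v, hG.nbl_ne (hW hv), ?_, by simp⟩
      intro z hz
      rw [e]; have := hcl v hv z (((nbl_NL G v).2 z).2 hz); simp; tauto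

theorem hf_app (E D : Pt V) : hf (E ++ D) = hf E ++ hf D := by simp [hf]
theorem drop_app (E D : Pt V) : drop (E ++ D) = drop E + drop D := by
  induction E with
  | nil => simp [drop]
  | cons a l ih => simp [drop, ih]; ring
theorem VS_app_LP (G : SimpleGraph V) (E : Pt V) (W : Finset V) (z : V) : z ∈ VS (E ++ LP G W) ↔ z ∈ vs E ∨ z ∈ W := by
  have e : vs (E ++ LP G W) = vs E ++ W.toList := by rw [← vs_LP G W]; simp [vs]
  rw [mem_VS, e]; simp

/-- Basic connectivity. -/
theorem conn0 {U : Finset V} {G : SimpleGraph V} (hG : Good U G) {D : Pt V} (hD : Patch G D) (hn : D ≠ [])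
    {W : Finset V} (hW : W ⊆ U \ VS D) (hWn : W.Nonempty) (hWp : W ≠ U \ VS D)
    (hcl : ∀ u ∈ W, ∀ v, v ∉ VS D → G.Adj u v → v ∈ W) :
    (∃ z ∈ hf D, z ∈ W) ∧ ∃ z ∈ hf D, z ∉ W := by
  have hX : ∃ x ∈ VS D, x ∈ U := by
    obtain ⟨d, hd⟩ := List.exists_mem_of_ne_nil _ hn
    have h : d.1 ∈ VS D := by rw [mem_VS]; simp only [vs, List.mem_map]; exact ⟨d, hd, rfl⟩
    exact ⟨d.1, h, hD.sub hG h⟩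
  have key : ∀ Z : Finset V, Z ⊆ U \ VS D → Z.Nonempty → (∀ u ∈ Z, ∀ v, v ∉ VS D → G.Adj u v → v ∈ Z) →
      ∃ z ∈ hf D, z ∈ Z := by
    intro Z hZ hZn hZc
    by_contra hno
    push Not at hno
    have : Z = U := by
      apply hG.conn Z (hZ.trans Finset.sdiff_subset) hZn
      intro u hu v huv
      by_cases hv : v ∈ VS D
      · exfalso
        have h1 := hD.hf_of_adj hv (Finset.mem_sdiff.1 (hZ hu)).2 huv.symm
        simp only [List.mem_flatMap, List.mem_map, Prod.mk.injEq] at h1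
        obtain ⟨d, hd, y, hy, rfl, rfl⟩ := h1
        exact hno y (by simp only [hf, List.mem_flatMap]; exact ⟨d, hd, hy⟩) hu
      · exact hZc u hu v hv huv
    obtain ⟨x, hx, hxU⟩ := hX
    rw [← this] at hxU
    exact (Finset.mem_sdiff.1 (hZ hxU)).2 hx
  refine ⟨key W hW hWn hcl, ?_⟩
  have := key ((U \ VS D) \ W) Finset.sdiff_subset ?_ ?_
  · obtain ⟨z, h1, h2⟩ := this
    exact ⟨z, h1, (Finset.mem_sdiff.1 h2).2⟩
  · rw [Finset.sdiff_nonempty]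
    exact fun h => hWp (Finset.Subset.antisymm hW h)
  · intro u hu v hv huv
    rw [Finset.mem_sdiff, Finset.mem_sdiff] at hu ⊢
    exact ⟨⟨hG.sub v u huv.symm, hv⟩, fun h => hu.2 (hcl v h u hu.1.2 huv.symm)⟩

def OK (G : SimpleGraph V) (W S : Finset V) (v : V) : Prop :=
  (∃ u ∈ S, G.Adj v u) ∧ ∃ u ∈ W, u ∉ S ∧ G.Adj v u

def PrR (G : SimpleGraph V) (W : Finset V) (x : V) (k : ℕ) : Prop :=
  ∃ S ⊆ W, S.card ≤ k ∧ x ∈ S ∧ ∀ v ∈ W, v ∉ S → OK G W S v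
def PrQ (G : SimpleGraph V) (W : Finset V) (x : V) (k : ℕ) : Prop :=
  ∃ S ⊆ W, S.card ≤ k ∧ x ∉ S ∧ (∃ u ∈ S, G.Adj x u) ∧ ∀ v ∈ W, v ≠ x → v ∉ S → OK G W S v
def PrS (G : SimpleGraph V) (W : Finset V) (x : V) (k : ℕ) : Prop :=
  ∃ S ⊆ W, S.card ≤ k ∧ x ∉ S ∧ (∃ u ∈ W, u ∉ S ∧ G.Adj x u) ∧ ∀ v ∈ W, v ≠ x → v ∉ S → OK G W S v

structure Lobe (U : Finset V) (G : SimpleGraph V) (W : Finset V) (x y : V) : Prop where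
  sub : W ⊆ U
  hx : x ∈ W
  hy : y ∉ W
  xy : G.Adj x y
  cl : ∀ v ∈ W, ∀ z, G.Adj v z → z ∈ W ∨ (v = x ∧ z = y)

inductive LT (G : SimpleGraph V) (W : Finset V) (x : V) : Prop
  | t0 (k : ℕ) (r : PrR G W x k) (q : PrQ G W x k) (s : PrS G W x k) (h : 10 * (k : ℤ) + 2 ≤ wt G W)
  | t1 (k : ℕ) (r : PrR G W x (k + 1)) (q : PrQ G W x k) (s : PrS G W x k) (h : 10 * (k : ℤ) + 4 ≤ wt G W)
  | t2 (k : ℕ) (r : PrR G W x (k + 1)) (q : PrQ G W x (k + 1)) (s : PrS G W x k) (h : 10 * (k : ℤ) + 9 ≤ wt G W)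

/-- Types 0 and 1 with cubic exit: remove the lobe. -/
theorem lobe01 {U : Finset V} {G : SimpleGraph V} (hG : Good U G) (ih : IH U) {W : Finset V} {x y : V}
    (hl : Lobe U G W x y) (hy : dg G y = 3) {k : ℕ} (q : PrQ G W x k) (s : PrS G W x k)
    (h : 10 * (k : ℤ) + 2 ≤ wt G W) : Bd U G 4 := by
  obtain ⟨l, hlx⟩ : ∃ l, NL G x (l ++ [y]) := by
    rcases hG.nl1 hl.xy with ⟨b, h⟩ | ⟨b, c, h⟩
    · exact ⟨[b], by simpa using h.r21⟩
    · exact ⟨[b, c], by simpa using h.r231⟩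
  have hln : l ≠ [] := by
    rintro rfl
    have h1 := hlx.dg
    have := hG.deg x (hl.sub hl.hx)
    simp at h1; omega
  have hlW : ∀ z ∈ l, z ∈ W := by
    intro z hz
    rcases hl.cl x hl.hx z (hlx.adj (by simp [hz])) with h | ⟨-, rfl⟩
    · exact h
    · have := hlx.1
      rw [List.nodup_append] at this
      exact absurd rfl (this.2.2 z hz z (by simp))
  have hD : Patch G ([(x, l, [y])] ++ LP G (W.erase x)) := by
    apply patch_LP hG ((Finset.erase_subset _ _).trans hl.sub)
    · simp [vs]
    · simp [vs]
    · intro v hv z hvz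
      rw [Finset.mem_erase] at hv ⊢
      have := hl.cl v hv.2 z hvz
      simp [vs]; tauto
    · simp only [List.mem_singleton, forall_eq]
      refine ⟨hlx, hln, ?_, ?_⟩
      · intro z hz; have := hlW z hz; simp [vs]; tauto
      · simp [vs]; exact ⟨fun _ => hl.hy, hl.xy.ne.symm⟩
  have hVS : VS ([(x, l, [y])] ++ LP G (W.erase x)) = W := by
    ext z; rw [VS_app_LP]; simp [vs]
    constructor
    · rintro (rfl | h); exacts [hl.hx, h.2]
    · tauto
  have hhf : hf ([(x, l, [y])] ++ LP G (W.erase x)) = [y] := by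
    rw [hf_app, hf_LP]; simp [hf]
  refine step hG ih hD (by rw [hhf]; simp) x x k (by simp) ?_ ?_ ?_ ?_
  · rw [hhf]; simp [cnt, nw, hy]
  · intro W1 h1 h2 h3 h4 _
    obtain ⟨⟨z, hz, hz'⟩, ⟨w, hw, hw'⟩⟩ := conn0 hG hD (by simp) h1 h2 h3 h4
    rw [hhf] at hz hw
    simp at hz hw
    subst hz; subst hw; exact hw' hz'
  · rw [hVS]
    intro S hS
    by_cases hyS : y ∈ S
    · obtain ⟨S', a1, a2, a3, ⟨u, a4, a5, a6⟩, a7⟩ := s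
      refine ⟨S', a1, a2, ?_, by simp, by simp⟩
      intro v hv hvS
      by_cases hvx : v = x
      · subst hvx
        exact ⟨⟨y, Or.inl hyS, hl.xy⟩, ⟨u, ⟨fun h => hS u h a4, a5⟩, a6⟩⟩
      · obtain ⟨⟨u, b1, b2⟩, ⟨w, b3, b4, b5⟩⟩ := a7 v hv hvx hvS
        exact ⟨⟨u, Or.inr b1, b2⟩, ⟨w, ⟨fun h => hS w h b3, b4⟩, b5⟩⟩
    · obtain ⟨S', a1, a2, a3, ⟨u, a4, a6⟩, a7⟩ := q
      refine ⟨S', a1, a2, ?_, by simp, by simp⟩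
      intro v hv hvS
      by_cases hvx : v = x
      · subst hvx
        exact ⟨⟨u, Or.inr a4, a6⟩, ⟨y, ⟨hyS, fun h => hl.hy (a1 h)⟩, hl.xy⟩⟩
      · obtain ⟨⟨u, b1, b2⟩, ⟨w, b3, b4, b5⟩⟩ := a7 v hv hvx hvS
        exact ⟨⟨u, Or.inr b1, b2⟩, ⟨w, ⟨fun h => hS w h b3, b4⟩, b5⟩⟩
  · rw [drop_app, drop_LP]
    have e1 : wt G W = wt G (W.erase x) + (7 - (dg G x : ℤ)) := by
      unfold wt; rw [Finset.sum_erase_add _ _ hl.hx]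
    have e2 := hlx.dg
    simp at e2
    simp [drop]
    omega

/-- `PrS` together with a dominating exit vertex. -/
theorem extS {U : Finset V} {G : SimpleGraph V} {W : Finset V} {x y : V} (hl : Lobe U G W x y) {k : ℕ}
    (s : PrS G W x k) (X S : Finset V) (hWX : W ⊆ X) (hS : ∀ v ∈ S, v ∉ X) (E : Finset V) (hE : ∀ z ∈ E, z ∉ W)
    (hy : y ∈ E) : ∃ Sx ⊆ W, Sx.card ≤ k ∧ x ∉ Sx ∧
      ∀ v ∈ W, v ∉ Sx → (∃ u, (u ∈ S ∨ u ∈ Sx ∪ E) ∧ G.Adj v u) ∧ (∃ u, (u ∉ S ∧ u ∉ Sx ∪ E) ∧ G.Adj v u) := by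
  obtain ⟨S', a1, a2, a3, ⟨u, a4, a5, a6⟩, a7⟩ := s
  refine ⟨S', a1, a2, a3, ?_⟩
  intro v hv hvS
  simp only [Finset.mem_union, not_or]
  by_cases hvx : v = x
  · subst hvx
    exact ⟨⟨y, Or.inr (Or.inr hy), hl.xy⟩, ⟨u, ⟨fun h => hS u h (hWX a4), a5, fun h => hE u h a4⟩, a6⟩⟩
  · obtain ⟨⟨u, b1, b2⟩, ⟨w, b3, b4, b5⟩⟩ := a7 v hv hvx hvS
    exact ⟨⟨u, Or.inr (Or.inl b1), b2⟩, ⟨w, ⟨fun h => hS w h (hWX b3), b4, fun h => hE w h b3⟩, b5⟩⟩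

theorem extQ {U : Finset V} {G : SimpleGraph V} {W : Finset V} {x y : V} (hl : Lobe U G W x y) {k : ℕ}
    (s : PrQ G W x k) (X S : Finset V) (hWX : W ⊆ X) (hS : ∀ v ∈ S, v ∉ X) (E : Finset V) (hE : ∀ z ∈ E, z ∉ W)
    (hy : y ∉ E) (hyS : y ∉ S) : ∃ Sx ⊆ W, Sx.card ≤ k ∧ x ∉ Sx ∧
      ∀ v ∈ W, v ∉ Sx → (∃ u, (u ∈ S ∨ u ∈ Sx ∪ E) ∧ G.Adj v u) ∧ (∃ u, (u ∉ S ∧ u ∉ Sx ∪ E) ∧ G.Adj v u) := by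
  obtain ⟨S', a1, a2, a3, ⟨u, a4, a6⟩, a7⟩ := s
  refine ⟨S', a1, a2, a3, ?_⟩
  intro v hv hvS
  simp only [Finset.mem_union, not_or]
  by_cases hvx : v = x
  · subst hvx
    exact ⟨⟨u, Or.inr (Or.inl a4), a6⟩, ⟨y, ⟨hyS, fun h => hl.hy (a1 h), hy⟩, hl.xy⟩⟩
  · obtain ⟨⟨u, b1, b2⟩, ⟨w, b3, b4, b5⟩⟩ := a7 v hv hvx hvS
    exact ⟨⟨u, Or.inr (Or.inl b1), b2⟩, ⟨w, ⟨fun h => hS w h (hWX b3), b4, fun h => hE w h b3⟩, b5⟩⟩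

theorem extR {U : Finset V} {G : SimpleGraph V} {W : Finset V} {x y : V} (hl : Lobe U G W x y) {k : ℕ}
    (s : PrR G W x k) (X S : Finset V) (hWX : W ⊆ X) (hS : ∀ v ∈ S, v ∉ X) (E : Finset V) (hE : ∀ z ∈ E, z ∉ W) :
    ∃ Sx ⊆ W, Sx.card ≤ k ∧ x ∈ Sx ∧
      ∀ v ∈ W, v ∉ Sx → (∃ u, (u ∈ S ∨ u ∈ Sx ∪ E) ∧ G.Adj v u) ∧ (∃ u, (u ∉ S ∧ u ∉ Sx ∪ E) ∧ G.Adj v u) := by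
  obtain ⟨S', a1, a2, a3, a7⟩ := s
  refine ⟨S', a1, a2, a3, ?_⟩
  intro v hv hvS
  simp only [Finset.mem_union, not_or]
  obtain ⟨⟨u, b1, b2⟩, ⟨w, b3, b4, b5⟩⟩ := a7 v hv hvS
  exact ⟨⟨u, Or.inr (Or.inl b1), b2⟩, ⟨w, ⟨fun h => hS w h (hWX b3), b4, fun h => hE w h b3⟩, b5⟩⟩

/-- Good selection inside a lobe, relative to a selection `E` outside. -/
def Fill (G : SimpleGraph V) (W : Finset V) (x y : V) (E : Finset V) (k : ℕ) (b : Prop) : Prop :=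
  ∃ Sx ⊆ W, Sx.card ≤ k ∧ (x ∈ Sx ↔ b) ∧
    ∀ v ∈ W, v ∉ Sx → (∃ u ∈ Sx ∪ E, G.Adj v u) ∧ (∃ u, (u ∈ W ∨ u = y) ∧ u ∉ Sx ∪ E ∧ G.Adj v u)

theorem fillS {U : Finset V} {G : SimpleGraph V} {W : Finset V} {x y : V} (hl : Lobe U G W x y) {k : ℕ}
    (s : PrS G W x k) (E : Finset V) (hE : ∀ z ∈ E, z ∉ W) (hy : y ∈ E) : Fill G W x y E k False := by
  obtain ⟨S', a1, a2, a3, ⟨u, a4, a5, a6⟩, a7⟩ := s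
  refine ⟨S', a1, a2, by simpa using a3, ?_⟩
  intro v hv hvS
  simp only [Finset.mem_union, not_or]
  by_cases hvx : v = x
  · subst hvx
    exact ⟨⟨y, Or.inr hy, hl.xy⟩, ⟨u, Or.inl a4, ⟨a5, fun h => hE u h a4⟩, a6⟩⟩
  · obtain ⟨⟨u, b1, b2⟩, ⟨w, b3, b4, b5⟩⟩ := a7 v hv hvx hvS
    exact ⟨⟨u, Or.inl b1, b2⟩, ⟨w, Or.inl b3, ⟨b4, fun h => hE w h b3⟩, b5⟩⟩

theorem fillQ {U : Finset V} {G : SimpleGraph V} {W : Finset V} {x y : V} (hl : Lobe U G W x y) {k : ℕ}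
    (s : PrQ G W x k) (E : Finset V) (hE : ∀ z ∈ E, z ∉ W) (hy : y ∉ E) : Fill G W x y E k False := by
  obtain ⟨S', a1, a2, a3, ⟨u, a4, a6⟩, a7⟩ := s
  refine ⟨S', a1, a2, by simpa using a3, ?_⟩
  intro v hv hvS
  simp only [Finset.mem_union, not_or]
  by_cases hvx : v = x
  · subst hvx
    exact ⟨⟨u, Or.inl a4, a6⟩, ⟨y, Or.inr rfl, ⟨fun h => hl.hy (a1 h), hy⟩, hl.xy⟩⟩
  · obtain ⟨⟨u, b1, b2⟩, ⟨w, b3, b4, b5⟩⟩ := a7 v hv hvx hvS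
    exact ⟨⟨u, Or.inl b1, b2⟩, ⟨w, Or.inl b3, ⟨b4, fun h => hE w h b3⟩, b5⟩⟩

theorem fillR {U : Finset V} {G : SimpleGraph V} {W : Finset V} {x y : V} (hl : Lobe U G W x y) {k : ℕ}
    (s : PrR G W x k) (E : Finset V) (hE : ∀ z ∈ E, z ∉ W) : Fill G W x y E k True := by
  obtain ⟨S', a1, a2, a3, a7⟩ := s
  refine ⟨S', a1, a2, by simpa using a3, ?_⟩
  intro v hv hvS
  simp only [Finset.mem_union, not_or]
  obtain ⟨⟨u, b1, b2⟩, ⟨w, b3, b4, b5⟩⟩ := a7 v hv hvS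
  exact ⟨⟨u, Or.inl b1, b2⟩, ⟨w, Or.inl b3, ⟨b4, fun h => hE w h b3⟩, b5⟩⟩

theorem Fill.ext {G : SimpleGraph V} {W E : Finset V} {x y : V} {k : ℕ} {b : Prop} (hx : x ∈ W) (h : Fill G W x y E k b)
    {X F : Finset V} (hX : ∀ z, z ∈ X ↔ z ∈ F ∨ z ∈ W) (hFW : ∀ z ∈ F, z ∉ W) (hy : y ∈ F) (hEF : E ⊆ F)
    {S : Finset V} (hS : ∀ v ∈ S, v ∉ X) {c : ℕ} (hc : E.card + k ≤ c) {p q : V}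
    (h1 : ∀ v ∈ F, v ∉ E → (∃ u, (u ∈ S ∨ u ∈ E ∨ (u = x ∧ b)) ∧ G.Adj v u) ∧
      ∃ u, ((u ∉ S ∧ u ∉ F ∧ u ∉ W) ∨ (u ∈ F ∧ u ∉ E) ∨ (u = x ∧ ¬ b)) ∧ G.Adj v u)
    (h2 : p ≠ q → p ∉ S → (q ∈ S → ∃ u ∈ E, G.Adj p u) ∧ (q ∉ S → ∃ u ∈ F, u ∉ E ∧ G.Adj p u))
    (h3 : p ≠ q → q ∉ S → (p ∈ S → ∃ u ∈ E, G.Adj q u) ∧ (p ∉ S → ∃ u ∈ F, u ∉ E ∧ G.Adj q u)) :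
    ∃ Sx ⊆ X, Sx.card ≤ c ∧
    (∀ v ∈ X, v ∉ Sx → (∃ u, (u ∈ S ∨ u ∈ Sx) ∧ G.Adj v u) ∧ (∃ u, (u ∉ S ∧ u ∉ Sx) ∧ G.Adj v u)) ∧
    (p ≠ q → p ∉ S → (q ∈ S → ∃ u ∈ Sx, G.Adj p u) ∧ (q ∉ S → ∃ u ∈ X, u ∉ Sx ∧ G.Adj p u)) ∧
    (p ≠ q → q ∉ S → (p ∈ S → ∃ u ∈ Sx, G.Adj q u) ∧ (p ∉ S → ∃ u ∈ X, u ∉ Sx ∧ G.Adj q u)) := by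
  obtain ⟨Sx, a1, a2, a3, a4⟩ := h
  have nX : ∀ u, u ∈ X → u ∉ S := fun u hu h => hS u h hu
  have nF : ∀ u, u ∈ F → u ∉ Sx := fun u hu h => hFW u hu (a1 h)
  have edge : ∀ p q, ((q ∈ S → ∃ u ∈ E, G.Adj p u) ∧ (q ∉ S → ∃ u ∈ F, u ∉ E ∧ G.Adj p u)) →
     (q ∈ S → ∃ u ∈ Sx ∪ E, G.Adj p u) ∧ (q ∉ S → ∃ u ∈ X, u ∉ Sx ∪ E ∧ G.Adj p u) := by
    rintro p q ⟨e1, e2⟩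
    refine ⟨fun h => ?_, fun h => ?_⟩
    · obtain ⟨u, f1, f2⟩ := e1 h; exact ⟨u, by simp [f1], f2⟩
    · obtain ⟨u, f1, f2, f3⟩ := e2 h; exact ⟨u, by simp [hX, f1], by simp [f2, nF u f1], f3⟩
  refine ⟨Sx ∪ E, ?_, ?_, ?_, ?_, ?_⟩
  · intro z hz
    rw [hX]
    rcases Finset.mem_union.1 hz with h | h
    · exact Or.inr (a1 h)
    · exact Or.inl (hEF h)
  · have := Finset.card_union_le Sx E; omega
  · intro v hv hvS
    simp only [Finset.mem_union, not_or] at hvS ⊢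
    rw [hX] at hv
    by_cases hvW : v ∈ W
    · obtain ⟨⟨u, b1, b2⟩, ⟨w, b3, b4, b5⟩⟩ := a4 v hvW hvS.1
      simp only [Finset.mem_union, not_or] at b1 b4
      refine ⟨⟨u, Or.inr b1, b2⟩, ⟨w, ⟨?_, b4⟩, b5⟩⟩
      apply nX; rw [hX]
      rcases b3 with h | h
      · exact Or.inr h
      · subst h; exact Or.inl hy
    · obtain ⟨⟨u, b1, b2⟩, ⟨w, b3, b5⟩⟩ := h1 v (by tauto) hvS.2
      constructor
      · rcases b1 with h | h | ⟨h, hb⟩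
        · exact ⟨u, Or.inl h, b2⟩
        · exact ⟨u, Or.inr (Or.inr h), b2⟩
        · subst h; exact ⟨u, Or.inr (Or.inl (a3.2 hb)), b2⟩
      · rcases b3 with h | h | ⟨h, hb⟩
        · exact ⟨w, ⟨h.1, fun h' => h.2.2 (a1 h'), fun h' => h.2.1 (hEF h')⟩, b5⟩
        · exact ⟨w, ⟨nX w ((hX w).2 (Or.inl h.1)), nF w h.1, h.2⟩, b5⟩
        · subst h; exact ⟨w, ⟨nX w ((hX w).2 (Or.inr hx)), fun h => hb (a3.1 h), fun h => hFW w (hEF h) hx⟩, b5⟩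
  · exact fun h h' => edge p q (h2 h h')
  · exact fun h h' => edge q p (h3 h h')

def Cd (G : SimpleGraph V) (F E : Finset V) (x : V) (b : Prop) (v : V) : Prop :=
  (∃ u, (u ∈ E ∨ (u = x ∧ b)) ∧ G.Adj v u) ∧ ∃ u, ((u ∈ F ∧ u ∉ E) ∨ (u = x ∧ ¬ b)) ∧ G.Adj v u

theorem Fill.core {G : SimpleGraph V} {W E : Finset V} {x y : V} {k : ℕ} {b : Prop} (hx : x ∈ W) (h : Fill G W x y E k b)
    {F : Finset V} (hFW : ∀ z ∈ F, z ∉ W) (hy : y ∈ F) (hEF : E ⊆ F) :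
    ∃ S ⊆ W ∪ F, S.card ≤ k + E.card ∧ (∀ z ∈ F, z ∈ S ↔ z ∈ E) ∧ (x ∈ S ↔ b) ∧ E ⊆ S ∧
      ∀ v ∈ W ∪ F, v ∉ S → (v ∈ F → Cd G F E x b v) → OK G (W ∪ F) S v := by
  obtain ⟨Sx, a1, a2, a3, a4⟩ := h
  have nF : ∀ u, u ∈ F → u ∉ Sx := fun u hu h => hFW u hu (a1 h)
  refine ⟨Sx ∪ E, Finset.union_subset_union a1 hEF, ?_, ?_, ?_, Finset.subset_union_right, ?_⟩
  · have := Finset.card_union_le Sx E; omega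
  · intro z hz; simp [nF z hz]
  · have : x ∉ E := fun h => hFW x (hEF h) hx
    simp [this, a3]
  · intro v hv hvS hC
    simp only [Finset.mem_union, not_or] at hv hvS
    unfold OK
    by_cases hvW : v ∈ W
    · obtain ⟨⟨u, b1, b2⟩, ⟨w, b3, b4, b5⟩⟩ := a4 v hvW hvS.1
      refine ⟨⟨u, b1, b2⟩, ⟨w, ?_, b4, b5⟩⟩
      rw [Finset.mem_union]
      rcases b3 with h | h
      · exact Or.inl h
      · subst h; exact Or.inr hy
    · obtain ⟨⟨u, b1, b2⟩, ⟨w, b3, b5⟩⟩ := hC (by tauto)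
      simp only [Finset.mem_union, not_or]
      constructor
      · rcases b1 with h | ⟨h, hb⟩
        · exact ⟨u, Or.inr h, b2⟩
        · subst h; exact ⟨u, (Or.inl (a3.2 hb)), b2⟩
      · rcases b3 with h | ⟨h, hb⟩
        · exact ⟨w, Or.inr h.1, ⟨nF w h.1, h.2⟩, b5⟩
        · subst h; exact ⟨w, Or.inl hx, ⟨fun h => hb (a3.1 h), fun h => hFW w (hEF h) hx⟩, b5⟩

theorem Fill.prR {G : SimpleGraph V} {W E : Finset V} {x y : V} {k : ℕ} {b : Prop} (hx : x ∈ W) (h : Fill G W x y E k b)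
    {F : Finset V} (hFW : ∀ z ∈ F, z ∉ W) (hy : y ∈ F) (hEF : E ⊆ F) {c : ℕ} (hc : k + E.card ≤ c) {x' : V}
    (hx' : x' ∈ E) (hC : ∀ v ∈ F, v ∉ E → Cd G F E x b v) : PrR G (W ∪ F) x' c := by
  obtain ⟨S, a1, a2, a3, a4, a5, a6⟩ := h.core hx hFW hy hEF
  refine ⟨S, a1, a2.trans hc, a5 hx', fun v hv hvS => a6 v hv hvS fun hF => hC v hF ?_⟩
  rw [← a3 v hF]; exact hvS

theorem Fill.prQ {G : SimpleGraph V} {W E : Finset V} {x y : V} {k : ℕ} {b : Prop} (hx : x ∈ W) (h : Fill G W x y E k b)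
    {F : Finset V} (hFW : ∀ z ∈ F, z ∉ W) (hy : y ∈ F) (hEF : E ⊆ F) {c : ℕ} (hc : k + E.card ≤ c) {x' : V}
    (hx' : x' ∈ F) (hx'' : x' ∉ E) (hd : ∃ u, (u ∈ E ∨ (u = x ∧ b)) ∧ G.Adj x' u)
    (hC : ∀ v ∈ F, v ≠ x' → v ∉ E → Cd G F E x b v) : PrQ G (W ∪ F) x' c := by
  obtain ⟨S, a1, a2, a3, a4, a5, a6⟩ := h.core hx hFW hy hEF
  refine ⟨S, a1, a2.trans hc, by rwa [a3 x' hx'], ?_, fun v hv hvx hvS => a6 v hv hvS fun hF => hC v hF hvx ?_⟩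
  · obtain ⟨u, h | ⟨h, hb⟩, h'⟩ := hd
    · exact ⟨u, a5 h, h'⟩
    · subst h; exact ⟨u, a4.2 hb, h'⟩
  · rw [← a3 v hF]; exact hvS

theorem Fill.prS {G : SimpleGraph V} {W E : Finset V} {x y : V} {k : ℕ} {b : Prop} (hx : x ∈ W) (h : Fill G W x y E k b)
    {F : Finset V} (hFW : ∀ z ∈ F, z ∉ W) (hy : y ∈ F) (hEF : E ⊆ F) {c : ℕ} (hc : k + E.card ≤ c) {x' : V}
    (hx' : x' ∈ F) (hx'' : x' ∉ E) (hd : ∃ u, ((u ∈ F ∧ u ∉ E) ∨ (u = x ∧ ¬ b)) ∧ G.Adj x' u)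
    (hC : ∀ v ∈ F, v ≠ x' → v ∉ E → Cd G F E x b v) : PrS G (W ∪ F) x' c := by
  obtain ⟨S, a1, a2, a3, a4, a5, a6⟩ := h.core hx hFW hy hEF
  refine ⟨S, a1, a2.trans hc, by rwa [a3 x' hx'], ?_, fun v hv hvx hvS => a6 v hv hvS fun hF => hC v hF hvx ?_⟩
  · obtain ⟨u, h | ⟨h, hb⟩, h'⟩ := hd
    · exact ⟨u, by simp [h.1], by rw [a3 u h.1]; exact h.2, h'⟩
    · subst h; exact ⟨u, by simp [hx], by rwa [a4], h'⟩
  · rw [← a3 v hF]; exact hvS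

theorem wt_union {G : SimpleGraph V} {W F : Finset V} (h : ∀ z ∈ F, z ∉ W) : wt G (W ∪ F) = wt G W + wt G F := by
  unfold wt
  rw [Finset.sum_union]
  rw [Finset.disjoint_left]
  exact fun a h1 h2 => h a h2 h1

theorem wt_insert {G : SimpleGraph V} {a : V} {F : Finset V} (h : a ∉ F) : wt G (insert a F) = 7 - dg G a + wt G F := by
  unfold wt
  rw [Finset.sum_insert h]

theorem wt_single {G : SimpleGraph V} {a : V} : wt G {a} = 7 - dg G a := by
  unfold wt
  rw [Finset.sum_singleton]

/-- A closed set is everything. -/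
theorem closed_bd {U : Finset V} {G : SimpleGraph V} (hG : Good U G) {W : Finset V} {x : V} (hW : W ⊆ U) {k : ℕ}
    (r : PrR G W x k) (hcl : ∀ v ∈ W, ∀ z, G.Adj v z → z ∈ W) (h : 10 * (k : ℤ) ≤ wt G W + 4) : Bd U G 4 := by
  obtain ⟨S, a1, a2, a3, a4⟩ := r
  have e : W = U := hG.conn W hW ⟨x, a1 a3⟩ hcl
  subst e
  refine ⟨S, ⟨a1, fun v hv hvS => ?_⟩, ?_⟩
  · obtain ⟨b1, u, b2, b3⟩ := a4 v hv hvS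
    exact ⟨b1, u, b3⟩
  · have : (S.card : ℤ) ≤ k := by exact_mod_cast a2
    linarith

theorem Lobe.out {U : Finset V} {G : SimpleGraph V} {W : Finset V} {x y : V} (hl : Lobe U G W x y) {v z : V}
    (hv : v ∉ W) (h : G.Adj v z) (hz : z ∈ W) : v = y ∧ z = x := by
  rcases hl.cl z hz v h.symm with h' | h'
  · exact absurd h' hv
  · exact ⟨h'.2, h'.1⟩

/-- Remove a lobe together with some explicit vertices, leaving two half edges. -/
theorem lstep {U : Finset V} {G : SimpleGraph V} (hG : Good U G) (ih : IH U) {W : Finset V} {x y : V}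
    (hl : Lobe U G W x y) (E : Pt V) (hnd : (vs E).Nodup) (hdis : ∀ z ∈ vs E, z ∉ W) (hyE : y ∈ vs E)
    (h : ∀ d ∈ E, NL G d.1 (d.2.1 ++ d.2.2) ∧ d.2.1 ≠ [] ∧ (∀ z ∈ d.2.1, z = x ∨ z ∈ vs E) ∧
      (∀ z ∈ d.2.2, z ∉ vs E ∧ z ≠ x)) {a b p q : V} (hhf : hf E = [a, b]) (hab : a ≠ b)
    (hpq : (p = a ∧ q = b ∧ ¬ G.Adj a b) ∨ (p = q ∧ G.Adj a b ∧ dg G a = 3 ∧ dg G b = 3)) {c : ℕ}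
    (hext : Ext G (VS (E ++ LP G W)) p q c) (hdrop : 10 * (c : ℤ) + 1 ≤ wt G W + drop E + if p = q then 0 else 2) :
    Bd U G 4 := by
  have hD : Patch G (E ++ LP G W) := by
    refine patch_LP hG hl.sub hnd hdis ?_ ?_
    · intro v hv z hvz
      rcases hl.cl v hv z hvz with h | h
      · exact Or.inl h
      · right; rw [h.2]; exact hyE
    · intro d hd
      obtain ⟨h1, h2, h3, h4⟩ := h d hd
      refine ⟨h1, h2, ?_, ?_⟩
      · intro z hz
        rcases h3 z hz with h | h
        · left; rw [h]; exact hl.hx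
        · exact Or.inr h
      · intro z hz
        refine ⟨fun hzW => ?_, (h4 z hz).1⟩
        have : d.1 ∉ W := hdis d.1 (by simp only [vs, List.mem_map]; exact ⟨d, hd, rfl⟩)
        exact (h4 z hz).2 (hl.out this (h1.adj (by simp [hz])) hzW).2
  have hhf' : hf (E ++ LP G W) = [a, b] := by rw [hf_app, hf_LP, hhf]; simp
  have hn : E ++ LP G W ≠ [] := by
    intro h0; rw [h0] at hhf'; simp [hf] at hhf'
  have haU := hG.deg a (Finset.mem_sdiff.1 (hD.hf_mem hG (z := a) (by rw [hhf']; simp))).1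
  have hbU := hG.deg b (Finset.mem_sdiff.1 (hD.hf_mem hG (z := b) (by rw [hhf']; simp))).1
  refine step hG ih hD (by rw [hhf']; simp) p q c ?_ ?_ ?_ hext ?_
  · rw [hhf']
    rcases hpq with ⟨rfl, rfl, h⟩ | ⟨h, -⟩
    · simp [h]
    · simp [h]
  · rw [hhf']
    rcases hpq with ⟨rfl, rfl, h⟩ | ⟨rfl, h, ha, hb⟩
    · simp [cnt, nw, hab, hab.symm]; omega
    · simp [cnt, nw, hab, hab.symm, ha, hb]
  · intro W1 h1 h2 h3 h4 h5
    obtain ⟨⟨z, hz, hz'⟩, ⟨w, hw, hw'⟩⟩ := conn0 hG hD hn h1 h2 h3 h4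
    have hiff : a ∈ W1 ↔ b ∈ W1 := by
      rcases hpq with ⟨rfl, rfl, h⟩ | ⟨rfl, h, ha, hb⟩
      · exact h5 hab
      · have ha := (Finset.mem_sdiff.1 (hD.hf_mem hG (z := a) (by rw [hhf']; simp))).2
        have hb := (Finset.mem_sdiff.1 (hD.hf_mem hG (z := b) (by rw [hhf']; simp))).2
        exact ⟨fun hh => h4 a hh b hb h, fun hh => h4 b hh a ha h.symm⟩
    rw [hhf'] at hz hw
    simp at hz hw
    rcases hz with rfl | rfl <;> rcases hw with rfl | rfl <;> tauto
  · rw [drop_app, drop_LP]; linarith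

/-- All larger lobes are settled. -/
def LB (U : Finset V) (G : SimpleGraph V) (n : ℕ) : Prop :=
  ∀ (W : Finset V) (x y : V), n < W.card → Lobe U G W x y → LT G W x → Bd U G 4

/-- Lobe or closed graph. -/
theorem lobeW {U : Finset V} {G : SimpleGraph V} (hG : Good U G) {n : ℕ} (hLB : LB U G n) {W : Finset V} {x : V}
    (hn : n < W.card) (hW : W ⊆ U) (hx : x ∈ W) (hcl : ∀ v ∈ W, v ≠ x → ∀ z, G.Adj v z → z ∈ W)
    (hu : ∀ z z', G.Adj x z → G.Adj x z' → z ∉ W → z' ∉ W → z = z')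
    (hLT : LT G W x) {k : ℕ} (r : PrR G W x k) (h : 10 * (k : ℤ) ≤ wt G W + 4) : Bd U G 4 := by
  by_cases hc : ∀ v ∈ W, ∀ z, G.Adj v z → z ∈ W
  · exact closed_bd hG hW r hc h
  · push Not at hc
    obtain ⟨v, hv, z, hz, hzW⟩ := hc
    have hvx : v = x := by
      by_contra hvx; exact hzW (hcl v hv hvx z hz)
    subst hvx
    refine hLB W v z hn ⟨hW, hx, hzW, hz, ?_⟩ hLT
    intro u hu' w huw
    by_cases huv : u = v
    · subst huv
      by_cases hw : w ∈ W
      · exact Or.inl hw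
      · exact Or.inr ⟨rfl, hu w z huw hz hw hzW⟩
    · exact Or.inl (hcl u hu' huv w huw)

theorem lobeX {U : Finset V} {G : SimpleGraph V} (hG : Good U G) {W : Finset V} (hLB : LB U G W.card) {x y x' : V}
    (hl : Lobe U G W x y) {F : Finset V} (hFU : F ⊆ U) (hFW : ∀ z ∈ F, z ∉ W) (hy : y ∈ F) (hx' : x' ∈ F)
    (hcl : ∀ v ∈ F, v ≠ x' → ∀ z, G.Adj v z → z = x ∨ z ∈ F)
    (hu : ∀ z z', G.Adj x' z → G.Adj x' z' → z ∉ F → z' ∉ F → z ≠ x → z' ≠ x → z = z')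
    (hLT : LT G (W ∪ F) x') {k : ℕ} (r : PrR G (W ∪ F) x' k) (h : 10 * (k : ℤ) ≤ wt G W + wt G F + 4) : Bd U G 4 := by
  refine lobeW hG hLB (W := W ∪ F) (x := x') ?_ ?_ ?_ ?_ ?_ hLT r (by rw [wt_union hFW]; exact h)
  · apply Finset.card_lt_card
    refine ⟨Finset.subset_union_left, fun hh => ?_⟩
    exact hFW y hy (hh (Finset.mem_union_right _ hy))
  · apply Finset.union_subset hl.sub
    exact hFU
  · simp [hx']
  · intro v hv hvx z hz
    rw [Finset.mem_union] at hv ⊢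
    rcases hv with hv | hv
    · rcases hl.cl v hv z hz with h | h
      · exact Or.inl h
      · right; rw [h.2]; exact hy
    · rcases hcl v hv hvx z hz with h | h
      · left; rw [h]; exact hl.hx
      · exact Or.inr h
  · intro z z' h1 h2 h3 h4
    simp only [Finset.mem_union, not_or] at h3 h4
    exact hu z z' h1 h2 h3.2 h4.2 (by rintro rfl; exact h3.1 hl.hx) (by rintro rfl; exact h4.1 hl.hx)

/-- Exit vertex of degree two. -/
theorem lobe_chain {U : Finset V} {G : SimpleGraph V} (hG : Good U G) {W : Finset V} (hLB : LB U G W.card) {x y y' : V}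
    (hl : Lobe U G W x y) (hy : NL G y [x, y']) {k kr kq : ℕ} (r : PrR G W x kr) (q : PrQ G W x kq) (s : PrS G W x k)
    (hT : (kr = k ∧ kq = k ∧ 10 * (k : ℤ) + 2 ≤ wt G W) ∨ (kr = k + 1 ∧ kq = k ∧ 10 * (k : ℤ) + 4 ≤ wt G W) ∨
      (kr = k + 1 ∧ kq = k + 1 ∧ 10 * (k : ℤ) + 7 ≤ wt G W)) : Bd U G 4 := by
  obtain ⟨h1, h2, h3, h4, h5⟩ := hy.f2
  have hF : ∀ z ∈ ({y} : Finset V), z ∉ W := by simpa using hl.hy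
  have R' : PrR G (W ∪ {y}) y (k + 1) := (fillS hl s {y} hF (by simp)).prR hl.hx hF (by simp) (by simp) (by simp)
    (by simp) (by simp)
  have Q' : PrQ G (W ∪ {y}) y kr := (fillR hl r ∅ (by simp)).prQ hl.hx hF (by simp) (by simp) (by simp)
    (by simp) (by simp) ⟨x, by simp, h3⟩ (by simp)
  have S' : PrS G (W ∪ {y}) y kq := (fillQ hl q ∅ (by simp) (by simp)).prS hl.hx hF (by simp) (by simp) (by simp)
    (by simp) (by simp) ⟨x, by simp, h3⟩ (by simp)
  have hw : wt G (W ∪ {y}) = wt G W + 5 := by rw [wt_union hF, wt_single, h2]; norm_num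
  have hw' : wt G {y} = 5 := by rw [wt_single, h2]; norm_num
  refine lobeX hG hLB hl (F := {y}) (by simpa using hG.sub _ _ h3) hF (by simp) (x' := y) (by simp) (by simp) ?_ ?_ R' ?_
  · intro z z' a1 a2 a3 a4 a5 a6
    rw [h5] at a1 a2; grind
  · rcases hT with ⟨rfl, rfl, h⟩ | ⟨rfl, rfl, h⟩ | ⟨rfl, rfl, h⟩
    · exact .t1 _ R' Q' S' (by omega)
    · exact .t2 _ R' Q' S' (by omega)
    · exact .t0 _ R' Q' S' (by push_cast; omega)
  · rw [hw']; omega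

/-- Cubic exit, second type, nonadjacent further neighbours or cubic ones. -/
theorem lobe2a {U : Finset V} {G : SimpleGraph V} (hG : Good U G) (ih : IH U) {W : Finset V} {x y y1 y2 : V}
    (hl : Lobe U G W x y) (hy : NL G y [x, y1, y2]) {k : ℕ} (r : PrR G W x (k + 1)) (s : PrS G W x k)
    (hw : (¬ G.Adj y1 y2 ∧ 10 * (k : ℤ) + 7 ≤ wt G W) ∨
      (G.Adj y1 y2 ∧ dg G y1 = 3 ∧ dg G y2 = 3 ∧ 10 * (k : ℤ) + 9 ≤ wt G W)) : Bd U G 4 := by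
  obtain ⟨⟨n1, n2, n3, n4, n5, n6⟩, h2, e1, e2, e3, h5⟩ := hy.f3
  have hyW := hl.hy
  have w1 : y1 ∉ W := fun h => n4 (hl.out hyW e2 h).2.symm
  have w2 : y2 ∉ W := fun h => n5 (hl.out hyW e3 h).2.symm
  have e1' := e1.symm
  have e2' := e2.symm
  have e3' := e3.symm
  obtain ⟨p, q, hpq⟩ : ∃ p q, (p = y1 ∧ q = y2 ∧ ¬ G.Adj y1 y2) ∨ (p = q ∧ G.Adj y1 y2 ∧ dg G y1 = 3 ∧ dg G y2 = 3) := by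
    by_cases h : G.Adj y1 y2
    · exact ⟨y1, y1, by tauto⟩
    · exact ⟨y1, y2, by tauto⟩
  refine lstep hG ih hl [(y, [x], [y1, y2])] (by simp [vs]) (by simpa [vs] using hyW) (by simp [vs]) ?_ (by simp [hf])
    n6 hpq (c := k + 1) ?_ ?_
  · simp [vs]; exact ⟨hy, ⟨n2.symm, n4.symm⟩, n3.symm, n5.symm⟩
  · intro S hS
    have hX : ∀ z, z ∈ VS ([(y, [x], [y1, y2])] ++ LP G W) ↔ z ∈ ({y} : Finset V) ∨ z ∈ W := by
      intro z; rw [VS_app_LP]; simp [vs]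
    have hF : ∀ z ∈ ({y} : Finset V), z ∉ W := by simpa using hyW
    by_cases h : p ≠ q ∧ (y1 ∉ S ∧ y2 ∉ S)
    · refine (fillR hl r ∅ (by simp)).ext hl.hx hX hF (by simp) (by simp) hS (by simp) ?_ ?_ ?_
      all_goals simp only [Finset.mem_singleton, Finset.notMem_empty]
      all_goals grind
    · refine (fillS hl s {y} hF (by simp)).ext hl.hx hX hF (by simp) (by simp) hS (by simp; omega) ?_ ?_ ?_
      all_goals simp only [Finset.mem_singleton, Finset.notMem_empty]
      all_goals grind
  · simp only [drop, List.length_cons, List.length_nil]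
    split_ifs with h
    · have : G.Adj y1 y2 := by
        rcases hpq with ⟨rfl, rfl, h'⟩ | h'
        · exact absurd h n6
        · exact h'.2.1
      push_cast; rcases hw with hw | hw
      · exact absurd this hw.1
      · omega
    · push_cast; omega

/-- Cubic exit followed by a triangle with a degree two vertex. -/
theorem lobe2c {U : Finset V} {G : SimpleGraph V} (hG : Good U G) {W : Finset V} (hLB : LB U G W.card) {x y y1 y2 : V}
    (hl : Lobe U G W x y) (hy : NL G y [x, y1, y2]) (hy1 : NL G y1 [y, y2]) {k : ℕ} (q : PrQ G W x (k + 1)) (s : PrS G W x k)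
    (hw : 10 * (k : ℤ) + 7 ≤ wt G W) : Bd U G 4 := by
  obtain ⟨⟨n1, n2, n3, n4, n5, n6⟩, h2, e1, e2, e3, h5⟩ := hy.f3
  obtain ⟨m1, m2, f1, f2, m5⟩ := hy1.f2
  have hyW := hl.hy
  have w1 : y1 ∉ W := fun h => n4 (hl.out hyW e2 h).2.symm
  have w2 : y2 ∉ W := fun h => n5 (hl.out hyW e3 h).2.symm
  have f2' := f2.symm
  have e1' := e1.symm
  have e3' := e3.symm
  have hF : ∀ z ∈ ({y, y1, y2} : Finset V), z ∉ W := by simp [hyW, w1, w2]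
  have d2 := hG.deg y2 (hG.sub _ _ f2')
  have hy2 : ∃ z, ∀ z', G.Adj y2 z' → z' = y ∨ z' = y1 ∨ z' = z := by
    rcases hG.nl2 e3' f2' n2 with h | ⟨c, h⟩
    · exact ⟨y, fun z hz => by have := (h.f2).2.2.2.2 z; tauto⟩
    · exact ⟨c, fun z hz => by have := (h.f3).2.2.2.2.2 z; tauto⟩
  obtain ⟨z, hz⟩ := hy2
  have hwF : wt G {y, y1, y2} = 4 + (5 + (7 - dg G y2)) := by
    rw [wt_insert (by simp [n2, n3]), wt_insert (by simp [n6]), wt_single, h2, m2]; norm_num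
  have R' : PrR G (W ∪ {y, y1, y2}) y2 (k + 2) := (fillQ hl q {y2} (by simpa using w2) (by simpa using n3)).prR hl.hx hF (by simp) (by simp) (by simp)
    (by simp) (by simp [Cd]; grind)
  have Q' : PrQ G (W ∪ {y, y1, y2}) y2 (k + 1) := (fillS hl s {y} (by simpa using hyW) (by simp)).prQ hl.hx hF (by simp) (by simp) (by simp)
    (by simp) (by simpa using n3.symm) ⟨y, by simp, e3'⟩ (by simp [Cd]; grind)
  have S' : PrS G (W ∪ {y, y1, y2}) y2 (k + 1) := (fillS hl s {y} (by simpa using hyW) (by simp)).prS hl.hx hF (by simp) (by simp) (by simp)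
    (by simp) (by simpa using n3.symm) ⟨y1, by simp [n2.symm], f2'⟩ (by simp [Cd]; grind)
  refine lobeX hG hLB hl (F := {y, y1, y2}) ?_ hF (by simp) (x' := y2) (by simp) ?_ ?_ (.t1 _ R' Q' S' ?_) R' ?_
  · have a1 := hG.sub _ _ e1; have a2 := hG.sub _ _ f1; have a3 := hG.sub _ _ f2'
    intro z; simp; grind
  · simp only [Finset.mem_insert, Finset.mem_singleton]; grind
  · intro u u' a1 a2 a3 a4 a5 a6
    simp only [Finset.mem_insert, Finset.mem_singleton] at a3 a4
    grind
  · rw [wt_union hF, hwF]; push_cast; omega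
  · rw [hwF]; push_cast; omega

/-- The lobe lemma. -/
theorem lobe_lt {U : Finset V} {G : SimpleGraph V} (hG : Good U G) (ih : IH U) : ∀ n, LB U G n := by
  have key : ∀ m n, n + m = U.card → LB U G n := by
    intro m
    induction m with
    | zero =>
      intro n hn W x y h1 hl _
      have := Finset.card_le_card hl.sub
      omega
    | succ m ihm =>
      intro n hn W x y h1 hl hT
      have hLB : LB U G W.card := by
        have h := ihm (n + 1) (by omega)
        intro W' x' y' h2 h3 h4
        exact h W' x' y' (by omega) h3 h4
      rcases hG.nl1 hl.xy.symm with ⟨y', hy⟩ | ⟨y1, y2, hy⟩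
      · rcases hT with ⟨k, r, q, s, h⟩ | ⟨k, r, q, s, h⟩ | ⟨k, r, q, s, h⟩
        · exact lobe_chain hG hLB hl hy r q s (by omega)
        · exact lobe_chain hG hLB hl hy r q s (by omega)
        · exact lobe_chain hG hLB hl hy r q s (by omega)
      · have hy3 := hy.f3.2.1
        rcases hT with ⟨k, r, q, s, h⟩ | ⟨k, r, q, s, h⟩ | ⟨k, r, q, s, h⟩
        · exact lobe01 hG ih hl hy3 q s (by omega)
        · exact lobe01 hG ih hl hy3 q s (by omega)
        · by_cases ha : G.Adj y1 y2
          · have e2 := hy.f3.2.2.2.1.symm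
            have e3 := hy.f3.2.2.2.2.1.symm
            have n2 := hy.f3.1.2.1
            have n3 := hy.f3.1.2.2.1
            rcases hG.nl2 e2 ha n3 with h1 | ⟨z1, h1⟩
            · exact lobe2c hG hLB hl hy h1 q s (by omega)
            · rcases hG.nl2 e3 ha.symm n2 with h2 | ⟨z2, h2⟩
              · exact lobe2c hG hLB hl hy.r132 h2 q s (by omega)
              · exact lobe2a hG ih hl hy r s (Or.inr ⟨ha, h1.f3.2.1, h2.f3.2.1, h⟩)
          · exact lobe2a hG ih hl hy r s (Or.inl ⟨ha, by omega⟩)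
  intro n
  by_cases hn : n ≤ U.card
  · exact key (U.card - n) n (by omega)
  · intro W x y h1 hl _
    have := Finset.card_le_card hl.sub
    omega

/-- Restriction to one side of a deletion leaving two half edges. -/
theorem side_good {U : Finset V} {G : SimpleGraph V} (hG : Good U G) {D : Pt V} (hD : Patch G D)
    {a b p : V} (hhf : hf D = [a, b]) (hab : a ≠ b) (ha : dg G a = 3) (hb : dg G b = 3)
    {W : Finset V} (hW : W ⊆ U \ VS D) (hWn : W.Nonempty) (hone : ¬ (a ∈ W ∧ b ∈ W))
    (hcl : ∀ u ∈ W, ∀ v, v ∉ VS D → G.Adj u v → v ∈ W) :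
    Good W (red G (U \ W) p p) := by
  have hWU : W ⊆ U := hW.trans Finset.sdiff_subset
  have e : U \ (U \ W) = W := by rw [Finset.sdiff_sdiff_eq_self hWU]
  have hn : D ≠ [] := by rintro rfl; simp [hf] at hhf
  have := red_good (U := U) (X := U \ W) (p := p) (q := p) hG (by rw [e]; exact hWn) (by simp) ?_ ?_
  · rwa [e] at this
  · intro v hv hvW
    have hvW : v ∈ W := by simp at hvW; tauto
    have hvX := (Finset.mem_sdiff.1 (hW hvW)).2
    have hio : io G (U \ W) v = io G (VS D) v := by
      unfold io; congr 1; ext z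
      simp only [Finset.mem_filter, Finset.mem_sdiff]
      constructor
      · rintro ⟨⟨h1, h2⟩, h3⟩
        refine ⟨?_, h3⟩
        by_contra h; exact h2 (hcl v hvW z h h3)
      · rintro ⟨h1, h2⟩
        exact ⟨⟨hD.sub hG h1, fun h => (Finset.mem_sdiff.1 (hW h)).2 h1⟩, h2⟩
    rw [hio, hD.io hvX, hhf]
    have := hG.deg v hv
    simp only [cnt, nw]
    split_ifs <;> simp_all <;> omega
  · intro Z hZ hZn hZc hpq
    rw [e] at hZ ⊢
    by_contra hne
    have hZX : Z ⊆ U \ VS D := hZ.trans hW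
    have c1 : ∀ u ∈ Z, ∀ v, v ∉ VS D → G.Adj u v → v ∈ Z := by
      intro u hu v hv huv
      have hvW := hcl u (hZ hu) v hv huv
      exact hZc u hu v (by simp [hvW]) huv
    have hZp : Z ≠ U \ VS D := fun h => hne (Finset.Subset.antisymm hZ (h ▸ hW))
    obtain ⟨⟨z, hz, hz'⟩, -⟩ := conn0 hG hD hn hZX hZn hZp c1
    have hZ'n : (W \ Z).Nonempty := by
      rw [Finset.sdiff_nonempty]; exact fun h => hne (Finset.Subset.antisymm hZ h)
    have c2 : ∀ u ∈ W \ Z, ∀ v, v ∉ VS D → G.Adj u v → v ∈ W \ Z := by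
      intro u hu v hv huv
      rw [Finset.mem_sdiff] at hu ⊢
      refine ⟨hcl u hu.1 v hv huv, fun h => hu.2 (c1 v h u (Finset.mem_sdiff.1 (hW hu.1)).2 huv.symm)⟩
    have hZ'p : W \ Z ≠ U \ VS D := by
      obtain ⟨t, ht⟩ := hZn
      intro h
      have : t ∈ W \ Z := h ▸ hZX ht
      exact (Finset.mem_sdiff.1 this).2 ht
    obtain ⟨⟨w, hw, hw'⟩, -⟩ := conn0 hG hD hn (Finset.sdiff_subset.trans hW) hZ'n hZ'p c2
    rw [hhf] at hz hw
    rw [Finset.mem_sdiff] at hw'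
    have := hZ hz'
    simp at hz hw
    rcases hz with rfl | rfl <;> rcases hw with rfl | rfl <;> tauto

theorem side_wt {U : Finset V} {G : SimpleGraph V} (hG : Good U G) {X W : Finset V} {p : V} (hX : X ⊆ U) (hW : W ⊆ U \ X)
    (hcl : ∀ u ∈ W, ∀ v, v ∉ X → G.Adj u v → v ∈ W) {v : V} (hv : v ∈ W) (z : V) :
    (red G X p p).Adj v z ↔ (red G (U \ W) p p).Adj v z := by
  have h1 := hW hv
  rw [Finset.mem_sdiff] at h1
  simp only [red, Finset.mem_sdiff]
  constructor
  · rintro ⟨a, b, c⟩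
    refine ⟨by tauto, ?_, c⟩
    rcases c with c | c
    · intro h; exact h.2 (hcl v hv z b c)
    · tauto
  · rintro ⟨a, b, c⟩
    refine ⟨by tauto, ?_, c⟩
    rcases c with c | c
    · intro h; exact b ⟨hX h, fun h' => (Finset.mem_sdiff.1 (hW h')).2 h⟩
    · tauto

/-- Deletion with two half edges at cubic vertices, without connectivity. -/
theorem step2 {U : Finset V} {G : SimpleGraph V} (hG : Good U G) (ih : IH U) {D : Pt V} (hD : Patch G D)
    {a b p : V} (hhf : hf D = [a, b]) (hab : a ≠ b) (ha : dg G a = 3) (hb : dg G b = 3) {c : ℕ}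
    (hext : Ext G (VS D) p p c) (hdrop : 10 * (c : ℤ) + 6 ≤ drop D) : Bd U G 4 := by
  by_cases hc : ∃ W ⊆ U \ VS D, W.Nonempty ∧ W ≠ U \ VS D ∧ (∀ u ∈ W, ∀ v, v ∉ VS D → G.Adj u v → v ∈ W)
  · obtain ⟨W, h1, h2, h3, h4⟩ := hc
    have hn : D ≠ [] := by rintro rfl; simp [hf] at hhf
    obtain ⟨⟨z, hz, hz'⟩, ⟨w, hw, hw'⟩⟩ := conn0 hG hD hn h1 h2 h3 h4
    set W' := (U \ VS D) \ W with hW'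
    have k1 : W' ⊆ U \ VS D := Finset.sdiff_subset
    have k2 : W'.Nonempty := by
      rw [hW', Finset.sdiff_nonempty]; exact fun h => h3 (Finset.Subset.antisymm h1 h)
    have k4 : ∀ u ∈ W', ∀ v, v ∉ VS D → G.Adj u v → v ∈ W' := by
      intro u hu v hv huv
      rw [hW', Finset.mem_sdiff, Finset.mem_sdiff] at hu ⊢
      exact ⟨⟨hG.sub v u huv.symm, hv⟩, fun h => hu.2 (h4 v h u hu.1.2 huv.symm)⟩
    rw [hhf] at hz hw
    simp only [List.mem_cons, List.not_mem_nil, or_false] at hz hw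
    have o1 : ¬ (a ∈ W ∧ b ∈ W) := by
      rintro ⟨a1, a2⟩; rcases hw with rfl | rfl <;> tauto
    have o2 : ¬ (a ∈ W' ∧ b ∈ W') := by
      simp only [hW', Finset.mem_sdiff]
      rintro ⟨a1, a2⟩; rcases hz with rfl | rfl <;> tauto
    have g1 := side_good (p := p) hG hD hhf hab ha hb h1 h2 o1 h4
    have g2 := side_good (p := p) hG hD hhf hab ha hb k1 k2 o2 k4
    have hlt := card_lt hG hD (by rw [hhf]; simp)
    obtain ⟨S1, s1, t1⟩ := ih W _ (lt_of_le_of_lt (Finset.card_le_card h1) hlt) g1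
    obtain ⟨S2, s2, t2⟩ := ih W' _ (lt_of_le_of_lt (Finset.card_le_card k1) hlt) g2
    have a1 := fun v (hv : v ∈ W) z => side_wt (p := p) hG (hD.sub hG) h1 h4 hv z
    have a2 := fun v (hv : v ∈ W') z => side_wt (p := p) hG (hD.sub hG) k1 k4 hv z
    have dgW : wt (red G (U \ W) p p) W = wt (red G (VS D) p p) W := by
      unfold wt; apply Finset.sum_congr rfl
      intro v hv; unfold dg; simp only [a1 v hv]
    have dgW' : wt (red G (U \ W') p p) W' = wt (red G (VS D) p p) W' := by
      unfold wt; apply Finset.sum_congr rfl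
      intro v hv; unfold dg; simp only [a2 v hv]
    have hun : W ∪ W' = U \ VS D := by rw [hW']; exact Finset.union_sdiff_of_subset h1
    have hdis : ∀ z ∈ W', z ∉ W := by intro z hz; rw [hW', Finset.mem_sdiff] at hz; exact hz.2
    have hw2 := wt_union (G := red G (VS D) p p) hdis
    have hb10 : Bd (U \ VS D) (red G (VS D) p p) 10 := by
      refine ⟨S1 ∪ S2, ⟨?_, ?_⟩, ?_⟩
      · rw [← hun]; exact Finset.union_subset_union s1.1 s2.1
      · intro v hv hvS
        rw [← hun, Finset.mem_union] at hv
        simp only [Finset.mem_union, not_or] at hvS ⊢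
        rcases hv with hv | hv
        · obtain ⟨⟨u, b1, b2⟩, ⟨w, b3, b4⟩⟩ := s1.2 v hv hvS.1
          refine ⟨⟨u, Or.inl b1, (a1 v hv u).2 b2⟩, ⟨w, ⟨b3, fun h => ?_⟩, (a1 v hv w).2 b4⟩⟩
          have := hdis w (s2.1 h)
          have h6 := g1.sub w v b4.symm
          exact this h6
        · obtain ⟨⟨u, b1, b2⟩, ⟨w, b3, b4⟩⟩ := s2.2 v hv hvS.2
          refine ⟨⟨u, Or.inr b1, (a2 v hv u).2 b2⟩, ⟨w, ⟨fun h => ?_, b3⟩, (a2 v hv w).2 b4⟩⟩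
          have h6 := g2.sub w v b4.symm
          exact hdis w h6 (s1.1 h)
      · have := Finset.card_union_le S1 S2
        rw [hun] at hw2
        have h' : ((S1 ∪ S2).card : ℤ) ≤ S1.card + S2.card := by exact_mod_cast this
        linarith
    refine red_bd (hD.sub hG) (by simp) hext hb10 ?_
    rw [hD.drop hG]; simp; linarith
  · push Not at hc
    refine step hG ih hD (by rw [hhf]; simp) p p c (by simp) ?_ ?_ hext (by simp; linarith)
    · rw [hhf]; simp [cnt, nw, hab, hab.symm, ha, hb]
    · intro W h1 h2 h3 h4 _
      obtain ⟨u, b1, v, b2, b3, b4⟩ := hc W h1 h2 h3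
      exact b4 (h4 u b1 v b2 b3)

theorem three_or {U : Finset V} {G : SimpleGraph V} (hG : Good U G) {v a b : V} (h : G.Adj v a) (h' : G.Adj v b) (hab : a ≠ b) :
    ∃ z, ∀ z', G.Adj v z' → z' = a ∨ z' = b ∨ z' = z := by
  rcases hG.nl2 h h' hab with h | ⟨c, h⟩
  · exact ⟨a, fun z hz => by have := (h.f2).2.2.2.2 z; tauto⟩
  · exact ⟨c, fun z hz => by have := (h.f3).2.2.2.2.2 z; tauto⟩

/-- Special lobe, exit followed by a diamond. -/
theorem spec_ii {U : Finset V} {G : SimpleGraph V} (hG : Good U G) {W : Finset V} (hLB : LB U G W.card) {x y y1 y2 z : V}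
    (hl : Lobe U G W x y) (hy : NL G y [x, y1, y2]) (hy1 : NL G y1 [y, y2, z]) (hy2 : NL G y2 [y, y1, z])
    {k : ℕ} (q : PrQ G W x (k + 1)) (s : PrS G W x k)
    (hw : 10 * (k : ℤ) + 7 ≤ wt G W) : Bd U G 4 := by
  obtain ⟨⟨n1, n2, n3, n4, n5, n6⟩, h2, e1, e2, e3, h5⟩ := hy.f3
  obtain ⟨⟨m1, m2, m3, m4, m5, m6⟩, i2, f1, f2, f3, i5⟩ := hy1.f3
  obtain ⟨⟨l1, l2, l3, l4, l5, l6⟩, j2, g1, g2, g3, j5⟩ := hy2.f3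
  have hyW := hl.hy
  have w1 : y1 ∉ W := fun h => n4 (hl.out hyW e2 h).2.symm
  have w2 : y2 ∉ W := fun h => n5 (hl.out hyW e3 h).2.symm
  have w3 : z ∉ W := fun h => m1 (hl.out w1 f3 h).1
  have hF : ∀ t ∈ ({y, y1, y2, z} : Finset V), t ∉ W := by simp [hyW, w1, w2, w3]
  have dz := hG.deg z (hG.sub _ _ g3.symm)
  obtain ⟨t, ht⟩ := three_or hG f3.symm g3.symm m2
  have f3' := f3.symm
  have g3' := g3.symm
  have hwF : wt G {y, y1, y2, z} = 4 + (4 + (4 + (7 - dg G z))) := by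
    rw [wt_insert (by simp [n2, n3, m5]), wt_insert (by simp [n6, m3]), wt_insert (by simp [l3]), wt_single, h2, i2, j2]; norm_num
  have R' : PrR G (W ∪ {y, y1, y2, z}) z (k + 2) := (fillS hl s {y, z} (by simp [hyW, w3]) (by simp)).prR hl.hx hF (by simp)
    (by simp [Finset.insert_subset_iff]) (by have := Finset.card_le_two (a := y) (b := z); omega)
    (by simp) (by simp [Cd]; grind)
  have Q' : PrQ G (W ∪ {y, y1, y2, z}) z (k + 2) := (fillQ hl q {y1} (by simp [w1]) (by simp [n2])).prQ hl.hx hF (by simp)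
    (by simp) (by simp)
    (by simp) (by simpa using m3.symm) ⟨y1, by simp, f3'⟩ (by simp [Cd]; grind)
  have S' : PrS G (W ∪ {y, y1, y2, z}) z (k + 1) := (fillS hl s {y} (by simp [hyW]) (by simp)).prS hl.hx hF (by simp)
    (by simp) (by simp)
    (by simp) (by simpa using m5.symm) ⟨y1, by simp [m1], f3'⟩ (by simp [Cd]; grind)
  refine lobeX hG hLB hl (F := {y, y1, y2, z}) ?_ hF (by simp) (x' := z) (by simp) ?_ ?_ (.t2 _ R' Q' S' ?_) R' ?_
  · have a1 := hG.sub _ _ e1; have a2 := hG.sub _ _ f1; have a3 := hG.sub _ _ g1; have a4 := hG.sub _ _ f3'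
    intro z; simp; grind
  · simp only [Finset.mem_insert, Finset.mem_singleton]; grind
  · intro u u' a1 a2 a3 a4 a5 a6
    simp only [Finset.mem_insert, Finset.mem_singleton] at a3 a4
    grind
  · rw [wt_union hF, hwF]; push_cast; omega
  · rw [hwF]; push_cast; omega

/-- Special lobe, exit followed by a triangle with cubic outer neighbours. -/
theorem spec_iii {U : Finset V} {G : SimpleGraph V} (hG : Good U G) (ih : IH U) {W : Finset V} {x y y1 y2 z1 z2 : V}
    (hl : Lobe U G W x y) (hy : NL G y [x, y1, y2]) (hy1 : NL G y1 [y, y2, z1]) (hy2 : NL G y2 [y, y1, z2])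
    (hz : z1 ≠ z2) (hz1 : dg G z1 = 3) (hz2 : dg G z2 = 3) {k : ℕ} (s : PrS G W x k)
    (hw : 10 * (k : ℤ) + 7 ≤ wt G W) : Bd U G 4 := by
  obtain ⟨⟨n1, n2, n3, n4, n5, n6⟩, h2, e1, e2, e3, h5⟩ := hy.f3
  obtain ⟨⟨m1, m2, m3, m4, m5, m6⟩, i2, f1, f2, f3, i5⟩ := hy1.f3
  obtain ⟨⟨l1, l2, l3, l4, l5, l6⟩, j2, g1, g2, g3, j5⟩ := hy2.f3
  have hyW := hl.hy
  have w1 : y1 ∉ W := fun h => n4 (hl.out hyW e2 h).2.symm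
  have w2 : y2 ∉ W := fun h => n5 (hl.out hyW e3 h).2.symm
  have w3 : z1 ∉ W := fun h => m1 (hl.out w1 f3 h).1
  have w4 : z2 ∉ W := fun h => l1 (hl.out w2 g3 h).1
  have hxW := hl.hx
  have hD : Patch G ([(y, [x, y1, y2], []), (y1, [y, y2], [z1]), (y2, [y, y1], [z2])] ++ LP G W) := by
    refine patch_LP hG hl.sub (by simp [vs]; grind) (by simp [vs, hyW, w1, w2]) ?_ ?_
    · intro v hv z hvz
      rcases hl.cl v hv z hvz with h | h
      · exact Or.inl h
      · right; rw [h.2]; simp [vs]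
    · simp [vs, hy, hy1, hy2, hxW, w3, w4]; grind
  refine step2 hG ih hD (a := z1) (b := z2) (p := z1) (by rw [hf_app, hf_LP]; simp [hf]) hz hz1 hz2 (c := k + 1) ?_ ?_
  · intro S hS
    have hX : ∀ z, z ∈ VS ([(y, [x, y1, y2], []), (y1, [y, y2], [z1]), (y2, [y, y1], [z2])] ++ LP G W) ↔
        z ∈ ({y, y1, y2} : Finset V) ∨ z ∈ W := by
      intro z; rw [VS_app_LP]; simp [vs]
    have hF : ∀ z ∈ ({y, y1, y2} : Finset V), z ∉ W := by simp [hyW, w1, w2]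
    refine (fillS hl s {y} (by simp [hyW]) (by simp)).ext hl.hx hX hF (by simp) (by simp) hS (by simp; omega) ?_ (by simp) (by simp)
    simp only [Finset.mem_insert, Finset.mem_singleton]
    grind
  · rw [drop_app, drop_LP]; simp [drop]; omega

set_option maxHeartbeats 2000000 in
/-- Special lobe, exit followed by a triangle on a five cycle with chord. -/
theorem spec_iv1 {U : Finset V} {G : SimpleGraph V} (hG : Good U G) {W : Finset V} (hLB : LB U G W.card) {x y y1 y2 z1 z2 : V}
    (hl : Lobe U G W x y) (hy : NL G y [x, y1, y2]) (hy1 : NL G y1 [y, y2, z1]) (hy2 : NL G y2 [y, y1, z2])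
    (hz : z1 ≠ z2) (hz1 : NL G z1 [y1, z2]) {k : ℕ} (s : PrS G W x k)
    (hw : 10 * (k : ℤ) + 7 ≤ wt G W) : Bd U G 4 := by
  obtain ⟨⟨n1, n2, n3, n4, n5, n6⟩, h2, e1, e2, e3, h5⟩ := hy.f3
  obtain ⟨⟨m1, m2, m3, m4, m5, m6⟩, i2, f1, f2, f3, i5⟩ := hy1.f3
  obtain ⟨⟨l1, l2, l3, l4, l5, l6⟩, j2, g1, g2, g3, j5⟩ := hy2.f3
  obtain ⟨o1, o2, p1, p2, o5⟩ := hz1.f2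
  have hyW := hl.hy
  have w1 : y1 ∉ W := fun h => n4 (hl.out hyW e2 h).2.symm
  have w2 : y2 ∉ W := fun h => n5 (hl.out hyW e3 h).2.symm
  have w3 : z1 ∉ W := fun h => m1 (hl.out w1 f3 h).1
  have w4 : z2 ∉ W := fun h => l1 (hl.out w2 g3 h).1
  have hxW := hl.hx
  have hF : ∀ t ∈ ({y, y1, y2, z1, z2} : Finset V), t ∉ W := by simp [hyW, w1, w2, w3, w4]
  have f3' := f3.symm
  have g3' := g3.symm
  have p2' := p2.symm
  have dz := hG.deg z2 (hG.sub _ _ g3')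
  obtain ⟨t, ht⟩ := three_or hG g3' p2' m6
  have hwF : wt G {y, y1, y2, z1, z2} = 4 + (4 + (4 + (5 + (7 - dg G z2)))) := by
    rw [wt_insert (by simp; grind), wt_insert (by simp; grind), wt_insert (by simp; grind), wt_insert (by simp; grind),
      wt_single, h2, i2, j2, o2]; norm_num
  have c1 : ({y, z2} : Finset V).card ≤ 2 := Finset.card_le_two
  have c2 : ({y, z1} : Finset V).card ≤ 2 := Finset.card_le_two
  have R' : PrR G (W ∪ {y, y1, y2, z1, z2}) z2 (k + 2) := (fillS hl s {y, z2} (by simp [hyW, w4]) (by simp)).prR hl.hx hF (by simp)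
    (by simp [Finset.insert_subset_iff]) (by omega) (by simp) (by simp [Cd]; grind)
  have Q' : PrQ G (W ∪ {y, y1, y2, z1, z2}) z2 (k + 2) := (fillS hl s {y, z1} (by simp [hyW, w3]) (by simp)).prQ hl.hx hF (by simp)
    (by simp [Finset.insert_subset_iff]) (by omega)
    (by simp) (by simp; grind) ⟨z1, by simp, p2'⟩ (by simp [Cd]; grind)
  have S' : PrS G (W ∪ {y, y1, y2, z1, z2}) z2 (k + 2) := (fillS hl s {y, z1} (by simp [hyW, w3]) (by simp)).prS hl.hx hF (by simp)
    (by simp [Finset.insert_subset_iff]) (by omega)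
    (by simp) (by simp; grind) ⟨y2, by simp; grind, g3'⟩ (by simp [Cd]; grind)
  refine lobeX hG hLB hl (F := {y, y1, y2, z1, z2}) ?_ hF (by simp) (x' := z2) (by simp) ?_ ?_ (.t0 _ R' Q' S' ?_) R' ?_
  · have a1 := hG.sub _ _ e1; have a2 := hG.sub _ _ f1; have a3 := hG.sub _ _ g1; have a4 := hG.sub _ _ f3'
    have a5 := hG.sub _ _ g3'
    intro z; simp; grind
  · simp only [Finset.mem_insert, Finset.mem_singleton]; grind
  · intro u u' a1 a2 a3 a4 a5 a6
    simp only [Finset.mem_insert, Finset.mem_singleton] at a3 a4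
    grind
  · rw [wt_union hF, hwF]; push_cast; omega
  · rw [hwF]; push_cast; omega

set_option maxHeartbeats 2000000 in
theorem spec_iv2 {U : Finset V} {G : SimpleGraph V} (hG : Good U G) (ih : IH U) {W : Finset V} {x y y1 y2 z1 z2 z3 : V}
    (hl : Lobe U G W x y) (hy : NL G y [x, y1, y2]) (hy1 : NL G y1 [y, y2, z1]) (hy2 : NL G y2 [y, y1, z2])
    (hz : z1 ≠ z2) (hz1 : NL G z1 [y1, z3]) (hz3 : z3 ≠ z2) (had : ¬ G.Adj z2 z3 ∨ dg G z2 = 3 ∧ dg G z3 = 3)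
    {k : ℕ} (q : PrQ G W x (k + 1)) (s : PrS G W x k)
    (hw : 10 * (k : ℤ) + 7 ≤ wt G W) : Bd U G 4 := by
  obtain ⟨⟨n1, n2, n3, n4, n5, n6⟩, h2, e1, e2, e3, h5⟩ := hy.f3
  obtain ⟨⟨m1, m2, m3, m4, m5, m6⟩, i2, f1, f2, f3, i5⟩ := hy1.f3
  obtain ⟨⟨l1, l2, l3, l4, l5, l6⟩, j2, g1, g2, g3, j5⟩ := hy2.f3
  obtain ⟨o1, o2, p1, p2, o5⟩ := hz1.f2
  have hyW := hl.hy
  have w1 : y1 ∉ W := fun h => n4 (hl.out hyW e2 h).2.symm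
  have w2 : y2 ∉ W := fun h => n5 (hl.out hyW e3 h).2.symm
  have w3 : z1 ∉ W := fun h => m1 (hl.out w1 f3 h).1
  have w4 : z2 ∉ W := fun h => l1 (hl.out w2 g3 h).1
  have w5 : z3 ∉ W := fun h => m5 (hl.out w3 p2 h).1.symm
  have hxW := hl.hx
  have f3' := f3.symm
  have g3' := g3.symm
  have p2' := p2.symm
  have u1 : z3 ≠ y := by rintro rfl; have := (h5 z1).1 p2'; grind
  have u2 : z3 ≠ y2 := by rintro rfl; have := (j5 z1).1 p2'; grind
  obtain ⟨p, q', hpq⟩ : ∃ p q, (p = z2 ∧ q = z3 ∧ ¬ G.Adj z2 z3) ∨ (p = q ∧ G.Adj z2 z3 ∧ dg G z2 = 3 ∧ dg G z3 = 3) := by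
    by_cases h : G.Adj z2 z3
    · exact ⟨z2, z2, by tauto⟩
    · exact ⟨z2, z3, by tauto⟩
  refine lstep hG ih hl [(y, [x, y1, y2], []), (y1, [y, y2, z1], []), (y2, [y, y1], [z2]), (z1, [y1], [z3])]
    (by simp [vs]; grind) (by simp [vs]; grind) (by simp [vs]) ?_ (by simp [hf])
    hz3.symm hpq (c := k + 2) ?_ ?_
  · simp [vs, hy, hy1, hy2, hz1]; grind
  · intro S hS
    have hX : ∀ z, z ∈ VS ([(y, [x, y1, y2], []), (y1, [y, y2, z1], []), (y2, [y, y1], [z2]), (z1, [y1], [z3])] ++ LP G W) ↔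
      z ∈ ({y, y1, y2, z1} : Finset V) ∨ z ∈ W := by
      intro z; rw [VS_app_LP]; simp [vs]
    have hF : ∀ z ∈ ({y, y1, y2, z1} : Finset V), z ∉ W := by simp; grind
    have c2 : ({y, z1} : Finset V).card ≤ 2 := Finset.card_le_two
    by_cases hs : p = q' ∨ z2 ∈ S
    · refine (fillS hl s {y, z1} (by simp [hyW, w3]) (by simp)).ext hl.hx hX hF (by simp) (by simp [Finset.insert_subset_iff]) hS (by omega) ?_ ?_ ?_
      all_goals simp only [Finset.mem_insert, Finset.mem_singleton]
      all_goals grind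
    · push Not at hs
      by_cases h3 : z3 ∈ S
      · refine (fillQ hl q {y2} (by simp [w2]) (by simp [n3])).ext hl.hx hX hF (by simp) (by simp) hS (by simp; omega) ?_ ?_ ?_
        all_goals simp only [Finset.mem_insert, Finset.mem_singleton]
        all_goals grind
      · refine (fillQ hl q {y1} (by simp [w1]) (by simp [n2])).ext hl.hx hX hF (by simp) (by simp) hS (by simp; omega) ?_ ?_ ?_
        all_goals simp only [Finset.mem_insert, Finset.mem_singleton]
        all_goals grind
  · simp only [drop, List.length_cons, List.length_nil]
    split_ifs <;> push_cast <;> omega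

set_option maxHeartbeats 2000000 in
theorem spec_iv3 {U : Finset V} {G : SimpleGraph V} (hG : Good U G) {W : Finset V} (hLB : LB U G W.card) {x y y1 y2 z1 z2 z3 : V}
    (hl : Lobe U G W x y) (hy : NL G y [x, y1, y2]) (hy1 : NL G y1 [y, y2, z1]) (hy2 : NL G y2 [y, y1, z2])
    (hz : z1 ≠ z2) (hz1 : NL G z1 [y1, z3]) (hz3 : z3 ≠ z2) (hd : NL G z3 [z1, z2])
    {k : ℕ} (q : PrQ G W x (k + 1)) (s : PrS G W x k)
    (hw : 10 * (k : ℤ) + 7 ≤ wt G W) : Bd U G 4 := by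
  obtain ⟨⟨n1, n2, n3, n4, n5, n6⟩, h2, e1, e2, e3, h5⟩ := hy.f3
  obtain ⟨⟨m1, m2, m3, m4, m5, m6⟩, i2, f1, f2, f3, i5⟩ := hy1.f3
  obtain ⟨⟨l1, l2, l3, l4, l5, l6⟩, j2, g1, g2, g3, j5⟩ := hy2.f3
  obtain ⟨o1, o2, p1, p2, o5⟩ := hz1.f2
  obtain ⟨r1, r2, s1, s2, r5⟩ := hd.f2
  have hyW := hl.hy
  have hxW := hl.hx
  have w1 : y1 ∉ W := fun h => n4 (hl.out hyW e2 h).2.symm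
  have w2 : y2 ∉ W := fun h => n5 (hl.out hyW e3 h).2.symm
  have w3 : z1 ∉ W := fun h => m1 (hl.out w1 f3 h).1
  have w4 : z2 ∉ W := fun h => l1 (hl.out w2 g3 h).1
  have w5 : z3 ∉ W := fun h => m5 (hl.out w3 p2 h).1.symm
  have u1 : z3 ≠ y := by rintro rfl; have := (h5 z1).1 p2.symm; grind
  have u2 : z3 ≠ y2 := by rintro rfl; have := (j5 z1).1 p2.symm; grind
  have hF : ∀ t ∈ ({y, y1, y2, z1, z3, z2} : Finset V), t ∉ W := by simp [hyW, w1, w2, w3, w4, w5]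
  have f3' := f3.symm
  have g3' := g3.symm
  have p2' := p2.symm
  have s2' := s2.symm
  have a1 := hG.sub _ _ e1
  have a2 := hG.sub _ _ f1
  have a3 := hG.sub _ _ g1
  have a4 := hG.sub _ _ f3'
  have a5 := hG.sub _ _ g3'
  have a6 := hG.sub _ _ p2'
  have dz := hG.deg z2 (by assumption)
  obtain ⟨t, ht⟩ := three_or hG g3' s2' (by grind)
  have hwF : wt G {y, y1, y2, z1, z3, z2} = 4 + (4 + (4 + (5 + (5 + (7 - dg G z2))))) := by
    rw [wt_insert (by simp; grind), wt_insert (by simp; grind), wt_insert (by simp; grind), wt_insert (by simp; grind),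
      wt_insert (by simp; grind), wt_single, h2, i2, j2, o2, r2]; ring
  have c1 : ({z2, y1} : Finset V).card ≤ 2 := Finset.card_le_two
  have c2 : ({z3, y} : Finset V).card ≤ 2 := Finset.card_le_two
  have R' : PrR G (W ∪ {y, y1, y2, z1, z3, z2}) z2 (k + 3) := (fillQ hl q {z2, y1} (by simp; grind) (by simp; try grind)).prR hl.hx hF (by simp)
    (by simp [Finset.insert_subset_iff]) (by omega) (by simp) (by simp [Cd]; grind)
  have Q' : PrQ G (W ∪ {y, y1, y2, z1, z3, z2}) z2 (k + 3) := (fillS hl s {z3, y} (by simp; grind) (by simp; try grind)).prQ hl.hx hF (by simp)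
    (by simp [Finset.insert_subset_iff]) (by omega)
    (by simp) (by simp; grind) ⟨z3, by simp, by assumption⟩ (by simp [Cd]; grind)
  have S' : PrS G (W ∪ {y, y1, y2, z1, z3, z2}) z2 (k + 3) := (fillS hl s {z3, y} (by simp; grind) (by simp; try grind)).prS hl.hx hF (by simp)
    (by simp [Finset.insert_subset_iff]) (by omega)
    (by simp) (by simp; grind) ⟨y2, by simp; grind, by assumption⟩ (by simp [Cd]; grind)
  refine lobeX hG hLB hl (F := {y, y1, y2, z1, z3, z2}) ?_ hF (by simp) (x' := z2) (by simp) ?_ ?_ (.t0 _ R' Q' S' ?_) R' ?_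
  · intro z; simp; grind
  · simp only [Finset.mem_insert, Finset.mem_singleton]; grind
  · intro u u' a1 a2 a3 a4 a5 a6
    simp only [Finset.mem_insert, Finset.mem_singleton] at a3 a4
    grind
  · rw [wt_union hF, hwF]; push_cast; omega
  · rw [hwF]; push_cast; omega

set_option maxHeartbeats 2000000 in
theorem spec_iv4 {U : Finset V} {G : SimpleGraph V} (hG : Good U G) {W : Finset V} (hLB : LB U G W.card) {x y y1 y2 z1 z2 z3 : V}
    (hl : Lobe U G W x y) (hy : NL G y [x, y1, y2]) (hy1 : NL G y1 [y, y2, z1]) (hy2 : NL G y2 [y, y1, z2])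
    (hz : z1 ≠ z2) (hz1 : NL G z1 [y1, z3]) (hz3 : z3 ≠ z2) (hd : NL G z2 [y2, z3])
    {k : ℕ} (q : PrQ G W x (k + 1)) (s : PrS G W x k)
    (hw : 10 * (k : ℤ) + 7 ≤ wt G W) : Bd U G 4 := by
  obtain ⟨⟨n1, n2, n3, n4, n5, n6⟩, h2, e1, e2, e3, h5⟩ := hy.f3
  obtain ⟨⟨m1, m2, m3, m4, m5, m6⟩, i2, f1, f2, f3, i5⟩ := hy1.f3
  obtain ⟨⟨l1, l2, l3, l4, l5, l6⟩, j2, g1, g2, g3, j5⟩ := hy2.f3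
  obtain ⟨o1, o2, p1, p2, o5⟩ := hz1.f2
  obtain ⟨r1, r2, s1, s2, r5⟩ := hd.f2
  have hyW := hl.hy
  have hxW := hl.hx
  have w1 : y1 ∉ W := fun h => n4 (hl.out hyW e2 h).2.symm
  have w2 : y2 ∉ W := fun h => n5 (hl.out hyW e3 h).2.symm
  have w3 : z1 ∉ W := fun h => m1 (hl.out w1 f3 h).1
  have w4 : z2 ∉ W := fun h => l1 (hl.out w2 g3 h).1
  have w5 : z3 ∉ W := fun h => m5 (hl.out w3 p2 h).1.symm
  have u1 : z3 ≠ y := by rintro rfl; have := (h5 z1).1 p2.symm; grind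
  have u2 : z3 ≠ y2 := by rintro rfl; have := (j5 z1).1 p2.symm; grind
  have hF : ∀ t ∈ ({y, y1, y2, z1, z3, z2} : Finset V), t ∉ W := by simp [hyW, w1, w2, w3, w4, w5]
  have f3' := f3.symm
  have g3' := g3.symm
  have p2' := p2.symm
  have s2' := s2.symm
  have a1 := hG.sub _ _ e1
  have a2 := hG.sub _ _ f1
  have a3 := hG.sub _ _ g1
  have a4 := hG.sub _ _ f3'
  have a5 := hG.sub _ _ g3'
  have a6 := hG.sub _ _ p2'
  have dz := hG.deg z3 (by assumption)
  obtain ⟨t, ht⟩ := three_or hG p2' s2' (by grind)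
  have hwF : wt G {y, y1, y2, z1, z3, z2} = 4 + (4 + (4 + (5 + (5 + (7 - dg G z3))))) := by
    rw [wt_insert (by simp; grind), wt_insert (by simp; grind), wt_insert (by simp; grind), wt_insert (by simp; grind),
      wt_insert (by simp; grind), wt_single, h2, i2, j2, o2, r2]; ring
  have c1 : ({z3, y} : Finset V).card ≤ 2 := Finset.card_le_two
  have c2 : ({z2, y1} : Finset V).card ≤ 2 := Finset.card_le_two
  have R' : PrR G (W ∪ {y, y1, y2, z1, z3, z2}) z3 (k + 3) := (fillS hl s {z3, y} (by simp; grind) (by simp; try grind)).prR hl.hx hF (by simp)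
    (by simp [Finset.insert_subset_iff]) (by omega) (by simp) (by simp [Cd]; grind)
  have Q' : PrQ G (W ∪ {y, y1, y2, z1, z3, z2}) z3 (k + 3) := (fillQ hl q {z2, y1} (by simp; grind) (by simp; try grind)).prQ hl.hx hF (by simp)
    (by simp [Finset.insert_subset_iff]) (by omega)
    (by simp) (by simp; grind) ⟨z2, by simp, by assumption⟩ (by simp [Cd]; grind)
  have S' : PrS G (W ∪ {y, y1, y2, z1, z3, z2}) z3 (k + 3) := (fillQ hl q {z2, y1} (by simp; grind) (by simp; try grind)).prS hl.hx hF (by simp)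
    (by simp [Finset.insert_subset_iff]) (by omega)
    (by simp) (by simp; grind) ⟨z1, by simp; grind, by assumption⟩ (by simp [Cd]; grind)
  refine lobeX hG hLB hl (F := {y, y1, y2, z1, z3, z2}) ?_ hF (by simp) (x' := z3) (by simp) ?_ ?_ (.t0 _ R' Q' S' ?_) R' ?_
  · intro z; simp; grind
  · simp only [Finset.mem_insert, Finset.mem_singleton]; grind
  · intro u u' a1 a2 a3 a4 a5 a6
    simp only [Finset.mem_insert, Finset.mem_singleton] at a3 a4
    grind
  · rw [wt_union hF, hwF]; push_cast; omega
  · rw [hwF]; push_cast; omega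

/-- Special lobe: exit followed by a triangle having a degree two outer neighbour. -/
theorem spec_iv {U : Finset V} {G : SimpleGraph V} (hG : Good U G) (ih : IH U) {W : Finset V} (hLB : LB U G W.card) {x y y1 y2 z1 z2 z3 : V}
    (hl : Lobe U G W x y) (hy : NL G y [x, y1, y2]) (hy1 : NL G y1 [y, y2, z1]) (hy2 : NL G y2 [y, y1, z2])
    (hz : z1 ≠ z2) (hz1 : NL G z1 [y1, z3]) {k : ℕ} (q : PrQ G W x (k + 1)) (s : PrS G W x k)
    (hw : 10 * (k : ℤ) + 7 ≤ wt G W) : Bd U G 4 := by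
  by_cases h3 : z3 = z2
  · subst h3; exact spec_iv1 hG hLB hl hy hy1 hy2 hz hz1 s hw
  by_cases had : ¬ G.Adj z2 z3 ∨ dg G z2 = 3 ∧ dg G z3 = 3
  · exact spec_iv2 hG ih hl hy hy1 hy2 hz hz1 h3 had q s hw
  · push Not at had
    have m6 := hy1.f3.1.2.2.1
    rcases hG.nl2 hz1.f2.2.2.2.1.symm had.1.symm hz with h | ⟨c, h⟩
    · exact spec_iv3 hG hLB hl hy hy1 hy2 hz hz1 h3 h q s hw
    · rcases hG.nl2 hy2.f3.2.2.2.2.1.symm had.1 (by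
        rintro rfl
        have := (hy2.f3.2.2.2.2.2 z1).1 hz1.f2.2.2.2.1.symm
        have := hy1.f3.1; have := hy2.f3.1; grind) with h' | ⟨c', h'⟩
      · exact spec_iv4 hG hLB hl hy hy1 hy2 hz hz1 h3 h' q s hw
      · exact absurd h.f3.2.1 (had.2 h'.f3.2.1)

/-- The special lobe lemma. -/
theorem lobe_sp {U : Finset V} {G : SimpleGraph V} (hG : Good U G) (ih : IH U) {W : Finset V} {x y : V}
    (hl : Lobe U G W x y) {k : ℕ} (r : PrR G W x (k + 1)) (q : PrQ G W x (k + 1)) (s : PrS G W x k)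
    (hw : 10 * (k : ℤ) + 7 ≤ wt G W) : Bd U G 4 := by
  have hLB := lobe_lt hG ih W.card
  rcases hG.nl1 hl.xy.symm with ⟨y', hy⟩ | ⟨y1, y2, hy⟩
  · exact lobe_chain hG hLB hl hy r q s (by omega)
  by_cases ha : G.Adj y1 y2
  · have e2 := hy.f3.2.2.2.1.symm
    have e3 := hy.f3.2.2.2.2.1.symm
    have n2 := hy.f3.1.2.1
    have n3 := hy.f3.1.2.2.1
    rcases hG.nl2 e2 ha n3 with h1 | ⟨z1, h1⟩
    · exact lobe2c hG hLB hl hy h1 q s (by omega)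
    rcases hG.nl2 e3 ha.symm n2 with h2 | ⟨z2, h2⟩
    · exact lobe2c hG hLB hl hy.r132 h2 q s (by omega)
    by_cases hz : z1 = z2
    · subst hz; exact spec_ii hG hLB hl hy h1 h2 q s hw
    rcases hG.nl1 h1.f3.2.2.2.2.1.symm with ⟨z3, h3⟩ | ⟨c1, c2, h3⟩
    · exact spec_iv hG ih hLB hl hy h1 h2 hz h3 q s hw
    rcases hG.nl1 h2.f3.2.2.2.2.1.symm with ⟨z3, h4⟩ | ⟨c3, c4, h4⟩
    · exact spec_iv hG ih hLB hl hy.r132 h2 h1 (Ne.symm hz) h4 q s hw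
    exact spec_iii hG ih hl hy h1 h2 hz h3.f3.2.1 h4.f3.2.1 s hw
  · exact lobe2a hG ih hl hy r s (Or.inl ⟨ha, by omega⟩)

/-- Triangle lobe. -/
theorem lobe_C3 {U : Finset V} {G : SimpleGraph V} (hG : Good U G) (ih : IH U) {t a r : V}
    (nd : [t, a, r].Nodup)
    (ht : NL G t [a, r]) (ha : NL G a [t, r]) : Bd U G 4 := by
  simp only [List.nodup_cons, List.mem_cons, List.not_mem_nil, or_false, not_or, not_false_eq_true, List.nodup_nil, and_true] at nd
  obtain ⟨-, dt, et0, et1, ijt⟩ := ht.f2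
  obtain ⟨-, da, ea0, ea1, ija⟩ := ha.f2
  have r0 := et1.symm
  have r1 := ea1.symm
  have dr := hG.deg r (hG.sub _ _ r0)
  obtain ⟨tt, ht⟩ := three_or hG r0 r1 (by grind)
  have hw : wt G {t, a, r} = (5 + (5 + (7 - dg G r))) := by
    rw [wt_insert (by simp; grind), wt_insert (by simp; grind), wt_single, dt, da]; ring
  have R' : PrR G {t, a, r} r 1 := ⟨{r}, by simp [Finset.insert_subset_iff], by simp, by simp, by simp [OK]; grind⟩
  have Q' : PrQ G {t, a, r} r 1 := ⟨{t}, by simp [Finset.insert_subset_iff], by simp, by simp; grind, by simp; grind, by simp [OK]; grind⟩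
  have S' : PrS G {t, a, r} r 1 := ⟨{t}, by simp [Finset.insert_subset_iff], by simp, by simp; grind, by simp; grind, by simp [OK]; grind⟩
  refine lobeW hG (lobe_lt hG ih 0) (W := {t, a, r}) (x := r) (by simp) (by intro z; simp; have := hG.sub; grind) (by simp) (by simp; grind) ?_ (.t0 1 R' Q' S' ?_) R' ?_
  · simp; grind
  · rw [hw]; push_cast; omega
  · rw [hw]; push_cast; omega

/-- Four cycle lobe. -/
theorem lobe_C4 {U : Finset V} {G : SimpleGraph V} (hG : Good U G) (ih : IH U) {t u w r : V}
    (nd : [t, u, w, r].Nodup)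
    (ht : NL G t [r, u]) (hu : NL G u [t, w]) (hw : NL G w [u, r]) : Bd U G 4 := by
  simp only [List.nodup_cons, List.mem_cons, List.not_mem_nil, or_false, not_or, not_false_eq_true, List.nodup_nil, and_true] at nd
  obtain ⟨-, dt, et0, et1, ijt⟩ := ht.f2
  obtain ⟨-, du, eu0, eu1, iju⟩ := hu.f2
  obtain ⟨-, dw, ew0, ew1, ijw⟩ := hw.f2
  have r0 := et0.symm
  have r1 := ew1.symm
  have dr := hG.deg r (hG.sub _ _ r0)
  obtain ⟨tt, ht⟩ := three_or hG r0 r1 (by grind)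
  have hw : wt G {t, u, w, r} = (5 + (5 + (5 + (7 - dg G r)))) := by
    rw [wt_insert (by simp; grind), wt_insert (by simp; grind), wt_insert (by simp; grind), wt_single, dt, du, dw]; ring
  have R' : PrR G {t, u, w, r} r 2 := ⟨{r, t}, by simp [Finset.insert_subset_iff], Finset.card_le_two, by simp, by simp [OK]; grind⟩
  have Q' : PrQ G {t, u, w, r} r 2 := ⟨{t, u}, by simp [Finset.insert_subset_iff], Finset.card_le_two, by simp; grind, by simp; grind, by simp [OK]; grind⟩
  have S' : PrS G {t, u, w, r} r 1 := ⟨{u}, by simp [Finset.insert_subset_iff], by simp, by simp; grind, by simp; grind, by simp [OK]; grind⟩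
  refine lobeW hG (lobe_lt hG ih 0) (W := {t, u, w, r}) (x := r) (by simp) (by intro z; simp; have := hG.sub; grind) (by simp) (by simp; grind) ?_ (.t2 1 R' Q' S' ?_) R' ?_
  · simp; grind
  · rw [hw]; push_cast; omega
  · rw [hw]; push_cast; omega

/-- Five cycle lobe. -/
theorem lobe_C5 {U : Finset V} {G : SimpleGraph V} (hG : Good U G) (ih : IH U) {t u w q r : V}
    (nd : [t, u, w, q, r].Nodup)
    (ht : NL G t [r, u]) (hu : NL G u [t, w]) (hw : NL G w [u, q]) (hq : NL G q [w, r]) (hr : dg G r = 3) : Bd U G 4 := by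
  simp only [List.nodup_cons, List.mem_cons, List.not_mem_nil, or_false, not_or, not_false_eq_true, List.nodup_nil, and_true] at nd
  obtain ⟨-, dt, et0, et1, ijt⟩ := ht.f2
  obtain ⟨-, du, eu0, eu1, iju⟩ := hu.f2
  obtain ⟨-, dw, ew0, ew1, ijw⟩ := hw.f2
  obtain ⟨-, dq, eq0, eq1, ijq⟩ := hq.f2
  have r0 := et0.symm
  have r1 := eq1.symm
  have dr := hG.deg r (hG.sub _ _ r0)
  obtain ⟨tt, ht⟩ := three_or hG r0 r1 (by grind)
  have hw : wt G {t, u, w, q, r} = (5 + (5 + (5 + (5 + (7 - dg G r))))) := by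
    rw [wt_insert (by simp; grind), wt_insert (by simp; grind), wt_insert (by simp; grind), wt_insert (by simp; grind), wt_single, dt, du, dw, dq]; ring
  have R' : PrR G {t, u, w, q, r} r 3 := ⟨{r, t, u}, by simp [Finset.insert_subset_iff], Finset.card_le_three, by simp, by simp [OK]; grind⟩
  have Q' : PrQ G {t, u, w, q, r} r 2 := ⟨{q, t}, by simp [Finset.insert_subset_iff], Finset.card_le_two, by simp; grind, by simp; grind, by simp [OK]; grind⟩
  have S' : PrS G {t, u, w, q, r} r 2 := ⟨{u, w}, by simp [Finset.insert_subset_iff], Finset.card_le_two, by simp; grind, by simp; grind, by simp [OK]; grind⟩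
  rcases hG.nl2 r0 r1 (by grind) with h | ⟨y, h⟩
  · have := h.f2.2.1; omega
  · obtain ⟨h1, -, -, -, h2, h3⟩ := h.f3
    have h4 := h2.symm
    have hyW : y ∉ ({t, u, w, q, r} : Finset V) := by simp; grind
    refine lobe_lt hG ih 0 {t, u, w, q, r} r y (by simp) ⟨by intro z; simp; have := hG.sub; grind, by simp, hyW, h2, by simp; grind⟩ (.t1 2 R' Q' S' ?_)
    rw [hw]; push_cast; omega

/-- Diamond lobe. -/
theorem lobe_K4e {U : Finset V} {G : SimpleGraph V} (hG : Good U G) (ih : IH U) {t a b r : V}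
    (nd : [t, a, b, r].Nodup)
    (ht : NL G t [a, b]) (ha : NL G a [t, b, r]) (hb : NL G b [t, a, r]) : Bd U G 4 := by
  simp only [List.nodup_cons, List.mem_cons, List.not_mem_nil, or_false, not_or, not_false_eq_true, List.nodup_nil, and_true] at nd
  obtain ⟨-, dt, et0, et1, ijt⟩ := ht.f2
  obtain ⟨-, da, ea0, ea1, ea2, ija⟩ := ha.f3
  obtain ⟨-, db, eb0, eb1, eb2, ijb⟩ := hb.f3
  have r0 := ea2.symm
  have r1 := eb2.symm
  have dr := hG.deg r (hG.sub _ _ r0)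
  obtain ⟨tt, ht⟩ := three_or hG r0 r1 (by grind)
  have hw : wt G {t, a, b, r} = (5 + (4 + (4 + (7 - dg G r)))) := by
    rw [wt_insert (by simp; grind), wt_insert (by simp; grind), wt_insert (by simp; grind), wt_single, dt, da, db]; ring
  have R' : PrR G {t, a, b, r} r 2 := ⟨{r, t}, by simp [Finset.insert_subset_iff], Finset.card_le_two, by simp, by simp [OK]; grind⟩
  have Q' : PrQ G {t, a, b, r} r 1 := ⟨{a}, by simp [Finset.insert_subset_iff], by simp, by simp; grind, by simp; grind, by simp [OK]; grind⟩
  have S' : PrS G {t, a, b, r} r 1 := ⟨{t}, by simp [Finset.insert_subset_iff], by simp, by simp; grind, by simp; grind, by simp [OK]; grind⟩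
  refine lobeW hG (lobe_lt hG ih 0) (W := {t, a, b, r}) (x := r) (by simp) (by intro z; simp; have := hG.sub; grind) (by simp) (by simp; grind) ?_ (.t1 1 R' Q' S' ?_) R' ?_
  · simp; grind
  · rw [hw]; push_cast; omega
  · rw [hw]; push_cast; omega

/-- House lobe, root at the base. -/
theorem lobe_H1 {U : Finset V} {G : SimpleGraph V} (hG : Good U G) (ih : IH U) {t a c b r : V}
    (nd : [t, a, c, b, r].Nodup)
    (ht : NL G t [a, b]) (ha : NL G a [t, b, c]) (hc : NL G c [a, r]) (hb : NL G b [t, a, r]) : Bd U G 4 := by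
  simp only [List.nodup_cons, List.mem_cons, List.not_mem_nil, or_false, not_or, not_false_eq_true, List.nodup_nil, and_true] at nd
  obtain ⟨-, dt, et0, et1, ijt⟩ := ht.f2
  obtain ⟨-, da, ea0, ea1, ea2, ija⟩ := ha.f3
  obtain ⟨-, dc, ec0, ec1, ijc⟩ := hc.f2
  obtain ⟨-, db, eb0, eb1, eb2, ijb⟩ := hb.f3
  have r0 := ec1.symm
  have r1 := eb2.symm
  have dr := hG.deg r (hG.sub _ _ r0)
  obtain ⟨tt, ht⟩ := three_or hG r0 r1 (by grind)
  have hw : wt G {t, a, c, b, r} = (5 + (4 + (5 + (4 + (7 - dg G r))))) := by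
    rw [wt_insert (by simp; grind), wt_insert (by simp; grind), wt_insert (by simp; grind), wt_insert (by simp; grind), wt_single, dt, da, dc, db]; ring
  have R' : PrR G {t, a, c, b, r} r 2 := ⟨{r, t}, by simp [Finset.insert_subset_iff], Finset.card_le_two, by simp, by simp [OK]; grind⟩
  have Q' : PrQ G {t, a, c, b, r} r 2 := ⟨{c, t}, by simp [Finset.insert_subset_iff], Finset.card_le_two, by simp; grind, by simp; grind, by simp [OK]; grind⟩
  have S' : PrS G {t, a, c, b, r} r 2 := ⟨{a}, by simp [Finset.insert_subset_iff], ((by simp : Finset.card _ ≤ 1)).trans (by norm_num), by simp; grind, by simp; grind, by simp [OK]; grind⟩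
  refine lobeW hG (lobe_lt hG ih 0) (W := {t, a, c, b, r}) (x := r) (by simp) (by intro z; simp; have := hG.sub; grind) (by simp) (by simp; grind) ?_ (.t0 2 R' Q' S' ?_) R' ?_
  · simp; grind
  · rw [hw]; push_cast; omega
  · rw [hw]; push_cast; omega

/-- House lobe, root at the apex. -/
theorem lobe_H2 {U : Finset V} {G : SimpleGraph V} (hG : Good U G) (ih : IH U) {a b c d r : V}
    (nd : [a, b, c, d, r].Nodup)
    (ha : NL G a [r, b, c]) (hb : NL G b [r, a, d]) (hc : NL G c [a, d]) (hd : NL G d [b, c]) : Bd U G 4 := by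
  simp only [List.nodup_cons, List.mem_cons, List.not_mem_nil, or_false, not_or, not_false_eq_true, List.nodup_nil, and_true] at nd
  obtain ⟨-, da, ea0, ea1, ea2, ija⟩ := ha.f3
  obtain ⟨-, db, eb0, eb1, eb2, ijb⟩ := hb.f3
  obtain ⟨-, dc, ec0, ec1, ijc⟩ := hc.f2
  obtain ⟨-, dd, ed0, ed1, ijd⟩ := hd.f2
  have r0 := ea0.symm
  have r1 := eb0.symm
  have dr := hG.deg r (hG.sub _ _ r0)
  obtain ⟨tt, ht⟩ := three_or hG r0 r1 (by grind)
  have hw : wt G {a, b, c, d, r} = (4 + (4 + (5 + (5 + (7 - dg G r))))) := by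
    rw [wt_insert (by simp; grind), wt_insert (by simp; grind), wt_insert (by simp; grind), wt_insert (by simp; grind), wt_single, da, db, dc, dd]; ring
  have R' : PrR G {a, b, c, d, r} r 2 := ⟨{c, r}, by simp [Finset.insert_subset_iff], Finset.card_le_two, by simp, by simp [OK]; grind⟩
  have Q' : PrQ G {a, b, c, d, r} r 2 := ⟨{a, b}, by simp [Finset.insert_subset_iff], Finset.card_le_two, by simp; grind, by simp; grind, by simp [OK]; grind⟩
  have S' : PrS G {a, b, c, d, r} r 2 := ⟨{a, c}, by simp [Finset.insert_subset_iff], Finset.card_le_two, by simp; grind, by simp; grind, by simp [OK]; grind⟩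
  refine lobeW hG (lobe_lt hG ih 0) (W := {a, b, c, d, r}) (x := r) (by simp) (by intro z; simp; have := hG.sub; grind) (by simp) (by simp; grind) ?_ (.t0 2 R' Q' S' ?_) R' ?_
  · simp; grind
  · rw [hw]; push_cast; omega
  · rw [hw]; push_cast; omega

/-- Diamond and one more vertex. -/
theorem lobe_D5 {U : Finset V} {G : SimpleGraph V} (hG : Good U G) (ih : IH U) {a b c z r : V}
    (nd : [a, b, c, z, r].Nodup)
    (ha : NL G a [b, c, z]) (hb : NL G b [a, c, z]) (hc : NL G c [a, b, r]) (hz : NL G z [a, b, r]) : Bd U G 4 := by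
  simp only [List.nodup_cons, List.mem_cons, List.not_mem_nil, or_false, not_or, not_false_eq_true, List.nodup_nil, and_true] at nd
  obtain ⟨-, da, ea0, ea1, ea2, ija⟩ := ha.f3
  obtain ⟨-, db, eb0, eb1, eb2, ijb⟩ := hb.f3
  obtain ⟨-, dc, ec0, ec1, ec2, ijc⟩ := hc.f3
  obtain ⟨-, dz, ez0, ez1, ez2, ijz⟩ := hz.f3
  have r0 := ec2.symm
  have r1 := ez2.symm
  have dr := hG.deg r (hG.sub _ _ r0)
  obtain ⟨tt, ht⟩ := three_or hG r0 r1 (by grind)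
  have hw : wt G {a, b, c, z, r} = (4 + (4 + (4 + (4 + (7 - dg G r))))) := by
    rw [wt_insert (by simp; grind), wt_insert (by simp; grind), wt_insert (by simp; grind), wt_insert (by simp; grind), wt_single, da, db, dc, dz]; ring
  have R' : PrR G {a, b, c, z, r} r 2 := ⟨{a, r}, by simp [Finset.insert_subset_iff], Finset.card_le_two, by simp, by simp [OK]; grind⟩
  have Q' : PrQ G {a, b, c, z, r} r 2 := ⟨{a, c}, by simp [Finset.insert_subset_iff], Finset.card_le_two, by simp; grind, by simp; grind, by simp [OK]; grind⟩
  have S' : PrS G {a, b, c, z, r} r 1 := ⟨{a}, by simp [Finset.insert_subset_iff], by simp, by simp; grind, by simp; grind, by simp [OK]; grind⟩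
  refine lobeW hG (lobe_lt hG ih 0) (W := {a, b, c, z, r}) (x := r) (by simp) (by intro z; simp; have := hG.sub; grind) (by simp) (by simp; grind) ?_ (.t2 1 R' Q' S' ?_) R' ?_
  · simp; grind
  · rw [hw]; push_cast; omega
  · rw [hw]; push_cast; omega

/-- The lobe on the complete bipartite graph. -/
theorem lobe_K23 {U : Finset V} {G : SimpleGraph V} (hG : Good U G) (ih : IH U) {s t u w r : V}
    (nd : [s, t, u, w, r].Nodup)
    (hs : NL G s [u, w]) (ht : NL G t [u, w]) (hu : NL G u [s, t, r]) (hw : NL G w [s, t, r]) : Bd U G 4 := by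
  simp only [List.nodup_cons, List.mem_cons, List.not_mem_nil, or_false, not_or, not_false_eq_true, List.nodup_nil, and_true] at nd
  obtain ⟨-, ds, es0, es1, ijs⟩ := hs.f2
  obtain ⟨-, dt, et0, et1, ijt⟩ := ht.f2
  obtain ⟨-, du, eu0, eu1, eu2, iju⟩ := hu.f3
  obtain ⟨-, dw, ew0, ew1, ew2, ijw⟩ := hw.f3
  have r0 := eu2.symm
  have r1 := ew2.symm
  have dr := hG.deg r (hG.sub _ _ r0)
  obtain ⟨tt, ht⟩ := three_or hG r0 r1 (by grind)
  have hw : wt G {s, t, u, w, r} = (5 + (5 + (4 + (4 + (7 - dg G r))))) := by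
    rw [wt_insert (by simp; grind), wt_insert (by simp; grind), wt_insert (by simp; grind), wt_insert (by simp; grind), wt_single, ds, dt, du, dw]; ring
  have R' : PrR G {s, t, u, w, r} r 2 := ⟨{r, u}, by simp [Finset.insert_subset_iff], Finset.card_le_two, by simp, by simp [OK]; grind⟩
  have Q' : PrQ G {s, t, u, w, r} r 2 := ⟨{s, u}, by simp [Finset.insert_subset_iff], Finset.card_le_two, by simp; grind, by simp; grind, by simp [OK]; grind⟩
  have S' : PrS G {s, t, u, w, r} r 2 := ⟨{s, t}, by simp [Finset.insert_subset_iff], Finset.card_le_two, by simp; grind, by simp; grind, by simp [OK]; grind⟩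
  refine lobeW hG (lobe_lt hG ih 0) (W := {s, t, u, w, r}) (x := r) (by simp) (by intro z; simp; have := hG.sub; grind) (by simp) (by simp; grind) ?_ (.t0 2 R' Q' S' ?_) R' ?_
  · simp; grind
  · rw [hw]; push_cast; omega
  · rw [hw]; push_cast; omega

/-- Twins on a five cycle. -/
theorem lobe_A6 {U : Finset V} {G : SimpleGraph V} (hG : Good U G) (ih : IH U) {s t u w c r : V}
    (nd : [s, t, u, w, c, r].Nodup)
    (hs : NL G s [u, w]) (ht : NL G t [u, w]) (hu : NL G u [s, t, c]) (hw : NL G w [s, t, r]) (hc : NL G c [u, r]) : Bd U G 4 := by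
  simp only [List.nodup_cons, List.mem_cons, List.not_mem_nil, or_false, not_or, not_false_eq_true, List.nodup_nil, and_true] at nd
  obtain ⟨-, ds, es0, es1, ijs⟩ := hs.f2
  obtain ⟨-, dt, et0, et1, ijt⟩ := ht.f2
  obtain ⟨-, du, eu0, eu1, eu2, iju⟩ := hu.f3
  obtain ⟨-, dw, ew0, ew1, ew2, ijw⟩ := hw.f3
  obtain ⟨-, dc, ec0, ec1, ijc⟩ := hc.f2
  have r0 := ec1.symm
  have r1 := ew2.symm
  have dr := hG.deg r (hG.sub _ _ r0)
  obtain ⟨tt, ht⟩ := three_or hG r0 r1 (by grind)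
  have hw : wt G {s, t, u, w, c, r} = (5 + (5 + (4 + (4 + (5 + (7 - dg G r)))))) := by
    rw [wt_insert (by simp; grind), wt_insert (by simp; grind), wt_insert (by simp; grind), wt_insert (by simp; grind), wt_insert (by simp; grind), wt_single, ds, dt, du, dw, dc]; ring
  have R' : PrR G {s, t, u, w, c, r} r 3 := ⟨{r, s, w}, by simp [Finset.insert_subset_iff], Finset.card_le_three, by simp, by simp [OK]; grind⟩
  have Q' : PrQ G {s, t, u, w, c, r} r 2 := ⟨{c, w}, by simp [Finset.insert_subset_iff], Finset.card_le_two, by simp; grind, by simp; grind, by simp [OK]; grind⟩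
  have S' : PrS G {s, t, u, w, c, r} r 2 := ⟨{s, u}, by simp [Finset.insert_subset_iff], Finset.card_le_two, by simp; grind, by simp; grind, by simp [OK]; grind⟩
  refine lobeW hG (lobe_lt hG ih 0) (W := {s, t, u, w, c, r}) (x := r) (by simp) (by intro z; simp; have := hG.sub; grind) (by simp) (by simp; grind) ?_ (.t1 2 R' Q' S' ?_) R' ?_
  · simp; grind
  · rw [hw]; push_cast; omega
  · rw [hw]; push_cast; omega

/-- Twins on a six cycle. -/
theorem lobe_A7 {U : Finset V} {G : SimpleGraph V} (hG : Good U G) (ih : IH U) {s t u w c f r : V}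
    (nd : [s, t, u, w, c, f, r].Nodup)
    (hs : NL G s [u, w]) (ht : NL G t [u, w]) (hu : NL G u [s, t, c]) (hw : NL G w [s, t, r]) (hc : NL G c [u, f]) (hf : NL G f [c, r]) : Bd U G 4 := by
  simp only [List.nodup_cons, List.mem_cons, List.not_mem_nil, or_false, not_or, not_false_eq_true, List.nodup_nil, and_true] at nd
  obtain ⟨-, ds, es0, es1, ijs⟩ := hs.f2
  obtain ⟨-, dt, et0, et1, ijt⟩ := ht.f2
  obtain ⟨-, du, eu0, eu1, eu2, iju⟩ := hu.f3
  obtain ⟨-, dw, ew0, ew1, ew2, ijw⟩ := hw.f3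
  obtain ⟨-, dc, ec0, ec1, ijc⟩ := hc.f2
  obtain ⟨-, df, ef0, ef1, ijf⟩ := hf.f2
  have r0 := ef1.symm
  have r1 := ew2.symm
  have dr := hG.deg r (hG.sub _ _ r0)
  obtain ⟨tt, ht⟩ := three_or hG r0 r1 (by grind)
  have hw : wt G {s, t, u, w, c, f, r} = (5 + (5 + (4 + (4 + (5 + (5 + (7 - dg G r))))))) := by
    rw [wt_insert (by simp; grind), wt_insert (by simp; grind), wt_insert (by simp; grind), wt_insert (by simp; grind), wt_insert (by simp; grind), wt_insert (by simp; grind), wt_single, ds, dt, du, dw, dc, df]; ring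
  have R' : PrR G {s, t, u, w, c, f, r} r 2 := ⟨{r, u}, by simp [Finset.insert_subset_iff], Finset.card_le_two, by simp, by simp [OK]; grind⟩
  have Q' : PrQ G {s, t, u, w, c, f, r} r 2 := ⟨{c, w}, by simp [Finset.insert_subset_iff], Finset.card_le_two, by simp; grind, by simp; grind, by simp [OK]; grind⟩
  have S' : PrS G {s, t, u, w, c, f, r} r 2 := ⟨{c, w}, by simp [Finset.insert_subset_iff], Finset.card_le_two, by simp; grind, by simp; grind, by simp [OK]; grind⟩
  refine lobeW hG (lobe_lt hG ih 0) (W := {s, t, u, w, c, f, r}) (x := r) (by simp) (by intro z; simp; have := hG.sub; grind) (by simp) (by simp; grind) ?_ (.t0 2 R' Q' S' ?_) R' ?_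
  · simp; grind
  · rw [hw]; push_cast; omega
  · rw [hw]; push_cast; omega

/-- Twins on a six cycle, other root. -/
theorem lobe_A7b {U : Finset V} {G : SimpleGraph V} (hG : Good U G) (ih : IH U) {s t u w c d r : V}
    (nd : [s, t, u, w, c, d, r].Nodup)
    (hs : NL G s [u, w]) (ht : NL G t [u, w]) (hu : NL G u [s, t, c]) (hw : NL G w [s, t, d]) (hc : NL G c [u, r]) (hd : NL G d [w, r]) : Bd U G 4 := by
  simp only [List.nodup_cons, List.mem_cons, List.not_mem_nil, or_false, not_or, not_false_eq_true, List.nodup_nil, and_true] at nd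
  obtain ⟨-, ds, es0, es1, ijs⟩ := hs.f2
  obtain ⟨-, dt, et0, et1, ijt⟩ := ht.f2
  obtain ⟨-, du, eu0, eu1, eu2, iju⟩ := hu.f3
  obtain ⟨-, dw, ew0, ew1, ew2, ijw⟩ := hw.f3
  obtain ⟨-, dc, ec0, ec1, ijc⟩ := hc.f2
  obtain ⟨-, dd, ed0, ed1, ijd⟩ := hd.f2
  have r0 := ec1.symm
  have r1 := ed1.symm
  have dr := hG.deg r (hG.sub _ _ r0)
  obtain ⟨tt, ht⟩ := three_or hG r0 r1 (by grind)
  have hw : wt G {s, t, u, w, c, d, r} = (5 + (5 + (4 + (4 + (5 + (5 + (7 - dg G r))))))) := by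
    rw [wt_insert (by simp; grind), wt_insert (by simp; grind), wt_insert (by simp; grind), wt_insert (by simp; grind), wt_insert (by simp; grind), wt_insert (by simp; grind), wt_single, ds, dt, du, dw, dc, dd]; ring
  have R' : PrR G {s, t, u, w, c, d, r} r 3 := ⟨{r, s, t}, by simp [Finset.insert_subset_iff], Finset.card_le_three, by simp, by simp [OK]; grind⟩
  have Q' : PrQ G {s, t, u, w, c, d, r} r 3 := ⟨{d, u}, by simp [Finset.insert_subset_iff], (Finset.card_le_two).trans (by norm_num), by simp; grind, by simp; grind, by simp [OK]; grind⟩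
  have S' : PrS G {s, t, u, w, c, d, r} r 3 := ⟨{d, u}, by simp [Finset.insert_subset_iff], (Finset.card_le_two).trans (by norm_num), by simp; grind, by simp; grind, by simp [OK]; grind⟩
  refine lobeW hG (lobe_lt hG ih 0) (W := {s, t, u, w, c, d, r}) (x := r) (by simp) (by intro z; simp; have := hG.sub; grind) (by simp) (by simp; grind) ?_ (.t0 3 R' Q' S' ?_) R' ?_
  · simp; grind
  · rw [hw]; push_cast; omega
  · rw [hw]; push_cast; omega

/-- The special lobe. -/
theorem lobe_S6 {U : Finset V} {G : SimpleGraph V} (hG : Good U G) (ih : IH U) {s t u p q r : V}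
    (nd : [s, t, u, p, q, r].Nodup)
    (hs : NL G s [p, q]) (ht : NL G t [p, u]) (hu : NL G u [t, q]) (hp : NL G p [s, t, r]) (hq : NL G q [s, u, r]) : Bd U G 4 := by
  simp only [List.nodup_cons, List.mem_cons, List.not_mem_nil, or_false, not_or, not_false_eq_true, List.nodup_nil, and_true] at nd
  obtain ⟨-, ds, es0, es1, ijs⟩ := hs.f2
  obtain ⟨-, dt, et0, et1, ijt⟩ := ht.f2
  obtain ⟨-, du, eu0, eu1, iju⟩ := hu.f2
  obtain ⟨-, dp, ep0, ep1, ep2, ijp⟩ := hp.f3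
  obtain ⟨-, dq, eq0, eq1, eq2, ijq⟩ := hq.f3
  have r0 := ep2.symm
  have r1 := eq2.symm
  have dr := hG.deg r (hG.sub _ _ r0)
  obtain ⟨tt, ht⟩ := three_or hG r0 r1 (by grind)
  have hw : wt G {s, t, u, p, q, r} = (5 + (5 + (5 + (4 + (4 + (7 - dg G r)))))) := by
    rw [wt_insert (by simp; grind), wt_insert (by simp; grind), wt_insert (by simp; grind), wt_insert (by simp; grind), wt_insert (by simp; grind), wt_single, ds, dt, du, dp, dq]; ring
  have R' : PrR G {s, t, u, p, q, r} r 3 := ⟨{p, r, t}, by simp [Finset.insert_subset_iff], Finset.card_le_three, by simp, by simp [OK]; grind⟩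
  have Q' : PrQ G {s, t, u, p, q, r} r 3 := ⟨{p, s, t}, by simp [Finset.insert_subset_iff], Finset.card_le_three, by simp; grind, by simp; grind, by simp [OK]; grind⟩
  have S' : PrS G {s, t, u, p, q, r} r 2 := ⟨{s, t}, by simp [Finset.insert_subset_iff], Finset.card_le_two, by simp; grind, by simp; grind, by simp [OK]; grind⟩
  by_cases hc : ∀ v ∈ ({s, t, u, p, q, r} : Finset V), ∀ z, G.Adj v z → z ∈ ({s, t, u, p, q, r} : Finset V)
  · exact closed_bd hG (by intro z; simp; have := hG.sub; grind) R' hc (by rw [hw]; push_cast; omega)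
  · have : ∃ y, G.Adj r y ∧ y ∉ ({s, t, u, p, q, r} : Finset V) := by
      push Not at hc; obtain ⟨v, hv, z, hz, hz'⟩ := hc
      simp at hv hz'; refine ⟨z, ?_, by simpa using hz'⟩; grind
    obtain ⟨y, hy, hyW⟩ := this
    refine lobe_sp hG ih (W := {s, t, u, p, q, r}) (x := r) (y := y) ⟨by intro z; simp; have := hG.sub; grind, by simp, hyW, hy, ?_⟩ R' Q' S' (by rw [hw]; push_cast; omega)
    simp at hyW ⊢; grind

/-- Two five cycles. -/
theorem lobe_B7 {U : Finset V} {G : SimpleGraph V} (hG : Good U G) (ih : IH U) {s t u p q c r : V}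
    (nd : [s, t, u, p, q, c, r].Nodup)
    (hs : NL G s [p, q]) (ht : NL G t [p, u]) (hu : NL G u [t, q]) (hp : NL G p [s, t, c]) (hq : NL G q [s, u, r]) (hc : NL G c [p, r]) : Bd U G 4 := by
  simp only [List.nodup_cons, List.mem_cons, List.not_mem_nil, or_false, not_or, not_false_eq_true, List.nodup_nil, and_true] at nd
  obtain ⟨-, ds, es0, es1, ijs⟩ := hs.f2
  obtain ⟨-, dt, et0, et1, ijt⟩ := ht.f2
  obtain ⟨-, du, eu0, eu1, iju⟩ := hu.f2
  obtain ⟨-, dp, ep0, ep1, ep2, ijp⟩ := hp.f3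
  obtain ⟨-, dq, eq0, eq1, eq2, ijq⟩ := hq.f3
  obtain ⟨-, dc, ec0, ec1, ijc⟩ := hc.f2
  have r0 := ec1.symm
  have r1 := eq2.symm
  have dr := hG.deg r (hG.sub _ _ r0)
  obtain ⟨tt, ht⟩ := three_or hG r0 r1 (by grind)
  have hw : wt G {s, t, u, p, q, c, r} = (5 + (5 + (5 + (4 + (4 + (5 + (7 - dg G r))))))) := by
    rw [wt_insert (by simp; grind), wt_insert (by simp; grind), wt_insert (by simp; grind), wt_insert (by simp; grind), wt_insert (by simp; grind), wt_insert (by simp; grind), wt_single, ds, dt, du, dp, dq, dc]; ring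
  have R' : PrR G {s, t, u, p, q, c, r} r 3 := ⟨{r, s, t}, by simp [Finset.insert_subset_iff], Finset.card_le_three, by simp, by simp [OK]; grind⟩
  have Q' : PrQ G {s, t, u, p, q, c, r} r 3 := ⟨{c, s, u}, by simp [Finset.insert_subset_iff], Finset.card_le_three, by simp; grind, by simp; grind, by simp [OK]; grind⟩
  have S' : PrS G {s, t, u, p, q, c, r} r 3 := ⟨{p, s, t}, by simp [Finset.insert_subset_iff], Finset.card_le_three, by simp; grind, by simp; grind, by simp [OK]; grind⟩
  refine lobeW hG (lobe_lt hG ih 0) (W := {s, t, u, p, q, c, r}) (x := r) (by simp) (by intro z; simp; have := hG.sub; grind) (by simp) (by simp; grind) ?_ (.t0 3 R' Q' S' ?_) R' ?_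
  · simp; grind
  · rw [hw]; push_cast; omega
  · rw [hw]; push_cast; omega

/-- Complete graph. -/
theorem base_K4 {U : Finset V} {G : SimpleGraph V} (hG : Good U G) (ih : IH U) {a b c d : V}
    (nd : [a, b, c, d].Nodup)
    (ha : NL G a [b, c, d]) (hb : NL G b [a, c, d]) (hc : NL G c [a, b, d]) (hd : NL G d [a, b, c]) : Bd U G 4 := by
  simp only [List.nodup_cons, List.mem_cons, List.not_mem_nil, or_false, not_or, not_false_eq_true, List.nodup_nil, and_true] at nd
  obtain ⟨-, da, ea0, ea1, ea2, ija⟩ := ha.f3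
  obtain ⟨-, db, eb0, eb1, eb2, ijb⟩ := hb.f3
  obtain ⟨-, dc, ec0, ec1, ec2, ijc⟩ := hc.f3
  obtain ⟨-, dd, ed0, ed1, ed2, ijd⟩ := hd.f3
  have hw : wt G {a, b, c, d} = (4 + (4 + (4 + 4))) := by
    rw [wt_insert (by simp; grind), wt_insert (by simp; grind), wt_insert (by simp; grind), wt_single, da, db, dc, dd]; ring
  have R' : PrR G {a, b, c, d} d 1 := ⟨{d}, by simp [Finset.insert_subset_iff], by simp, by simp, by simp [OK]; grind⟩
  exact closed_bd hG (by intro z; simp; have := hG.sub; grind) R' (by simp; grind) (by rw [hw]; norm_num)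

/-- Prism. -/
theorem base_prism {U : Finset V} {G : SimpleGraph V} (hG : Good U G) (ih : IH U) {a b c d e f : V}
    (nd : [a, b, c, d, e, f].Nodup)
    (ha : NL G a [b, c, d]) (hb : NL G b [a, c, e]) (hc : NL G c [a, b, f]) (hd : NL G d [a, e, f]) (he : NL G e [b, d, f]) (hf : NL G f [c, d, e]) : Bd U G 4 := by
  simp only [List.nodup_cons, List.mem_cons, List.not_mem_nil, or_false, not_or, not_false_eq_true, List.nodup_nil, and_true] at nd
  obtain ⟨-, da, ea0, ea1, ea2, ija⟩ := ha.f3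
  obtain ⟨-, db, eb0, eb1, eb2, ijb⟩ := hb.f3
  obtain ⟨-, dc, ec0, ec1, ec2, ijc⟩ := hc.f3
  obtain ⟨-, dd, ed0, ed1, ed2, ijd⟩ := hd.f3
  obtain ⟨-, de, ee0, ee1, ee2, ije⟩ := he.f3
  obtain ⟨-, df, ef0, ef1, ef2, ijf⟩ := hf.f3
  have hw : wt G {a, b, c, d, e, f} = (4 + (4 + (4 + (4 + (4 + 4))))) := by
    rw [wt_insert (by simp; grind), wt_insert (by simp; grind), wt_insert (by simp; grind), wt_insert (by simp; grind), wt_insert (by simp; grind), wt_single, da, db, dc, dd, de, df]; ring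
  have R' : PrR G {a, b, c, d, e, f} f 2 := ⟨{a, f}, by simp [Finset.insert_subset_iff], Finset.card_le_two, by simp, by simp [OK]; grind⟩
  exact closed_bd hG (by intro z; simp; have := hG.sub; grind) R' (by simp; grind) (by rw [hw]; norm_num)

/-- Seven vertices, claw. -/
theorem base_claw {U : Finset V} {G : SimpleGraph V} (hG : Good U G) (ih : IH U) {u v w p q r a : V}
    (nd : [u, v, w, p, q, r, a].Nodup)
    (hu : NL G u [a, p]) (hv : NL G v [a, q]) (hw : NL G w [a, r]) (hp : NL G p [u, q, r]) (hq : NL G q [v, p, r]) (hr : NL G r [w, p, q]) (ha : NL G a [u, v, w]) : Bd U G 4 := by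
  simp only [List.nodup_cons, List.mem_cons, List.not_mem_nil, or_false, not_or, not_false_eq_true, List.nodup_nil, and_true] at nd
  obtain ⟨-, du, eu0, eu1, iju⟩ := hu.f2
  obtain ⟨-, dv, ev0, ev1, ijv⟩ := hv.f2
  obtain ⟨-, dw, ew0, ew1, ijw⟩ := hw.f2
  obtain ⟨-, dp, ep0, ep1, ep2, ijp⟩ := hp.f3
  obtain ⟨-, dq, eq0, eq1, eq2, ijq⟩ := hq.f3
  obtain ⟨-, dr, er0, er1, er2, ijr⟩ := hr.f3
  obtain ⟨-, da, ea0, ea1, ea2, ija⟩ := ha.f3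
  have hw : wt G {u, v, w, p, q, r, a} = (5 + (5 + (5 + (4 + (4 + (4 + 4)))))) := by
    rw [wt_insert (by simp; grind), wt_insert (by simp; grind), wt_insert (by simp; grind), wt_insert (by simp; grind), wt_insert (by simp; grind), wt_insert (by simp; grind), wt_single, du, dv, dw, dp, dq, dr, da]; ring
  have R' : PrR G {u, v, w, p, q, r, a} a 3 := ⟨{a, p, u}, by simp [Finset.insert_subset_iff], Finset.card_le_three, by simp, by simp [OK]; grind⟩
  exact closed_bd hG (by intro z; simp; have := hG.sub; grind) R' (by simp; grind) (by rw [hw]; norm_num)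

/-- Seven vertices, subdivided edge. -/
theorem base_A8 {U : Finset V} {G : SimpleGraph V} (hG : Good U G) (ih : IH U) {a b c d e f v : V}
    (nd : [a, b, c, d, e, f, v].Nodup)
    (ha : NL G a [v, c, d]) (hb : NL G b [v, e, f]) (hc : NL G c [a, e, f]) (hd : NL G d [a, e, f]) (he : NL G e [b, c, d]) (hf : NL G f [b, c, d]) (hv : NL G v [a, b]) : Bd U G 4 := by
  simp only [List.nodup_cons, List.mem_cons, List.not_mem_nil, or_false, not_or, not_false_eq_true, List.nodup_nil, and_true] at nd
  obtain ⟨-, da, ea0, ea1, ea2, ija⟩ := ha.f3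
  obtain ⟨-, db, eb0, eb1, eb2, ijb⟩ := hb.f3
  obtain ⟨-, dc, ec0, ec1, ec2, ijc⟩ := hc.f3
  obtain ⟨-, dd, ed0, ed1, ed2, ijd⟩ := hd.f3
  obtain ⟨-, de, ee0, ee1, ee2, ije⟩ := he.f3
  obtain ⟨-, df, ef0, ef1, ef2, ijf⟩ := hf.f3
  obtain ⟨-, dv, ev0, ev1, ijv⟩ := hv.f2
  have hw : wt G {a, b, c, d, e, f, v} = (4 + (4 + (4 + (4 + (4 + (4 + 5)))))) := by
    rw [wt_insert (by simp; grind), wt_insert (by simp; grind), wt_insert (by simp; grind), wt_insert (by simp; grind), wt_insert (by simp; grind), wt_insert (by simp; grind), wt_single, da, db, dc, dd, de, df, dv]; ring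
  have R' : PrR G {a, b, c, d, e, f, v} v 3 := ⟨{a, b, v}, by simp [Finset.insert_subset_iff], Finset.card_le_three, by simp, by simp [OK]; grind⟩
  exact closed_bd hG (by intro z; simp; have := hG.sub; grind) R' (by simp; grind) (by rw [hw]; norm_num)

/-- There is no bridge inside a minimal set. -/
theorem nobridge {U L : Finset V} {G : SimpleGraph V} (hG : Good U G) (hL : MinL U G L) {M : Finset V} (hM : M ⊆ U)
    {m m' : V} (h1 : m ∈ M) (h2 : m' ∉ M) (h3 : m ∈ L) (h4 : m' ∈ L) (h5 : G.Adj m m') (hc : cut1 G M) : False := by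
  have mU := hL.sub h3
  have mU' := hL.sub h4
  by_cases a : M ⊆ L
  · exact hL.min M a ⟨m, h1⟩ (by rintro rfl; exact h2 h4) hc
  by_cases b : U \ M ⊆ L
  · refine hL.min (U \ M) b ⟨m', by simp [h2, mU']⟩ (fun h => ?_) ?_
    · rw [← h] at h3; simp [h1] at h3
    · intro u v u' v' a1 a2 a3 a4 a5 a6
      have hv := hG.sub _ _ a3.symm
      have hv' := hG.sub _ _ a6.symm
      simp only [Finset.mem_sdiff, not_and, not_not] at a1 a2 a4 a5
      have := hc v u v' u' (a2 hv) a1.2 a3.symm (a5 hv') a4.2 a6.symm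
      exact ⟨this.2, this.1⟩
  have key : ∀ Z : Finset V, Z ⊆ U → Z.Nonempty → (∀ z ∈ Z, z ∉ L) → (∀ z ∈ Z, ∀ w, G.Adj z w → w ∉ L → w ∈ Z) →
      ∃ u v, u ∈ L ∧ v ∈ Z ∧ G.Adj u v := by
    intro Z hZ hZn hZL hZc
    by_contra hno
    push Not at hno
    have : Z = U := by
      apply hG.conn Z hZ hZn
      intro u hu v huv
      refine hZc u hu v huv (fun h => hno v u h hu huv.symm)
    exact hZL m (this ▸ mU) h3
  obtain ⟨u, v, b1, b2, b3⟩ := key (M \ L) (Finset.sdiff_subset.trans hM) (Finset.sdiff_nonempty.2 a) (by simp) (by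
    intro z hz w hzw hw
    simp only [Finset.mem_sdiff] at hz ⊢
    refine ⟨?_, hw⟩
    by_contra h
    have := hc z w m m' hz.1 h hzw h1 h2 h5
    exact hw (this.2 ▸ h4))
  obtain ⟨u', v', c1, c2, c3⟩ := key ((U \ M) \ L) (Finset.sdiff_subset.trans Finset.sdiff_subset) (Finset.sdiff_nonempty.2 b) (by simp) (by
    intro z hz w hzw hw
    simp only [Finset.mem_sdiff] at hz ⊢
    refine ⟨⟨hG.sub _ _ hzw.symm, fun h => ?_⟩, hw⟩
    have := hc w z m m' h hz.1.2 hzw.symm h1 h2 h5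
    exact hw (this.1 ▸ h3))
  simp only [Finset.mem_sdiff] at b2 c2
  have := hL.cut u v u' v' b1 b2.2 b3 c1 c2.2 c3
  exact c2.1.2 (this.2 ▸ b2.1)

theorem In_or {U L : Finset V} {G : SimpleGraph V} (hL : MinL U G L) {u v : V} (hu : u ∈ L) (hv : v ∈ L) (h : u ≠ v) :
    In G L u ∨ In G L v := by
  by_contra hno
  push Not at hno
  have h1 : ∃ z, G.Adj u z ∧ z ∉ L := by by_contra h'; push Not at h'; exact hno.1 ⟨hu, h'⟩
  have h2 : ∃ z, G.Adj v z ∧ z ∉ L := by by_contra h'; push Not at h'; exact hno.2 ⟨hv, h'⟩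
  obtain ⟨z, a1, a2⟩ := h1
  obtain ⟨w, b1, b2⟩ := h2
  exact h (hL.cut u z v w hu a2 a1 hv b2 b1).1

theorem nIn {G : SimpleGraph V} {L : Finset V} {v : V} (hv : v ∈ L) (h : ¬ In G L v) : ∃ z, G.Adj v z ∧ z ∉ L := by
  by_contra h'; push Not at h'; exact h ⟨hv, h'⟩

theorem In_two {U L : Finset V} {G : SimpleGraph V} (hG : Good U G) (hL : MinL U G L) {v a b : V} (hv : v ∈ L) (h : NL G v [a, b]) :
    In G L v := by
  by_contra hn
  obtain ⟨z, h1, h2⟩ := nIn hv hn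
  have key : ∀ a b, NL G v [a, b] → a ∉ L → False := by
    intro a b h ha
    obtain ⟨⟨n1, n2, n3⟩, hd, e1, e2, e3⟩ := h.f2
    have hb : b ∈ L := by
      by_contra hb
      exact n3 (hL.cut v a v b hv ha e1 hv hb e2).2
    refine nobridge hG hL (M := {v}) (by simpa using hL.sub hv) (m := v) (m' := b) (by simp) (by simpa using n2.symm) hv hb e2 ?_
    have hm := hL.min (L.erase v) (Finset.erase_subset _ _) ⟨b, by simp [hb, n2.symm]⟩ (by simp [hv])
    exfalso; apply hm
    intro u w u' w' a1 a2 a3 a4 a5 a6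
    have : ∀ u w, u ∈ L.erase v → w ∉ L.erase v → G.Adj u w → u = b ∧ w = v := by
      intro u w c1 c2 c3
      rw [Finset.mem_erase] at c1
      by_cases hw : w ∈ L
      · have : w = v := by by_contra h; exact c2 (by simp [hw, h])
        subst this
        rcases (e3 u).1 c3.symm with h | h
        · exact absurd c1.2 (h ▸ ha)
        · exact ⟨h, rfl⟩
      · exact absurd (hL.cut u w v a c1.2 hw c3 hv ha e1).1 c1.1
    rw [(this u w a1 a2 a3).1, (this u w a1 a2 a3).2, (this u' w' a4 a5 a6).1, (this u' w' a4 a5 a6).2]; simp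
  rcases (h.f2.2.2.2.2 z).1 h1 with rfl | rfl
  · exact key _ _ h h2
  · exact key _ _ h.r21 h2

/-- Reduction with a new edge; the ends of the new edge may lie outside `L`. -/
theorem stepN {U L : Finset V} {G : SimpleGraph V} (hG : Good U G) (ih : IH U) (hL : MinL U G L)
    {D : Pt V} (hD : Patch G D) (p q : V) (c : ℕ) (hne : p ≠ q) (hp : p ∈ hf D) (hq : q ∈ hf D) (hpq : ¬ G.Adj p q)
    (hdeg : ∀ z ∈ hf D, 2 + cnt (· = z) (hf D) ≤ dg G z + nw p q z)
    (hE : ∀ d ∈ D, ∀ z ∈ d.2.2, z ≠ p → z ≠ q → d.1 ∈ L ∧ z ∈ L)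
    (hconn : ∀ W : Finset V, p ∉ W → q ∉ W → 2 ≤ cnt (· ∈ W) (hf D) → W ⊆ U \ VS D →
      (∀ u ∈ W, ∀ v, v ∉ VS D → G.Adj u v → v ∈ W) → False)
    (hext : Ext G (VS D) p q c)
    (hdrop : 10 * (c : ℤ) + 1 ≤ drop D + 2) : Bd U G 4 := by
  have hn : D ≠ [] := by rintro rfl; simp [hf] at hp
  have hXn : (VS D).Nonempty := by
    obtain ⟨d, hd⟩ := List.exists_mem_of_ne_nil _ hn
    exact ⟨d.1, by rw [mem_VS]; simp only [vs, List.mem_map]; exact ⟨d, hd, rfl⟩⟩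
  have key : ∀ W : Finset V, W ⊆ U \ VS D → W.Nonempty → p ∉ W → q ∉ W →
      (∀ u ∈ W, ∀ v, v ∉ VS D → G.Adj u v → v ∈ W) → False := by
    intro W h1 h2 h3 h4 h5
    have hWX : ∀ z ∈ W, z ∉ VS D := fun z hz => (Finset.mem_sdiff.1 (h1 hz)).2
    refine hconn W h3 h4 ?_ h1 h5
    by_contra h6
    have hcr : ∃ u v, u ∈ W ∧ v ∉ W ∧ G.Adj u v := by
      by_contra hno; push Not at hno
      have : W = U := hG.conn W (h1.trans Finset.sdiff_subset) h2 (fun u hu v huv => by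
        by_contra h; exact hno u v hu h huv)
      obtain ⟨x, hx⟩ := hXn
      exact hWX x (this ▸ hD.sub hG hx) hx
    obtain ⟨u, v, b1, b2, b3⟩ := hcr
    have cr : ∀ u v, u ∈ W → v ∉ W → G.Adj u v → v ∈ VS D := by
      intro u v b1 b2 b3
      by_contra h; exact b2 (h5 u b1 v h b3)
    have hv := cr u v b1 b2 b3
    have := hD.hf_of_adj hv (hWX u b1) b3.symm
    simp only [List.mem_flatMap, List.mem_map, Prod.mk.injEq] at this
    obtain ⟨d, hd, y, hy, rfl, rfl⟩ := this
    have hLL := hE d hd y hy (by rintro rfl; exact h3 b1) (by rintro rfl; exact h4 b1)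
    refine nobridge hG hL (h1.trans Finset.sdiff_subset) b1 b2 hLL.2 hLL.1 b3 ?_
    intro u1 v1 u2 v2 a1 a2 a3 a4 a5 a6
    by_contra h
    exact h6 (hD.two _ (cr u1 v1 a1 a2 a3) (hWX u1 a1) a3.symm (cr u2 v2 a4 a5 a6) (hWX u2 a4) a6.symm (by tauto) a1 a4)
  refine step hG ih hD (List.ne_nil_of_mem hp) p q c (fun _ => ⟨hp, hq, hpq⟩) hdeg ?_ hext (by simpa [hne] using hdrop)
  intro W h1 h2 h3 h4 h5
  have h5 := h5 hne
  by_cases hpW : p ∈ W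
  · refine key ((U \ VS D) \ W) Finset.sdiff_subset ?_ (by simp [hpW]) (by simp [h5.1 hpW]) ?_
    · rw [Finset.sdiff_nonempty]; exact fun h => h3 (Finset.Subset.antisymm h1 h)
    · intro u hu v hv huv
      rw [Finset.mem_sdiff, Finset.mem_sdiff] at hu ⊢
      refine ⟨⟨hG.sub v u huv.symm, hv⟩, fun h => hu.2 (h4 v h u hu.1.2 huv.symm)⟩
  · exact key W h1 h2 hpW (by rwa [← h5]) h4

/-- Working context. -/
structure Cx (U L : Finset V) (G : SimpleGraph V) : Prop where
  g : Good U G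
  ih : IH U
  m : MinL U G L
  nb : ¬ Bd U G 4
  n5 : ¬ (U.card = 5 ∧ wt G U = 25)

theorem Good.dge {U : Finset V} {G : SimpleGraph V} (hG : Good U G) {v a : V} (h : G.Adj v a) : dg G v = 2 ∨ dg G v = 3 :=
  hG.deg v (hG.sub v a h)

/-- Three consecutive vertices of degree two. -/
theorem A0 {U L : Finset V} {G : SimpleGraph V} (hC : Cx U L G) {t1 t2 t3 p q : V} (ht : t2 ∈ L)
    (h1 : NL G t1 [t2, p]) (h2 : NL G t2 [t1, t3]) (h3 : NL G t3 [t2, q]) : False := by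
  have ⟨g, ih, m, nb, n5⟩ := hC
  apply nb
  have i2 := In_two g m ht h2
  have i1 := In_two g m (i2.2 t1 (h2.adj (by simp))) h1
  have i3 := In_two g m (i2.2 t3 (h2.adj (by simp))) h3
  obtain ⟨a1, d1, b1, c1, e1⟩ := h1.f2
  obtain ⟨a2, d2, b2, c2, e2⟩ := h2.f2
  obtain ⟨a3, d3, b3, c3, e3⟩ := h3.f2
  by_cases h13 : G.Adj t1 t3
  · have hp : p = t3 := by grind
    have hq : q = t1 := by have := h13.symm; grind
    subst hp hq
    exact lobe_C3 g ih (t := q) (a := p) (r := t2) (by simp; grind) h1.r21 h3.r21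
  have np : p ≠ t3 := by grind
  have nq : q ≠ t1 := by rintro rfl; exact h13 c3.symm
  by_cases hpq : p = q
  · subst hpq
    exact lobe_C4 g ih (t := t1) (u := t2) (w := t3) (r := p) (by simp; grind) h1.r21 h2 h3
  have dp := g.dge c1.symm
  have dq := g.dge c3.symm
  by_cases hA : G.Adj p q
  · rcases dp with dp | dp
    · have np2 : NL G p [t1, q] := by
        rcases g.nl2 c1.symm hA (by grind) with h | ⟨c, h⟩
        · exact h
        · have := h.dg; simp at this; omega
      rcases dq with dq | dq
      · have nq2 : NL G q [t3, p] := by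
          rcases g.nl2 c3.symm hA.symm (by grind) with h | ⟨c, h⟩
          · exact h
          · have := h.dg; simp at this; omega
        exfalso
        have hU : ({t1, t2, t3, p, q} : Finset V) = U := by
          apply g.conn
          · have := g.sub _ _ b1; have := g.sub _ _ b2; have := g.sub _ _ b3
            have := g.sub _ _ hA; have := g.sub _ _ hA.symm
            simp [Finset.insert_subset_iff, *]
          · simp
          · obtain ⟨-, -, -, -, e4⟩ := np2.f2
            obtain ⟨-, -, -, -, e5⟩ := nq2.f2
            simp only [Finset.mem_insert, Finset.mem_singleton]
            grind
        apply n5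
        rw [← hU]
        constructor
        · rw [Finset.card_insert_of_notMem, Finset.card_insert_of_notMem, Finset.card_insert_of_notMem, Finset.card_insert_of_notMem] <;> simp <;> grind
        · unfold wt
          rw [Finset.sum_insert, Finset.sum_insert, Finset.sum_insert, Finset.sum_insert, Finset.sum_singleton] <;> simp [d1, d2, d3, dp, dq] <;> grind
      · exact lobe_C5 g ih (t := p) (u := t1) (w := t2) (q := t3) (r := q) (by simp; grind) np2.r21 h1.r21 h2 h3 dq
    · rcases dq with dq | dq
      · have nq2 : NL G q [t3, p] := by
          rcases g.nl2 c3.symm hA.symm (by grind) with h | ⟨c, h⟩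
          · exact h
          · have := h.dg; simp at this; omega
        exact lobe_C5 g ih (t := q) (u := t3) (w := t2) (q := t1) (r := p) (by simp; grind) nq2.r21 h3.r21 h2.r21 h1 dp
      · exact P3L g ih m h1 h2 h3 h13 (by simp) (by simp) i1 i2 i3 p p (by simp) (by simp)
          (by simp [cnt, nw, dp, dq, hpq, Ne.symm hpq])
  · refine P3L g ih m h1 h2 h3 h13 (by simp) (by simp) i1 i2 i3 p q (by simp [hA]) (by simp) ?_
    simp [cnt, nw, hpq, Ne.symm hpq]; omega

theorem Good.d22 {U : Finset V} {G : SimpleGraph V} (hG : Good U G) {v a b : V} (h : G.Adj v a) (h' : G.Adj v b)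
    (hab : a ≠ b) (hd : dg G v = 2) : NL G v [a, b] := by
  rcases hG.nl2 h h' hab with h | ⟨c, h⟩
  · exact h
  · have := h.dg; simp at this; omega

theorem Good.d32 {U : Finset V} {G : SimpleGraph V} (hG : Good U G) {v a b : V} (h : G.Adj v a) (h' : G.Adj v b)
    (hab : a ≠ b) (hd : dg G v = 3) : ∃ c, NL G v [a, b, c] := by
  rcases hG.nl2 h h' hab with h | h
  · have := h.dg; simp at this; omega
  · exact h

theorem Good.d33 {U : Finset V} {G : SimpleGraph V} (hG : Good U G) {v a b c : V} (h : G.Adj v a) (h' : G.Adj v b)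
    (h'' : G.Adj v c) (hab : a ≠ b) (hac : a ≠ c) (hbc : b ≠ c) : NL G v [a, b, c] := by
  rcases hG.nl2 h h' hab with h1 | ⟨d, h1⟩
  · obtain ⟨-, -, -, -, e⟩ := h1.f2; grind
  · obtain ⟨-, -, -, -, -, e⟩ := h1.f3
    have : c = d := by grind
    rwa [this]

theorem T1x {U L : Finset V} {G : SimpleGraph V} (g : Good U G) (m : MinL U G L) {t a b a1 b1 : V} (ht : t ∈ L) (ha : a ∈ L)
    (hb : b ∈ L) (h1 : NL G t [a, b]) (h2 : NL G a [t, b, a1]) (h3 : NL G b [t, a, b1]) (hE : a1 ≠ b1) : In G L a := by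
  obtain ⟨n1, d1, -, c1, e1⟩ := h1.f2
  obtain ⟨n2, d2, -, -, c2, e2⟩ := h2.f3
  obtain ⟨n3, d3, -, -, c3, e3⟩ := h3.f3
  have : a1 ∈ L := by
    by_contra hn
    have hb1 : b1 ∈ L := by
      by_contra hn'
      have := m.cut a a1 b b1 ha hn c2 hb hn' c3
      grind
    refine nobridge g m (M := L \ {t, a, b}) (Finset.sdiff_subset.trans m.sub) (m := b1) (m' := b) (by simp [hb1]; grind) (by simp) hb1 hb c3.symm ?_
    have key : ∀ u v, u ∈ L \ {t, a, b} → v ∉ L \ {t, a, b} → G.Adj u v → u = b1 ∧ v = b := by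
      intro u v h4 h5 h6
      have h6' := h6.symm
      simp only [Finset.mem_sdiff, Finset.mem_insert, Finset.mem_singleton, not_or] at h4 h5
      by_cases hv : v ∈ L
      · have : v = t ∨ v = a ∨ v = b := by grind
        rcases this with rfl | rfl | rfl
        · rw [e1] at h6'; grind
        · rw [e2] at h6'; grind
        · rw [e3] at h6'; grind
      · have := m.cut a a1 u v ha hn c2 h4.1 hv h6
        grind
    intro u v u' v' h4 h5 h6 h7 h8 h9
    have := key u v h4 h5 h6
    have := key u' v' h7 h8 h9
    grind
  refine ⟨ha, fun z hz => ?_⟩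
  rcases (e2 z).1 hz with rfl | rfl | rfl
  · exact ht
  · exact hb
  · exact this

/-- A degree two vertex in a triangle. -/
theorem T1 {U L : Finset V} {G : SimpleGraph V} (hC : Cx U L G) {t a b : V} (ht : t ∈ L)
    (h1 : NL G t [a, b]) (hab : G.Adj a b) : False := by
  have ⟨g, ih, m, nb, n5⟩ := hC
  apply nb
  have i1 := In_two g m ht h1
  obtain ⟨n1, d1, b1, c1, e1⟩ := h1.f2
  rcases g.dge hab with da | da
  · exact lobe_C3 g ih (t := t) (a := a) (r := b) (by simp; grind) h1 (g.d22 b1.symm hab n1.2.1 da)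
  rcases g.dge hab.symm with db | db
  · exact lobe_C3 g ih (t := t) (a := b) (r := a) (by simp; grind) h1.r21 (g.d22 c1.symm hab.symm n1.1 db)
  obtain ⟨a1, h2⟩ := g.d32 b1.symm hab n1.2.1 da
  obtain ⟨b1, h3⟩ := g.d32 c1.symm hab.symm n1.1 db
  obtain ⟨n2, d2, -, -, c2, e2⟩ := h2.f3
  obtain ⟨n3, d3, -, -, c3, e3⟩ := h3.f3
  have ha := i1.2 a (h1.adj (by simp))
  have hb := i1.2 b (h1.adj (by simp))
  by_cases hE : a1 = b1
  · subst hE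
    exact lobe_K4e g ih (t := t) (a := a) (b := b) (r := a1) (by simp; grind) h1 h2 h3
  have ia := T1x g m ht ha hb h1 h2 h3 hE
  have ib := T1x g m ht hb ha h1.r21 h3 h2 (Ne.symm hE)
  have da1 := g.dge c2.symm
  have db1 := g.dge c3.symm
  by_cases hA : G.Adj a1 b1
  · rcases da1 with da1 | da1
    · exact lobe_H1 g ih (t := t) (a := a) (c := a1) (b := b) (r := b1) (by simp; grind) h1 h2 (g.d22 c2.symm hA (by grind) da1) h3
    rcases db1 with db1 | db1
    · exact lobe_H1 g ih (t := t) (a := b) (c := b1) (b := a) (r := a1) (by simp; grind) h1.r21 h3 (g.d22 c3.symm hA.symm (by grind) db1) h2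
    exact TRL g ih m h2 h1 h3 (by simp) (by simp) ia i1 ib a1 a1 (by simp) (by simp)
      (by simp [cnt, nw, da1, db1, hE, Ne.symm hE])
  · refine TRL g ih m h2 h1 h3 (by simp) (by simp) ia i1 ib a1 b1 (by simp [hA]) (by simp [hE]) ?_
    simp [cnt, nw, hE, Ne.symm hE]; omega

theorem T3e {U L : Finset V} {G : SimpleGraph V} (hC : Cx U L G) {a b c a1 b1 c1 : V}
    (ia : In G L a) (ib : In G L b) (ic : In G L c)
    (h1 : NL G a [b, c, a1]) (h2 : NL G b [a, c, b1]) (h3 : NL G c [a, b, c1])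
    (hab : a1 ≠ b1) (hac : a1 ≠ c1) (hbc : b1 ≠ c1) (hA : ¬ G.Adj a1 b1) (hd : dg G c1 = 3) : False := by
  have ⟨g, ih, m, nb, n5⟩ := hC
  apply nb
  obtain ⟨n1, d1, -, -, f1, e1⟩ := h1.f3
  obtain ⟨n2, d2, -, -, f2, e2⟩ := h2.f3
  have := g.dge f1.symm
  have := g.dge f2.symm
  refine TRL g ih m h1.r213 h3 h2.r213 (by simp) (by simp) ia ic ib a1 b1 (by simp [hA]) (by simp [hab]) ?_
  simp [cnt, nw, hab, Ne.symm hab, hac, hac.symm, hbc, hbc.symm, hd]; omega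

theorem T3q {U L : Finset V} {G : SimpleGraph V} (hC : Cx U L G) {a b c z c1 : V}
    (ia : In G L a) (ib : In G L b) (ic : In G L c)
    (h1 : NL G a [b, c, z]) (h2 : NL G b [a, c, z]) (h3 : NL G c [a, b, c1]) : False := by
  have ⟨g, ih, m, nb, n5⟩ := hC
  apply nb
  obtain ⟨n1, d1, -, -, f1, e1⟩ := h1.f3
  obtain ⟨n2, d2, -, -, f2, e2⟩ := h2.f3
  obtain ⟨n3, d3, -, -, f3, e3⟩ := h3.f3
  have dc := g.dge f3.symm
  by_cases hz : z = c1
  · subst hz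
    exact base_K4 g ih (a := a) (b := b) (c := c) (d := z) (by simp; grind) h1 h2 h3
      (g.d33 f1.symm f2.symm f3.symm (by grind) (by grind) (by grind))
  rcases g.dge f1.symm with dz | dz
  · exact lobe_K4e g ih (t := z) (a := a) (b := b) (r := c) (by simp; grind) (g.d22 f1.symm f2.symm (by grind) dz) h1.r312 h2.r312
  by_cases hA : G.Adj z c1
  · exact lobe_D5 g ih (a := a) (b := b) (c := c) (z := z) (r := c1) (by simp; grind) h1 h2 h3
      (g.d33 f1.symm f2.symm hA (by grind) (by grind) (by grind))
  · refine TRL g ih m h1 h2 h3.r213 (by simp) (by simp) ia ib ic z c1 (by simp [hA]) (by simp [hz]) ?_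
    simp [cnt, nw, hz, Ne.symm hz, dz]; omega

theorem T3x {U L : Finset V} {G : SimpleGraph V} (hC : Cx U L G) {a b c a1 b1 c1 : V}
    (ia : In G L a) (ib : In G L b) (hc : c ∈ L) (hc1 : c1 ∉ L)
    (h1 : NL G a [b, c, a1]) (h2 : NL G b [a, c, b1]) (h3 : NL G c [a, b, c1]) (hd : dg G a1 = 3) : False := by
  have ⟨g, ih, m, nb, n5⟩ := hC
  apply nb
  obtain ⟨n1, d1, -, -, f1, e1⟩ := h1.f3
  obtain ⟨n2, d2, -, -, f2, e2⟩ := h2.f3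
  obtain ⟨n3, d3, -, -, f3, e3⟩ := h3.f3
  have := g.dge f2.symm
  have := g.dge f3.symm
  have ha1 := ia.2 _ f1
  have hb1 := ib.2 _ f2
  have hA : ¬ G.Adj b1 c1 := by
    intro h
    have := m.cut b1 c1 c c1 hb1 hc1 h hc hc1 f3
    grind
  have hne : b1 ≠ c1 := by grind
  have hne' : a1 ≠ c1 := by grind
  refine stepN g ih m (patch_DT h2 h1 h3) b1 c1 1 hne (by simp [hf_DT]) (by simp [hf_DT]) hA ?_ ?_ ?_
    (ext_DT (A := [b1]) (B := [c1]) h2 h1 h3 (by simp) (by simp) (by simp)) ?_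
  · rw [hf_DT]
    by_cases h : a1 = b1
    · subst h
      simp [cnt, nw, hd, hne, hne.symm]; omega
    · simp [cnt, nw, hd, hne, hne.symm, h, Ne.symm h, hne', hne'.symm]; omega
  · simp [DT]; grind [In]
  · rw [hf_DT]
    intro W p1 p2 p3
    simp [cnt, p1, p2] at p3
    split_ifs at p3 <;> omega
  · simp [DT, drop]

/-- Triangles of cubic vertices: interior vertices have outer neighbours of degree two. -/
theorem T3 {U L : Finset V} {G : SimpleGraph V} (hC : Cx U L G) {a b c a1 b1 c1 : V}
    (ia : In G L a)
    (h1 : NL G a [b, c, a1]) (h2 : NL G b [a, c, b1]) (h3 : NL G c [a, b, c1]) : dg G a1 = 2 := by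
  have ⟨g, ih, m, nb, n5⟩ := hC
  obtain ⟨n1, d1, f1, f1', g1, e1⟩ := h1.f3
  obtain ⟨n2, d2, f2, f2', g2, e2⟩ := h2.f3
  obtain ⟨n3, d3, f3, f3', g3, e3⟩ := h3.f3
  have hb := ia.2 b f1
  have hc := ia.2 c f1'
  by_contra hd
  have hd : dg G a1 = 3 := by have := g.dge g1.symm; omega
  by_cases ib : In G L b
  swap
  · obtain ⟨z, z1, z2⟩ := nIn hb ib
    have hz : z = b1 := by grind [In]
    subst hz
    have ic := (In_or m hb hc n1.2.2.2.1).resolve_left ib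
    exact T3x hC ia ic hb z2 h1.r213 h3 h2 hd
  by_cases ic : In G L c
  swap
  · obtain ⟨z, z1, z2⟩ := nIn hc ic
    have hz : z = c1 := by grind [In]
    subst hz
    exact T3x hC ia ib hc z2 h1 h2 h3 hd
  by_cases hab : a1 = b1
  · subst hab; exact T3q hC ia ib ic h1 h2 h3
  by_cases hac : a1 = c1
  · subst hac; exact T3q hC ia ic ib h1.r213 h3 h2
  by_cases hbc : b1 = c1
  · subst hbc; exact T3q hC ib ic ia h2.r213 h3.r213 h1
  have hba := Ne.symm hab
  have hca := Ne.symm hac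
  have hcb := Ne.symm hbc
  have kab := T3e hC ia ib ic h1 h2 h3 hab hac hbc
  have kac := T3e hC ia ic ib h1.r213 h3 h2 hac hab hcb
  have kbc := T3e hC ib ic ia h2.r213 h3.r213 h1 hbc hba hca
  have kA : G.Adj b1 c1 := by by_contra h; exact kbc h hd
  rcases g.dge g2.symm with db | db
  · rcases g.dge g3.symm with dc | dc
    · exact nb (lobe_H2 g ih (a := b) (b := c) (c := b1) (d := c1) (r := a) (by simp; grind) h2 h3
        (g.d22 g2.symm kA (by grind) db) (g.d22 g3.symm kA.symm (by grind) dc))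
    · have kB : G.Adj a1 b1 := by by_contra h; exact kab h dc
      have := (g.d22 g2.symm kA (by grind) db).f2
      have := kB.symm
      grind
  · have kB : G.Adj a1 c1 := by by_contra h; exact kac h db
    rcases g.dge g3.symm with dc | dc
    · have := (g.d22 g3.symm kA.symm (by grind) dc).f2
      have := kB.symm
      grind
    · have kD : G.Adj a1 b1 := by by_contra h; exact kab h dc
      exact nb (base_prism g ih (a := a) (b := b) (c := c) (d := a1) (e := b1) (f := c1) (by simp; grind) h1 h2 h3
        (g.d33 g1.symm kD kB (by grind) (by grind) (by grind))
        (g.d33 g2.symm kD.symm kA (by grind) (by grind) (by grind))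
        (g.d33 g3.symm kB.symm kA.symm (by grind) (by grind) (by grind)))

theorem ext_C4 {G : SimpleGraph V} {X : Finset V} {u w s t u1 w1 f p q : V}
    (hX : ∀ z, z ∈ X ↔ z = u ∨ z = w ∨ z = s ∨ z = t ∨ z = u1) (nd : [u, w, s, t, u1].Nodup)
    (a1 : G.Adj u s) (a2 : G.Adj u t) (a3 : G.Adj w s) (a4 : G.Adj w t) (a5 : G.Adj u u1) (a6 : G.Adj w w1)
    (a7 : G.Adj u1 f) (hw : w1 ∉ X) (hf : f ∉ X) (hpq : p = q ∨ p = w1 ∧ q = f) : Ext G X p q 2 := by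
  intro S hS
  have b1 := a1.symm; have b2 := a2.symm; have b3 := a3.symm; have b4 := a4.symm; have b5 := a5.symm
  have b6 := a6.symm; have b7 := a7.symm
  have c1 := hS u; have c2 := hS w; have c3 := hS s; have c4 := hS t; have c5 := hS u1
  clear hS
  simp only [hX] at hw hf c1 c2 c3 c4 c5 ⊢
  simp at nd
  by_cases h1 : w1 ∈ S
  · refine ⟨{u, u1}, by simp [Finset.insert_subset_iff, hX], Finset.card_le_two, ?_, ?_, ?_⟩
    all_goals grind
  · by_cases h2 : f ∈ S
    · refine ⟨{w, s}, by simp [Finset.insert_subset_iff, hX], Finset.card_le_two, ?_, ?_, ?_⟩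
      all_goals grind
    · refine ⟨{u, s}, by simp [Finset.insert_subset_iff, hX], Finset.card_le_two, ?_, ?_, ?_⟩
      all_goals grind

theorem ext_C4' {G : SimpleGraph V} {X : Finset V} {u w s t u1 w1 f g : V}
    (hX : ∀ z, z ∈ X ↔ z = u ∨ z = w ∨ z = s ∨ z = t ∨ z = u1) (nd : [u, w, s, t, u1].Nodup)
    (a1 : G.Adj u s) (a2 : G.Adj u t) (a3 : G.Adj w s) (a4 : G.Adj w t) (a5 : G.Adj u u1) (a6 : G.Adj w w1)
    (a7 : G.Adj u1 f) (a8 : G.Adj u1 g) (hw : w1 ∉ X) (hf : f ∉ X) (hg : g ∉ X) : Ext G X f g 2 := by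
  intro S hS
  have b1 := a1.symm; have b2 := a2.symm; have b3 := a3.symm; have b4 := a4.symm; have b5 := a5.symm
  have b6 := a6.symm; have b7 := a7.symm; have b8 := a8.symm
  have c1 := hS u; have c2 := hS w; have c3 := hS s; have c4 := hS t; have c5 := hS u1
  clear hS
  simp only [hX] at hw hf hg c1 c2 c3 c4 c5 ⊢
  simp at nd
  by_cases h1 : f ∈ S ∨ g ∈ S
  · refine ⟨{w, u1}, by simp [Finset.insert_subset_iff, hX], Finset.card_le_two, ?_, ?_, ?_⟩
    all_goals grind
  · refine ⟨{u, s}, by simp [Finset.insert_subset_iff, hX], Finset.card_le_two, ?_, ?_, ?_⟩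
    all_goals grind

theorem ext_C5 {G : SimpleGraph V} {X : Finset V} {p t1 t2 q s p1 q1 p' q' : V}
    (hX : ∀ z, z ∈ X ↔ z = p ∨ z = t1 ∨ z = t2 ∨ z = q ∨ z = s) (nd : [p, t1, t2, q, s].Nodup)
    (a1 : G.Adj p t1) (a2 : G.Adj t1 t2) (a3 : G.Adj t2 q) (a4 : G.Adj q s) (a5 : G.Adj s p) (a6 : G.Adj p p1)
    (a7 : G.Adj q q1) (hw : p1 ∉ X) (hf : q1 ∉ X) (hpq : p' = q' ∨ p' = p1 ∧ q' = q1) : Ext G X p' q' 2 := by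
  intro S hS
  have b1 := a1.symm; have b2 := a2.symm; have b3 := a3.symm; have b4 := a4.symm; have b5 := a5.symm
  have b6 := a6.symm; have b7 := a7.symm
  have c1 := hS p; have c2 := hS t1; have c3 := hS t2; have c4 := hS q; have c5 := hS s
  clear hS
  simp only [hX] at hw hf c1 c2 c3 c4 c5 ⊢
  simp at nd
  by_cases h1 : p1 ∈ S
  · refine ⟨{t2, q}, by simp [Finset.insert_subset_iff, hX], Finset.card_le_two, ?_, ?_, ?_⟩
    all_goals grind
  · by_cases h2 : q1 ∈ S
    · refine ⟨{p, t1}, by simp [Finset.insert_subset_iff, hX], Finset.card_le_two, ?_, ?_, ?_⟩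
      all_goals grind
    · refine ⟨{t1, s}, by simp [Finset.insert_subset_iff, hX], Finset.card_le_two, ?_, ?_, ?_⟩
      all_goals grind

theorem ext_claw5 {G : SimpleGraph V} {X : Finset V} {a v u s s' v' u' f p q : V}
    (hX : ∀ z, z ∈ X ↔ z = a ∨ z = v ∨ z = u ∨ z = s ∨ z = s') (nd : [a, v, u, s, s'].Nodup)
    (a1 : G.Adj a v) (a2 : G.Adj a u) (a3 : G.Adj a s) (a4 : G.Adj s s') (a5 : G.Adj v v') (a6 : G.Adj u u')
    (a7 : G.Adj s' f) (hv : v' ∉ X) (hu : u' ∉ X) (hf : f ∉ X) (hpq : p = q ∨ p = v' ∧ q = u') : Ext G X p q 2 := by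
  intro S hS
  have b1 := a1.symm; have b2 := a2.symm; have b3 := a3.symm; have b4 := a4.symm; have b5 := a5.symm
  have b6 := a6.symm; have b7 := a7.symm
  have c1 := hS a; have c2 := hS v; have c3 := hS u; have c4 := hS s; have c5 := hS s'
  clear hS
  simp only [hX] at hv hu hf c1 c2 c3 c4 c5 ⊢
  simp at nd
  by_cases h1 : v' ∈ S
  · refine ⟨{u, s'}, by simp [Finset.insert_subset_iff, hX], Finset.card_le_two, ?_, ?_, ?_⟩
    all_goals grind
  · by_cases h2 : u' ∈ S
    · refine ⟨{v, s'}, by simp [Finset.insert_subset_iff, hX], Finset.card_le_two, ?_, ?_, ?_⟩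
      all_goals grind
    · by_cases h3 : f ∈ S
      · refine ⟨{a}, by simp [Finset.insert_subset_iff, hX], by simp, ?_, ?_, ?_⟩
        all_goals grind
      · refine ⟨{a, s}, by simp [Finset.insert_subset_iff, hX], Finset.card_le_two, ?_, ?_, ?_⟩
        all_goals grind

theorem ext_claw7 {G : SimpleGraph V} {X : Finset V} {a v u s s' f g v' u' f' g' : V}
    (hX : ∀ z, z ∈ X ↔ z = a ∨ z = v ∨ z = u ∨ z = s ∨ z = s' ∨ z = f ∨ z = g) (nd : [a, v, u, s, s', f, g].Nodup)
    (a1 : G.Adj a v) (a2 : G.Adj a u) (a3 : G.Adj a s) (a4 : G.Adj s s') (a5 : G.Adj v v') (a6 : G.Adj u u')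
    (a7 : G.Adj s' f) (a8 : G.Adj s' g) (a9 : G.Adj f f') (a10 : G.Adj g g')
    (hv : v' ∉ X) (hu : u' ∉ X) (hf : f' ∉ X) (hg : g' ∉ X) : Ext G X v' u' 3 := by
  intro S hS
  have b1 := a1.symm; have b2 := a2.symm; have b3 := a3.symm; have b4 := a4.symm; have b5 := a5.symm
  have b6 := a6.symm; have b7 := a7.symm; have b8 := a8.symm; have b9 := a9.symm; have b10 := a10.symm
  have c1 := hS a; have c2 := hS v; have c3 := hS u; have c4 := hS s; have c5 := hS s'; have c6 := hS f; have c7 := hS g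
  clear hS
  simp only [hX] at hv hu hf hg c1 c2 c3 c4 c5 c6 c7 ⊢
  simp at nd
  by_cases h1 : v' ∈ S
  · by_cases h3 : f' ∈ S
    · refine ⟨{u, s, g}, by simp [Finset.insert_subset_iff, hX], Finset.card_le_three, ?_, ?_, ?_⟩
      all_goals grind
    · refine ⟨{u, s', g}, by simp [Finset.insert_subset_iff, hX], Finset.card_le_three, ?_, ?_, ?_⟩
      all_goals grind
  · by_cases h2 : u' ∈ S
    · by_cases h3 : f' ∈ S
      · refine ⟨{v, s, g}, by simp [Finset.insert_subset_iff, hX], Finset.card_le_three, ?_, ?_, ?_⟩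
        all_goals grind
      · refine ⟨{v, s', g}, by simp [Finset.insert_subset_iff, hX], Finset.card_le_three, ?_, ?_, ?_⟩
        all_goals grind
    · refine ⟨{a, f, g}, by simp [Finset.insert_subset_iff, hX], Finset.card_le_three, ?_, ?_, ?_⟩
      all_goals grind

/-- Four-cycle patch. -/
def DC4 (u w s t u1 w1 : V) (F : List V) : Pt V :=
  [(u, [s, t, u1], []), (w, [s, t], [w1]), (s, [u, w], []), (t, [u, w], []), (u1, [u], F)]

theorem C4L {U L : Finset V} {G : SimpleGraph V} (g : Good U G) (ih : IH U) (m : MinL U G L)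
    {u w s t u1 w1 : V} {F : List V} (hu : NL G u [s, t, u1]) (hw : NL G w [s, t, w1]) (hs : NL G s [u, w]) (ht : NL G t [u, w])
    (hu1 : NL G u1 (u :: F)) (n1 : u1 ≠ w) (n2 : u1 ≠ w1) (hF : F ≠ [])
    (iu : In G L u) (iw : In G L w) (iu1 : In G L u1) (p q : V)
    (hpq : p = q ∨ p = w1 ∧ q ∈ F ∨ F = [p, q]) (hA : p ≠ q → ¬ G.Adj p q)
    (hlen : F.length ≤ if p = q then 1 else 2)
    (hdeg : ∀ z ∈ w1 :: F, 2 + cnt (· = z) (w1 :: F) ≤ dg G z + nw p q z) : Bd U G 4 := by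
  obtain ⟨m1, -, a1, a2, a5, e1⟩ := hu.f3
  obtain ⟨m2, -, a3, a4, a6, e2⟩ := hw.f3
  obtain ⟨m3, -, -, -, e3⟩ := hs.f2
  obtain ⟨m4, -, -, -, e4⟩ := ht.f2
  have nd : [u, w, s, t, u1].Nodup := by simp; grind
  have hFa : ∀ z ∈ F, G.Adj u1 z ∧ z ≠ u ∧ z ≠ w ∧ z ≠ s ∧ z ≠ t ∧ z ≠ u1 := by
    intro z hz
    have h1 := hu1.adj (z := z) (by simp [hz])
    have h2 := hu1.1
    simp only [List.nodup_cons] at h2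
    have h3 := h1.symm
    have h4 := h1.ne
    refine ⟨h1, ?_, ?_, ?_, ?_, h4.symm⟩
    · rintro rfl; exact h2.1 hz
    · rintro rfl; rw [e2] at h3; grind
    · rintro rfl; rw [e3] at h3; grind
    · rintro rfl; rw [e4] at h3; grind
  have hw1 : w1 ≠ u ∧ w1 ≠ w ∧ w1 ≠ s ∧ w1 ≠ t ∧ w1 ≠ u1 := by
    have := a6.symm
    refine ⟨?_, ?_, ?_, ?_, ?_⟩ <;> grind
  have hvs : vs (DC4 u w s t u1 w1 F) = [u, w, s, t, u1] := by simp [vs, DC4]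
  have hhf : hf (DC4 u w s t u1 w1 F) = w1 :: F := by simp [hf, DC4]
  have hD : Patch G (DC4 u w s t u1 w1 F) := by
    refine ⟨by rw [hvs]; exact nd, ?_⟩
    rw [hvs]
    simp only [DC4, List.mem_cons, List.not_mem_nil, or_false]
    rintro d (rfl | rfl | rfl | rfl | rfl)
    · exact ⟨hu, by simp, by simp, by simp⟩
    · exact ⟨hw, by simp, by simp, by simpa using hw1⟩
    · exact ⟨hs, by simp, by simp, by simp⟩
    · exact ⟨ht, by simp, by simp, by simp⟩
    · exact ⟨hu1, by simp, by simp, fun z hz => by have := hFa z hz; simp [this]⟩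
  have hX : ∀ z, z ∈ VS (DC4 u w s t u1 w1 F) ↔ z = u ∨ z = w ∨ z = s ∨ z = t ∨ z = u1 := by
    intro z; rw [mem_VS, hvs]; simp
  have is : In G L s := In_two g m (iu.2 s a1) hs
  have it : In G L t := In_two g m (iu.2 t a2) ht
  have hw1X : w1 ∉ VS (DC4 u w s t u1 w1 F) := by rw [hX]; grind
  have hFX : ∀ z ∈ F, z ∉ VS (DC4 u w s t u1 w1 F) := by intro z hz; rw [hX]; have := hFa z hz; grind
  refine stepL g ih m hD (int_of_In hD (by rw [hvs]; simp [iu, iw, iu1, is, it])) (by rw [hhf]; simp) p q 2 ?_ (by rw [hhf]; exact hdeg) ?_ ?_ ?_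
  · intro h
    rw [hhf]
    refine ⟨?_, ?_, hA h⟩ <;> rcases hpq with rfl | ⟨rfl, h1⟩ | rfl <;> simp_all
  · intro W h1 h2 _ _
    rw [hhf] at h1 h2
    refine small_conn ?_ W h1 h2
    simp only [List.length_cons]
    split_ifs at hlen <;> omega
  · rcases hpq with h | ⟨h, h1⟩ | rfl
    · obtain ⟨f, hf⟩ := List.exists_mem_of_ne_nil _ hF
      exact ext_C4 hX nd a1 a2 a3 a4 a5 a6 (hFa f hf).1 hw1X (hFX f hf) (Or.inl h)
    · exact ext_C4 hX nd a1 a2 a3 a4 a5 a6 (hFa q h1).1 hw1X (hFX q h1) (Or.inr ⟨h, rfl⟩)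
    · exact ext_C4' hX nd a1 a2 a3 a4 a5 a6 (hFa p (by simp)).1 (hFa q (by simp)).1 hw1X (hFX p (by simp)) (hFX q (by simp))
  · simp only [DC4, drop, List.length_cons, List.length_nil]
    split_ifs at hlen ⊢ <;> push_cast <;> omega

/-- Five-cycle patch. -/
def DC5 (p t1 t2 q s p1 q1 : V) : Pt V :=
  [(p, [t1, s], [p1]), (t1, [p, t2], []), (t2, [t1, q], []), (q, [t2, s], [q1]), (s, [p, q], [])]

theorem C5L {U L : Finset V} {G : SimpleGraph V} (g : Good U G) (ih : IH U) (m : MinL U G L)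
    {p t1 t2 q s p1 q1 : V} (hp : NL G p [t1, s, p1]) (h1 : NL G t1 [p, t2]) (h2 : NL G t2 [t1, q]) (hq : NL G q [t2, s, q1])
    (hs : NL G s [p, q]) (n1 : p1 ≠ q)
    (ip : In G L p) (iq : In G L q) (p' q' : V)
    (hpq : p' = q' ∨ p' = p1 ∧ q' = q1) (hA : p' ≠ q' → ¬ G.Adj p' q')
    (hdeg : ∀ z ∈ [p1, q1], 2 + cnt (· = z) [p1, q1] ≤ dg G z + nw p' q' z) : Bd U G 4 := by
  obtain ⟨m1, -, a1, a5, a6, e1⟩ := hp.f3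
  obtain ⟨m2, -, a3, a4, a7, e2⟩ := hq.f3
  obtain ⟨m3, -, -, b1, e3⟩ := h1.f2
  obtain ⟨m4, -, -, b2, e4⟩ := h2.f2
  obtain ⟨m5, -, -, -, e5⟩ := hs.f2
  have hpt : p ≠ t2 := by grind
  have hst1 : s ≠ t1 := by grind
  have hst2 : s ≠ t2 := by grind
  have hqt : q ≠ t1 := by grind
  have nd : [p, t1, t2, q, s].Nodup := by simp; grind
  have hp1 : p1 ≠ p ∧ p1 ≠ t1 ∧ p1 ≠ t2 ∧ p1 ≠ q ∧ p1 ≠ s := by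
    have := a6.symm
    refine ⟨?_, ?_, ?_, ?_, ?_⟩ <;> grind
  have hq1 : q1 ≠ p ∧ q1 ≠ t1 ∧ q1 ≠ t2 ∧ q1 ≠ q ∧ q1 ≠ s := by
    have := a7.symm
    refine ⟨?_, ?_, ?_, ?_, ?_⟩ <;> grind
  have hvs : vs (DC5 p t1 t2 q s p1 q1) = [p, t1, t2, q, s] := by simp [vs, DC5]
  have hhf : hf (DC5 p t1 t2 q s p1 q1) = [p1, q1] := by simp [hf, DC5]
  have hD : Patch G (DC5 p t1 t2 q s p1 q1) := by
    refine ⟨by rw [hvs]; exact nd, ?_⟩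
    rw [hvs]
    simp only [DC5, List.mem_cons, List.not_mem_nil, or_false]
    rintro d (rfl | rfl | rfl | rfl | rfl)
    · exact ⟨hp, by simp, by simp, by simpa using hp1⟩
    · exact ⟨h1, by simp, by simp, by simp⟩
    · exact ⟨h2, by simp, by simp, by simp⟩
    · exact ⟨hq, by simp, by simp, by simpa using hq1⟩
    · exact ⟨hs, by simp, by simp, by simp⟩
  have hX : ∀ z, z ∈ VS (DC5 p t1 t2 q s p1 q1) ↔ z = p ∨ z = t1 ∨ z = t2 ∨ z = q ∨ z = s := by
    intro z; rw [mem_VS, hvs]; simp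
  have is : In G L s := In_two g m (ip.2 s a5) hs
  have i1 : In G L t1 := In_two g m (ip.2 t1 a1) h1
  have i2 : In G L t2 := In_two g m (iq.2 t2 a3) h2
  refine stepL g ih m hD (int_of_In hD (by rw [hvs]; simp [ip, i1, i2, is, iq])) (by rw [hhf]; simp) p' q' 2 ?_ (by rw [hhf]; exact hdeg) ?_ ?_ ?_
  · intro h
    rw [hhf]
    refine ⟨?_, ?_, hA h⟩ <;> rcases hpq with rfl | ⟨rfl, rfl⟩ <;> simp_all
  · intro W h1 h2 _ _
    rw [hhf] at h1 h2
    exact small_conn (by simp) W h1 h2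
  · exact ext_C5 hX nd a1 b1 b2 a4 a5.symm a6 a7 (by rw [hX]; grind) (by rw [hX]; grind) hpq
  · simp only [DC5, drop, List.length_cons, List.length_nil]
    split_ifs <;> push_cast <;> omega

/-- Claw patch. -/
def DK5 (a v u s s' v' u' : V) (F : List V) : Pt V :=
  [(a, [v, u, s], []), (v, [a], [v']), (u, [a], [u']), (s, [a, s'], []), (s', [s], F)]

theorem patch_K5 {G : SimpleGraph V} {a v u s s' v' u' : V} {F : List V} (ha : NL G a [v, u, s]) (hv : NL G v [a, v'])
    (hu : NL G u [a, u']) (hs : NL G s [a, s']) (hs' : NL G s' (s :: F))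
    (nv : v' ≠ u) (nv' : v' ≠ s') (nu : u' ≠ v) (nu' : u' ≠ s') (ns : s' ≠ v) (ns' : s' ≠ u) :
    Patch G (DK5 a v u s s' v' u' F) ∧ [a, v, u, s, s'].Nodup ∧
      (∀ z, z ∈ VS (DK5 a v u s s' v' u' F) ↔ z = a ∨ z = v ∨ z = u ∨ z = s ∨ z = s') ∧
      v' ∉ VS (DK5 a v u s s' v' u' F) ∧ u' ∉ VS (DK5 a v u s s' v' u' F) ∧ (∀ z ∈ F, z ∉ VS (DK5 a v u s s' v' u' F)) := by
  obtain ⟨m1, -, a1, a2, a3, e1⟩ := ha.f3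
  obtain ⟨m2, -, -, a4, e2⟩ := hv.f2
  obtain ⟨m3, -, -, a5, e3⟩ := hu.f2
  obtain ⟨m4, -, -, a6, e4⟩ := hs.f2
  have b4 := a4.symm
  have b5 := a5.symm
  have nd : [a, v, u, s, s'].Nodup := by simp; grind
  have hFa : ∀ z ∈ F, G.Adj s' z ∧ z ≠ a ∧ z ≠ v ∧ z ≠ u ∧ z ≠ s ∧ z ≠ s' := by
    intro z hz
    have h1 := hs'.adj (z := z) (by simp [hz])
    have h2 := hs'.1
    simp only [List.nodup_cons] at h2
    have h3 := h1.symm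
    have h4 := h1.ne
    refine ⟨h1, ?_, ?_, ?_, ?_, h4.symm⟩
    · rintro rfl; rw [e1] at h3; grind
    · rintro rfl; rw [e2] at h3; grind
    · rintro rfl; rw [e3] at h3; grind
    · rintro rfl; exact h2.1 hz
  have hv1 : v' ≠ a ∧ v' ≠ v ∧ v' ≠ u ∧ v' ≠ s ∧ v' ≠ s' := by
    refine ⟨?_, ?_, ?_, ?_, ?_⟩ <;> grind
  have hu1 : u' ≠ a ∧ u' ≠ v ∧ u' ≠ u ∧ u' ≠ s ∧ u' ≠ s' := by
    refine ⟨?_, ?_, ?_, ?_, ?_⟩ <;> grind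
  have hvs : vs (DK5 a v u s s' v' u' F) = [a, v, u, s, s'] := by simp [vs, DK5]
  have hX : ∀ z, z ∈ VS (DK5 a v u s s' v' u' F) ↔ z = a ∨ z = v ∨ z = u ∨ z = s ∨ z = s' := by
    intro z; rw [mem_VS, hvs]; simp
  refine ⟨⟨by rw [hvs]; exact nd, ?_⟩, nd, hX, by rw [hX]; grind, by rw [hX]; grind, fun z hz => by rw [hX]; have := hFa z hz; grind⟩
  rw [hvs]
  simp only [DK5, List.mem_cons, List.not_mem_nil, or_false]
  rintro d (rfl | rfl | rfl | rfl | rfl)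
  · exact ⟨ha, by simp, by simp, by simp⟩
  · exact ⟨hv, by simp, by simp, by simpa using hv1⟩
  · exact ⟨hu, by simp, by simp, by simpa using hu1⟩
  · exact ⟨hs, by simp, by simp, by simp⟩
  · exact ⟨hs', by simp, by simp, fun z hz => by have := hFa z hz; simp [this]⟩

theorem hf_K5 (a v u s s' v' u' : V) (F : List V) : hf (DK5 a v u s s' v' u' F) = v' :: u' :: F := by simp [hf, DK5]
theorem vs_K5 (a v u s s' v' u' : V) (F : List V) : vs (DK5 a v u s s' v' u' F) = [a, v, u, s, s'] := by simp [vs, DK5]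

/-- A set inside `L` with two outgoing edges has them inside `L`. -/
theorem twocut {U L : Finset V} {G : SimpleGraph V} (g : Good U G) (m : MinL U G L) {X : Finset V} (hX : X ⊆ L)
    {u w u1 w1 : V} (hu : u ∈ X) (hw : w ∈ X) (huw : u ≠ w) (a1 : G.Adj u u1) (a2 : G.Adj w w1) (hw1 : w1 ∉ X)
    (h : ∀ z ∈ X, ∀ v, v ∉ X → G.Adj z v → (z = u ∧ v = u1) ∨ (z = w ∧ v = w1)) : u1 ∈ L := by
  by_contra hn
  have hb1 : w1 ∈ L := by
    by_contra hn'
    exact huw (m.cut u u1 w w1 (hX hu) hn a1 (hX hw) hn' a2).1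
  refine nobridge g m (M := L \ X) (Finset.sdiff_subset.trans m.sub) (m := w1) (m' := w) (by simp [hb1, hw1]) (by simp [hw]) hb1 (hX hw) a2.symm ?_
  have key : ∀ z v, z ∈ L \ X → v ∉ L \ X → G.Adj z v → z = w1 ∧ v = w := by
    intro z v h4 h5 h6
    simp only [Finset.mem_sdiff, not_and, not_not] at h4 h5
    by_cases hv : v ∈ L
    · rcases h v (h5 hv) z h4.2 h6.symm with ⟨-, h7⟩ | ⟨h7, h8⟩
      · exact absurd h4.1 (h7 ▸ hn)
      · exact ⟨h8, h7⟩
    · have := (m.cut u u1 z v (hX hu) hn a1 h4.1 hv h6).1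
      exact absurd hu (this ▸ h4.2)
  intro z v z' v' h4 h5 h6 h7 h8 h9
  have h1 := key z v h4 h5 h6
  have h2 := key z' v' h7 h8 h9
  exact ⟨h1.1.trans h2.1.symm, h1.2.trans h2.2.symm⟩

/-- In a triangle of `L`, an interior vertex has degree three and its outer neighbour has degree two. -/
theorem tri {U L : Finset V} {G : SimpleGraph V} (hC : Cx U L G) {a b c d : V} (ia : In G L a) (h : NL G a [d, b, c]) (hbc : G.Adj b c) :
    dg G d = 2 := by
  have ⟨g, ih, m, nb, n5⟩ := hC
  obtain ⟨n1, d1, f1, f2, f3, e1⟩ := h.f3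
  rcases g.dge hbc with db | db
  · exact (T1 hC (ia.2 b f2) (g.d22 f2.symm hbc (by grind) db) f3).elim
  rcases g.dge hbc.symm with dc | dc
  · exact (T1 hC (ia.2 c f3) (g.d22 f3.symm hbc.symm (by grind) dc) f2).elim
  obtain ⟨b1, hb⟩ := g.d32 f2.symm hbc (by grind) db
  obtain ⟨c1, hc⟩ := g.d32 f3.symm hbc.symm (by grind) dc
  exact T3 hC ia h.r231 hb hc

theorem twin1 {U L : Finset V} {G : SimpleGraph V} (hC : Cx U L G) {s t u w u1 w1 : V}
    (hs : NL G s [u, w]) (ht : NL G t [u, w]) (hu : NL G u [s, t, u1]) (hw : NL G w [s, t, w1])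
    (iu : In G L u) (iw : In G L w) (h1 : u1 ≠ w1) (h2 : u1 ≠ w) (hd : dg G u1 = 2) : False := by
  have ⟨g, ih, m, nb, n5⟩ := hC
  apply nb
  obtain ⟨n1, d1, -, c1, e1⟩ := hs.f2
  obtain ⟨n2, d2, -, c2, e2⟩ := ht.f2
  obtain ⟨n3, d3, -, -, c3, e3⟩ := hu.f3
  obtain ⟨n4, d4, -, -, c4, e4⟩ := hw.f3
  obtain ⟨f, hf⟩ := g.d2 c3.symm hd
  have iu1 := In_two g m (iu.2 _ c3) hf
  obtain ⟨n5, d5, -, c5, e5⟩ := hf.f2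
  have c5' := c5.symm
  have nf : f ≠ w ∧ f ≠ s ∧ f ≠ t := by grind
  have hwu : w1 ≠ u := by have := c4.symm; grind
  by_cases hfw : f = w1
  · subst hfw
    exact lobe_A6 g ih (s := s) (t := t) (u := u) (w := w) (c := u1) (r := f) (by simp; grind) hs ht hu hw hf
  have df := g.dge c5'
  have dw := g.dge c4.symm
  by_cases hA : G.Adj w1 f
  · rcases df with df | df
    · exact lobe_A7 g ih (s := s) (t := t) (u := u) (w := w) (c := u1) (f := f) (r := w1) (by simp; grind) hs ht hu hw hf
        (g.d22 c5' hA.symm h1 df)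
    rcases dw with dw | dw
    · exact lobe_A7b g ih (s := s) (t := t) (u := u) (w := w) (c := u1) (d := w1) (r := f) (by simp; grind) hs ht hu hw hf
        (g.d22 c4.symm hA nf.1.symm dw)
    exact C4L g ih m hu hw hs ht hf h2 h1 (by simp) iu iw iu1 f f (by simp) (by simp) (by simp)
      (by simp [cnt, nw, df, dw, hfw, Ne.symm hfw])
  · refine C4L g ih m hu hw hs ht hf h2 h1 (by simp) iu iw iu1 w1 f (by simp) (by simp [hA]) (by simp [Ne.symm hfw]) ?_
    simp [cnt, nw, hfw, Ne.symm hfw]; omega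

theorem twin2 {U L : Finset V} {G : SimpleGraph V} (hC : Cx U L G) {s t u w u1 w1 : V}
    (hs : NL G s [u, w]) (ht : NL G t [u, w]) (hu : NL G u [s, t, u1]) (hw : NL G w [s, t, w1])
    (iu : In G L u) (iw : In G L w) (iu1 : In G L u1) (h1 : u1 ≠ w1) (h2 : u1 ≠ w) (hd : dg G u1 = 3) (hd' : dg G w1 = 3) : False := by
  have ⟨g, ih, m, nb, n5⟩ := hC
  apply nb
  obtain ⟨n3, d3, -, -, c3, e3⟩ := hu.f3
  obtain ⟨f, k, hf⟩ := g.d3 c3.symm hd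
  obtain ⟨n5, d5, -, c5, c6, e5⟩ := hf.f3
  have hA : ¬ G.Adj f k := fun h => by have := tri hC iu1 hf h; omega
  have df := g.dge c5.symm
  have dk := g.dge c6.symm
  refine C4L g ih m hu hw hs ht hf h2 h1 (by simp) iu iw iu1 f k (by simp) (by simp [hA]) (by simp [n5]) ?_
  by_cases k1 : w1 = f
  · subst k1
    simp [cnt, nw, n5, n5.2.2.2.2.2.symm]; omega
  by_cases k2 : w1 = k
  · subst k2
    simp [cnt, nw, n5, n5.2.2.2.2.2.symm]; omega
  · simp [cnt, nw, n5, n5.2.2.2.2.2.symm, k1, k2, Ne.symm k1, Ne.symm k2]; omega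

/-- No twins of degree two. -/
theorem twins {U L : Finset V} {G : SimpleGraph V} (hC : Cx U L G) {s t u w : V} (hsL : s ∈ L) (htL : t ∈ L) (hst : s ≠ t)
    (hs : NL G s [u, w]) (ht : NL G t [u, w]) : False := by
  have ⟨g, ih, m, nb, n5⟩ := hC
  have is := In_two g m hsL hs
  obtain ⟨n1, d1, b1, c1, e1⟩ := hs.f2
  obtain ⟨n2, d2, b2, c2, e2⟩ := ht.f2
  have uL := is.2 u b1
  have wL := is.2 w c1
  rcases g.dge b1.symm with du | du
  · exact nb (lobe_C4 g ih (t := s) (u := u) (w := t) (r := w) (by simp; grind) hs.r21 (g.d22 b1.symm b2.symm hst du) ht)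
  rcases g.dge c1.symm with dw | dw
  · exact nb (lobe_C4 g ih (t := s) (u := w) (w := t) (r := u) (by simp; grind) hs (g.d22 c1.symm c2.symm hst dw) ht.r21)
  obtain ⟨u1, hu⟩ := g.d32 b1.symm b2.symm hst du
  obtain ⟨w1, hw⟩ := g.d32 c1.symm c2.symm hst dw
  have nuw : ¬ G.Adj u w := fun h => T1 hC hsL hs h
  obtain ⟨n3, d3, -, -, c3, e3⟩ := hu.f3
  obtain ⟨n4, d4, -, -, c4, e4⟩ := hw.f3
  have h2 : u1 ≠ w := by grind
  have h3 : w1 ≠ u := by rintro rfl; exact nuw c4.symm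
  by_cases h1 : u1 = w1
  · subst h1
    exact nb (lobe_K23 g ih (s := s) (t := t) (u := u) (w := w) (r := u1) (by simp; grind) hs ht hu hw)
  have tc : ∀ u w u1 w1, u ∈ L → w ∈ L → NL G s [u, w] → NL G t [u, w] → NL G u [s, t, u1] → NL G w [s, t, w1] → w1 ≠ u → u ≠ w → u1 ∈ L := by
    clear * - g m hsL htL
    intro u w u1 w1 uL wL hs ht hu hw hn hn'
    have hs := hs.f2
    have ht := ht.f2
    have hu := hu.f3
    have hw := hw.f3
    refine twocut g m (X := {s, t, u, w}) (u := u) (w := w) (w1 := w1) ?_ (by simp) (by simp) hn' (by grind) (by grind) (by simp; grind) ?_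
    · simp [Finset.insert_subset_iff, *]
    · simp only [Finset.mem_insert, Finset.mem_singleton]; grind
  have iu : In G L u := ⟨uL, fun z hz => by
    have := tc u w u1 w1 uL wL hs ht hu hw h3 n1.2.2
    grind⟩
  have iw : In G L w := ⟨wL, fun z hz => by
    have := tc w u w1 u1 wL uL hs.r21 ht.r21 hw hu h2 n1.2.2.symm
    grind⟩
  rcases g.dge c3.symm with du1 | du1
  · exact twin1 hC hs ht hu hw iu iw h1 h2 du1
  rcases g.dge c4.symm with dw1 | dw1
  · exact twin1 hC hs.r21 ht.r21 hw hu iw iu (Ne.symm h1) h3 dw1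
  rcases In_or m (iu.2 _ c3) (iw.2 _ c4) h1 with i | i
  · exact twin2 hC hs ht hu hw iu iw i h1 h2 du1 dw1
  · exact twin2 hC hs.r21 ht.r21 hw hu iw iu i (Ne.symm h1) h3 dw1 du1

/-- No five-cycle made of a thread of length one and a thread of length two. -/
theorem C5conf {U L : Finset V} {G : SimpleGraph V} (hC : Cx U L G) {s t1 t2 p q : V} (hsL : s ∈ L) (htL : t1 ∈ L)
    (hs : NL G s [p, q]) (h1 : NL G t1 [p, t2]) (h2 : NL G t2 [t1, q]) : False := by
  have ⟨g, ih, m, nb, n5⟩ := hC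
  have is := In_two g m hsL hs
  have i1 := In_two g m htL h1
  obtain ⟨n1, d1, b1, c1, e1⟩ := hs.f2
  obtain ⟨n2, d2, b2, c2, e2⟩ := h1.f2
  obtain ⟨n3, d3, b3, c3, e3⟩ := h2.f2
  have t2L := i1.2 t2 c2
  have i2 := In_two g m t2L h2
  have uL := is.2 p b1
  have wL := is.2 q c1
  have hst1 : s ≠ t1 := by rintro rfl; have : t2 = q := by grind
                           exact n3.2.1 this
  have hst2 : s ≠ t2 := by rintro rfl; have : t1 = p := by grind
                           exact n2.1 this
  rcases g.dge b1.symm with dp | dp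
  · exact A0 hC htL h2 h1.r21 (g.d22 b2.symm b1.symm (by grind) dp)
  rcases g.dge c1.symm with dq | dq
  · exact A0 hC t2L h1.r21 h2 (g.d22 c3.symm c1.symm (by grind) dq)
  obtain ⟨p1, hp⟩ := g.d32 b2.symm b1.symm (by grind) dp
  obtain ⟨q1, hq⟩ := g.d32 c3.symm c1.symm (by grind) dq
  have npq : ¬ G.Adj p q := fun h => T1 hC hsL hs h
  obtain ⟨n4, d4, -, -, c4, e4⟩ := hp.f3
  obtain ⟨n5, d5, -, -, c5, e5⟩ := hq.f3
  have k1 : p1 ≠ q := by grind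
  have k2 : q1 ≠ p := by rintro rfl; exact npq c5.symm
  have k3 : p1 ≠ t2 := by have := c4.symm; grind
  have k4 : q1 ≠ t1 := by have := c5.symm; grind
  by_cases hE : p1 = q1
  · subst hE
    exact nb (lobe_S6 g ih (s := s) (t := t1) (u := t2) (p := p) (q := q) (r := p1) (by simp; grind) hs h1 h2 hp.r213 hq.r213)
  have tc : ∀ p q p1 q1 t1 t2, p ∈ L → q ∈ L → t1 ∈ L → t2 ∈ L → NL G s [p, q] → NL G t1 [p, t2] → NL G t2 [t1, q] → NL G p [t1, s, p1] →
      NL G q [t2, s, q1] → q1 ≠ t1 → q1 ≠ p → p1 ∈ L := by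
    clear * - g m hsL
    intro p q p1 q1 t1 t2 a1 a2 a3 a4 hs h1 h2 h3 h4 hn hn'
    have hs := hs.f2
    have h1 := h1.f2
    have h2 := h2.f2
    have h3 := h3.f3
    have h4 := h4.f3
    refine twocut g m (X := {s, t1, t2, p, q}) (u := p) (w := q) (w1 := q1) ?_ (by simp) (by simp) (by grind) (by grind) (by grind) (by simp; grind) ?_
    · simp [Finset.insert_subset_iff, *]
    · simp only [Finset.mem_insert, Finset.mem_singleton]; grind
  have ip : In G L p := ⟨uL, fun z hz => by
    have := tc p q p1 q1 t1 t2 uL wL htL t2L hs h1 h2 hp hq k4 k2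
    grind⟩
  have iq : In G L q := ⟨wL, fun z hz => by
    have := tc q p q1 p1 t2 t1 wL uL t2L htL hs.r21 h2.r21 h1.r21 hq hp k3 k1
    grind⟩
  apply nb
  have dp1 := g.dge c4.symm
  have dq1 := g.dge c5.symm
  by_cases hA : G.Adj p1 q1
  · rcases dp1 with dp1 | dp1
    · exact lobe_B7 g ih (s := s) (t := t1) (u := t2) (p := p) (q := q) (c := p1) (r := q1) (by simp; grind) hs h1 h2 hp.r213 hq.r213
        (g.d22 c4.symm hA k2.symm dp1)
    rcases dq1 with dq1 | dq1
    · exact lobe_B7 g ih (s := s) (t := t2) (u := t1) (p := q) (q := p) (c := q1) (r := p1) (by simp; grind) hs.r21 h2.r21 h1.r21 hq.r213 hp.r213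
        (g.d22 c5.symm hA.symm k1.symm dq1)
    exact C5L g ih m hp h1 h2 hq hs k1 ip iq p1 p1 (by simp) (by simp) (by simp [cnt, nw, dp1, dq1, hE, Ne.symm hE])
  · refine C5L g ih m hp h1 h2 hq hs k1 ip iq p1 q1 (by simp) (by simp [hA]) ?_
    simp [cnt, nw, hE, Ne.symm hE]; omega

theorem K5L {U L : Finset V} {G : SimpleGraph V} (g : Good U G) (ih : IH U) (m : MinL U G L) {a v u s s' v' u' f : V} (ha : NL G a [v, u, s]) (hv : NL G v [a, v'])
    (hu : NL G u [a, u']) (hs : NL G s [a, s']) (hs' : NL G s' [s, f])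
    (nv : v' ≠ u) (nv' : v' ≠ s') (nu : u' ≠ v) (nu' : u' ≠ s') (ns : s' ≠ v) (ns' : s' ≠ u)
    (ia : In G L a) (p q : V) (hpq : p = q ∨ p = v' ∧ q = u') (hA : p ≠ q → ¬ G.Adj p q)
    (hdeg : ∀ z ∈ [v', u', f], 2 + cnt (· = z) [v', u', f] ≤ dg G z + nw p q z) : Bd U G 4 := by
  obtain ⟨hD, nd, hX, x1, x2, x3⟩ := patch_K5 ha hv hu hs hs' nv nv' nu nu' ns ns'
  have iv := In_two g m (ia.2 v (ha.adj (by simp))) hv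
  have iu := In_two g m (ia.2 u (ha.adj (by simp))) hu
  have is := In_two g m (ia.2 s (ha.adj (by simp))) hs
  have is' := In_two g m (is.2 s' (hs.adj (by simp))) hs'
  refine stepL g ih m hD (int_of_In hD (by rw [vs_K5]; simp [*])) (by rw [hf_K5]; simp) p q 2 ?_ (by rw [hf_K5]; exact hdeg) ?_ ?_ ?_
  · intro h
    rw [hf_K5]
    refine ⟨?_, ?_, hA h⟩ <;> rcases hpq with rfl | ⟨rfl, rfl⟩ <;> simp_all
  · intro W h1 h2 _ _
    rw [hf_K5] at h1 h2
    exact small_conn (by simp) W h1 h2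
  · exact ext_claw5 hX nd (ha.adj (by simp)) (ha.adj (by simp)) (ha.adj (by simp)) (hs.adj (by simp)) (hv.adj (by simp)) (hu.adj (by simp)) (hs'.adj (z := f) (by simp)) x1 x2
      (x3 f (by simp)) hpq
  · simp only [DK5, drop, List.length_cons, List.length_nil]
    split_ifs <;> push_cast <;> omega

theorem thread1 {U L : Finset V} {G : SimpleGraph V} (hC : Cx U L G) {t1 t2 p q : V} (htL : t1 ∈ L) (ip : In G L p)
    (h1 : NL G t1 [p, t2]) (h2 : NL G t2 [t1, q]) : False := by
  have ⟨g, ih, m, nb, n5⟩ := hC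
  have i1 := In_two g m htL h1
  obtain ⟨n2, d2, b2, c2, e2⟩ := h1.f2
  obtain ⟨n3, d3, b3, c3, e3⟩ := h2.f2
  have t2L := i1.2 t2 c2
  have i2 := In_two g m t2L h2
  have dp : dg G p = 3 := by
    rcases g.dge b2.symm with dp | dp
    · obtain ⟨z, hz⟩ := g.d2 b2.symm dp
      exact (A0 hC htL h2 h1.r21 hz).elim
    · exact dp
  have dq : dg G q = 3 := by
    rcases g.dge c3.symm with dp | dp
    · obtain ⟨z, hz⟩ := g.d2 c3.symm dp
      exact (A0 hC t2L h1.r21 h2 hz).elim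
    · exact dp
  have npt : ¬ G.Adj p t2 := fun h => T1 hC htL h1 h
  have hpq : p ≠ q := by rintro rfl; exact npt c3.symm
  by_cases hA : G.Adj p q
  · obtain ⟨p1, hp⟩ := g.d32 b2.symm hA (by grind) dp
    obtain ⟨n4, d4, -, -, c4, e4⟩ := hp.f3
    have dp1 := g.dge c4.symm
    by_cases hB : G.Adj p1 q
    · rcases dp1 with dp1 | dp1
      · exact T1 hC (ip.2 p1 c4) (g.d22 c4.symm hB hpq dp1) hA
      · have hq := g.d33 hB.symm hA.symm c3.symm (by grind) (by grind) (by grind)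
        have : p1 ≠ t2 := by grind
        exact nb (lobe_H2 g ih (a := p) (b := q) (c := t1) (d := t2) (r := p1) (by simp; grind) hp.r321 hq h1 h2.r21)
    · refine nb (P3L g ih m hp h1 h2 npt (by simp) (by simp) ip i1 i2 p1 q (by simp [hB]) (by simp) ?_)
      simp [cnt, nw, n4, n4.2.2.2.2.2.symm, dq]; omega
  obtain ⟨p1, p2, hp⟩ := g.d3 b2.symm dp
  obtain ⟨n4, d4, -, b4, c4, e4⟩ := hp.f3
  have k1 : p1 ≠ q := by grind
  have k2 : p2 ≠ q := by grind
  have key : ∀ p1 p2, NL G p [t1, p1, p2] → dg G p1 = 2 → dg G p2 = 3 → p1 ≠ q → p2 ≠ q → False := by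
    intro p1 p2 hp dp1 dp2 k1 k2
    obtain ⟨n4, d4, -, b4, c4, e4⟩ := hp.f3
    have hB : ¬ G.Adj p1 q := fun h => C5conf hC (ip.2 _ b4) htL (g.d22 b4.symm h hpq dp1) h1 h2
    refine nb (P3L g ih m hp h1 h2 npt (by simp) (by simp) ip i1 i2 p1 q (by simp [hB]) (by simp) ?_)
    simp [cnt, nw, n4, n4.2.2.2.2.2.symm, dq, dp1, dp2, k1, k2, k1.symm, k2.symm]
  rcases g.dge b4.symm with dp1 | dp1 <;> rcases g.dge c4.symm with dp2 | dp2
  rotate_left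
  · exact key p1 p2 hp dp1 dp2 k1 k2
  · exact key p2 p1 hp.r132 dp2 dp1 k2 k1
  · refine nb (P3L g ih m hp h1 h2 npt (by simp) (by simp) ip i1 i2 p1 p1 (by simp) (by simp) ?_)
    simp [cnt, nw, n4, n4.2.2.2.2.2.symm, dq, dp1, dp2, k1, k2, k1.symm, k2.symm]
  obtain ⟨p1', hp1⟩ := g.d2 b4.symm dp1
  obtain ⟨p2', hp2⟩ := g.d2 c4.symm dp2
  obtain ⟨n5, d5, -, b5, e5⟩ := hp1.f2
  obtain ⟨n6, d6, -, b6, e6⟩ := hp2.f2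
  have p1L := ip.2 _ b4
  have p2L := ip.2 _ c4
  have q1 : p1' ≠ p2 := by rintro rfl; exact T1 hC p1L hp1 c4
  have q2 : p2' ≠ p1 := by rintro rfl; exact T1 hC p2L hp2 b4
  have q3 : p1' ≠ t2 := by have := b5.symm; grind
  have q4 : p2' ≠ t2 := by have := b6.symm; grind
  have q5 : p1' ≠ p2' := by rintro rfl; exact twins hC p1L p2L n4.2.2.2.2.2 hp1 hp2
  have q6 : p1' ≠ q := by rintro rfl; exact C5conf hC p1L htL hp1 h1 h2
  have q7 : p2' ≠ q := by rintro rfl; exact C5conf hC p2L htL hp2 h1 h2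
  have e1 := g.dge b5.symm
  have e2 := g.dge b6.symm
  by_cases hB : G.Adj p1' p2'
  · rcases e1 with e1 | e1
    · exact C5conf hC p2L p1L hp2 hp1 (g.d22 b5.symm hB (by grind) e1)
    rcases e2 with e2 | e2
    · exact C5conf hC p1L p2L hp1 hp2 (g.d22 b6.symm hB.symm (by grind) e2)
    refine nb (K5L g ih m hp.r231 hp1 hp2 h1 h2 q1 q3 q2 q4 (by grind) (by grind) ip p p (by simp) (by simp) ?_)
    simp [cnt, nw, e1, e2, dq, q5, q6, q7, q5.symm, q6.symm, q7.symm]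
  · refine nb (K5L g ih m hp.r231 hp1 hp2 h1 h2 q1 q3 q2 q4 (by grind) (by grind) ip p1' p2' (by simp) (by simp [hB]) ?_)
    simp [cnt, nw, dq, q5, q6, q7, q5.symm, q6.symm, q7.symm]; omega

/-- Degree two vertices are not adjacent. -/
theorem thread {U L : Finset V} {G : SimpleGraph V} (hC : Cx U L G) {t1 t2 : V} (htL : t1 ∈ L)
    (hA : G.Adj t1 t2) (h1 : dg G t1 = 2) (h2 : dg G t2 = 2) : False := by
  have ⟨g, ih, m, nb, n5⟩ := hC
  obtain ⟨p, h1⟩ := g.d2 hA h1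
  obtain ⟨q, h2⟩ := g.d2 hA.symm h2
  have i1 := In_two g m htL h1
  have i2 := In_two g m (i1.2 _ hA) h2
  have hpq : p ≠ q := by rintro rfl; exact T1 hC htL h1 (h2.adj (by simp))
  rcases In_or m (i1.2 p (h1.adj (by simp))) (i2.2 q (h2.adj (by simp))) hpq with i | i
  · exact thread1 hC htL i h1.r21 h2
  · exact thread1 hC i2.1 i h2.r21 h1

theorem cnt4 {W : Finset V} {p q f k : V} (h1 : p ∉ W) (h2 : q ∉ W) (h3 : 2 ≤ cnt (· ∈ W) [p, q, f, k]) : f ∈ W ∧ k ∈ W := by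
  by_cases hf : f ∈ W <;> by_cases hk : k ∈ W <;> simp [cnt, h1, h2, hf, hk] at h3 ⊢

/-- An interior cubic vertex does not have exactly two neighbours of degree two. -/
theorem p3two {U L : Finset V} {G : SimpleGraph V} (hC : Cx U L G) {a v u w : V} (ia : In G L a)
    (ha : NL G a [v, u, w]) (dv : dg G v = 2) (du : dg G u = 2) (dw : dg G w = 3) : False := by
  have ⟨g, ih, m, nb, n5⟩ := hC
  obtain ⟨n1, d1, a1, a2, a3, e1⟩ := ha.f3
  have vL := ia.2 v a1
  have uL := ia.2 u a2
  obtain ⟨v', hv⟩ := g.d2 a1.symm dv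
  obtain ⟨u', hu⟩ := g.d2 a2.symm du
  obtain ⟨n2, -, -, b2, e2⟩ := hv.f2
  obtain ⟨n3, -, -, b3, e3⟩ := hu.f2
  have dv' : dg G v' = 3 := (g.dge b2.symm).resolve_left (thread hC vL b2 dv)
  have du' : dg G u' = 3 := (g.dge b3.symm).resolve_left (thread hC uL b3 du)
  have k1 : v' ≠ u' := by rintro rfl; exact twins hC vL uL n1.2.2.2.1 hv hu
  have k2 : v' ≠ w := by rintro rfl; exact T1 hC vL hv a3
  have k3 : u' ≠ w := by rintro rfl; exact T1 hC uL hu a3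
  have iv := In_two g m vL hv
  have iu := In_two g m uL hu
  refine nb (P3L g ih m hv ha hu (fun h => thread hC vL h dv du) (by simp) (by simp) iv ia iu v v (by simp) (by simp) ?_)
  simp [cnt, nw, k1, k2, k3, k1.symm, k2.symm, k3.symm, dv', du', dw]

theorem claw5 {U L : Finset V} {G : SimpleGraph V} (hC : Cx U L G) {a v u s v' u' s' f k : V} (aL : a ∈ L) (sL : s ∈ L) (is' : In G L s')
    (ha : NL G a [v, u, s]) (hv : NL G v [a, v']) (hu : NL G u [a, u']) (hs : NL G s [a, s']) (hs' : NL G s' [s, f, k])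
    (nv : v' ≠ u) (nv' : v' ≠ s') (nu : u' ≠ v) (nu' : u' ≠ s') (ns : s' ≠ v) (ns' : s' ≠ u)
    (hne : v' ≠ u') (hA : ¬ G.Adj v' u') (dv : v' ∈ L → dg G v' = 3) (du : dg G u' = 3) (df : dg G f = 3) (dk : dg G k = 3) : False := by
  have ⟨g, ih, m, nb, n5⟩ := hC
  apply nb
  obtain ⟨hD, nd, hX, x1, x2, x3⟩ := patch_K5 ha hv hu hs hs' nv nv' nu nu' ns ns'
  obtain ⟨n1, d1, a1, a2, a3, e1⟩ := ha.f3
  obtain ⟨n2, -, -, b2, e2⟩ := hv.f2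
  obtain ⟨n3, -, -, b3, e3⟩ := hu.f2
  obtain ⟨n4, -, -, b4, e4⟩ := hs.f2
  obtain ⟨n5, -, -, b5, b6, e5⟩ := hs'.f3
  have fL := is'.2 f b5
  have kL := is'.2 k b6
  refine stepN g ih m hD v' u' 2 hne (by simp [hf_K5]) (by simp [hf_K5]) hA ?_ ?_ ?_ ?_ ?_
  · rw [hf_K5]
    have dv2 := g.dge b2.symm
    have q1 := n5.2.2.2.2.2
    have q2 := q1.symm
    have q3 := hne.symm
    intro z hz
    simp only [List.mem_cons, List.not_mem_nil, or_false] at hz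
    simp only [cnt, nw]
    rcases hz with rfl | rfl | rfl | rfl <;> split_ifs <;> grind
  · simp [DK5]; grind [In]
  · intro W w1 w2 w3 w4 w5
    rw [hf_K5] at w3
    have hfk : f ∈ W ∧ k ∈ W := cnt4 w1 w2 w3
    have hWX : ∀ z ∈ W, z ∉ VS (DK5 a v u s s' v' u' [f, k]) := fun z hz => (Finset.mem_sdiff.1 (w4 hz)).2
    have key : ∀ x y, x ∈ W ∪ {s, s'} → y ∉ W ∪ {s, s'} → G.Adj x y → x = s ∧ y = a := by
      intro x y h1 h2 h3
      simp only [Finset.mem_union, Finset.mem_insert, Finset.mem_singleton, not_or] at h1 h2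
      rcases h1 with h1 | h1 | h1
      · have h4 : y ∈ VS (DK5 a v u s s' v' u' [f, k]) := by by_contra h; exact h2.1 (w5 x h1 y h h3)
        have h5 := hWX x h1
        have h6 := h3.symm
        rw [hX] at h4 h5
        clear hX w5 hWX
        rcases h4 with rfl | rfl | rfl | rfl | rfl
        · rw [e1] at h6; grind
        · rw [e2] at h6; grind
        · rw [e3] at h6; grind
        · grind
        · grind
      · subst h1; rw [e4] at h3; grind
      · subst h1; rw [e5] at h3; grind
    refine nobridge g m (M := W ∪ {s, s'}) ?_ (m := s) (m' := a) (by simp) ?_ sL aL (hs.adj (by simp)) ?_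
    · refine Finset.union_subset (w4.trans Finset.sdiff_subset) ?_
      simp [Finset.insert_subset_iff, m.sub sL, m.sub is'.1]
    · have : a ∉ W := fun h => hWX a h ((hX a).2 (by simp))
      simp at nd
      simp [this]; grind
    · intro x y x' y' h1 h2 h3 h4 h5 h6
      have := key x y h1 h2 h3
      have := key x' y' h4 h5 h6
      grind
  · exact ext_claw5 hX nd a1 a2 a3 b4 b2 b3 b5 x1 x2 (x3 f (by simp)) (Or.inr ⟨rfl, rfl⟩)
  · simp [DK5, drop]

/-- Double claw patch. -/
def DK7 (a v u s s' f k v' u' f' k' : V) : Pt V :=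
  [(a, [v, u, s], []), (v, [a], [v']), (u, [a], [u']), (s, [a, s'], []), (s', [s, f, k], []), (f, [s'], [f']), (k, [s'], [k'])]

theorem claw7 {U L : Finset V} {G : SimpleGraph V} (hC : Cx U L G) {a v u s v' u' s' f k : V} (aL : a ∈ L) (sL : s ∈ L) (is' : In G L s')
    (ha : NL G a [v, u, s]) (hv : NL G v [a, v']) (hu : NL G u [a, u']) (hs : NL G s [a, s']) (hs' : NL G s' [s, f, k])
    (nv : v' ≠ u) (nv' : v' ≠ s') (nu : u' ≠ v) (nu' : u' ≠ s') (ns : s' ≠ v) (ns' : s' ≠ u)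
    (hne : v' ≠ u') (hA : ¬ G.Adj v' u') (dv : v' ∈ L → dg G v' = 3) (du : dg G u' = 3) (df : dg G f = 2) (dk : dg G k = 2) : False := by
  have ⟨g, ih, m, nb, n5⟩ := hC
  apply nb
  obtain ⟨n1, d1, a1, a2, a3, e1⟩ := ha.f3
  obtain ⟨n2, d2, -, b2, e2⟩ := hv.f2
  obtain ⟨n3, d3, -, b3, e3⟩ := hu.f2
  obtain ⟨n4, -, -, b4, e4⟩ := hs.f2
  obtain ⟨n5, d5, -, b5, b6, e5⟩ := hs'.f3
  have fL := is'.2 f b5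
  have kL := is'.2 k b6
  obtain ⟨f', hf⟩ := g.d2 b5.symm df
  obtain ⟨k', hk⟩ := g.d2 b6.symm dk
  obtain ⟨n6, -, -, b7, e6⟩ := hf.f2
  obtain ⟨n7, -, -, b8, e7⟩ := hk.f2
  have df' : dg G f' = 3 := (g.dge b7.symm).resolve_left (thread hC fL b7 df)
  have dk' : dg G k' = 3 := (g.dge b8.symm).resolve_left (thread hC kL b8 dk)
  have hfk' : f' ≠ k' := by rintro rfl; exact twins hC fL kL n5.2.2.2.2.2 hf hk
  have r0 : ∀ z, G.Adj s' z → dg G z = 2 → z ≠ a ∧ z ≠ v ∧ z ≠ u := by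
    intro z hz dz
    refine ⟨?_, ?_, ?_⟩ <;> intro h <;> rw [h] at dz hz
    · omega
    · have := hz.symm
      rw [e2] at this
      rcases this with h | h
      · exact n4.2.2 h.symm
      · exact nv' h.symm
    · have := hz.symm
      rw [e3] at this
      rcases this with h | h
      · exact n4.2.2 h.symm
      · exact nu' h.symm
  have r1 := r0 f b5 df
  have r2 := r0 k b6 dk
  have nd : [a, v, u, s, s', f, k].Nodup := by simp; grind
  have ds : dg G s = 2 := by have := hs.dg; simpa using this
  have i1 : v' ∉ [a, v, u, s, s', f, k] := by
    have h0 := b2.symm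
    have h1 : v' ≠ f := by intro h; rw [h] at dv; have := dv fL; omega
    have h2 : v' ≠ k := by intro h; rw [h] at dv; have := dv kL; omega
    have h3 : v' ≠ s := by
      intro h; rw [h, e4] at h0
      rcases h0 with h0 | h0
      · exact n2.1 h0
      · exact ns h0.symm
    simp only [List.mem_cons, List.not_mem_nil, or_false, not_or]
    exact ⟨n2.2.2.symm, n2.2.1.symm, nv, h3, nv', h1, h2⟩
  have i2 : u' ∉ [a, v, u, s, s', f, k] := by
    have h0 := b3.symm
    have h1 : u' ≠ f := by intro h; rw [h] at du; omega
    have h2 : u' ≠ k := by intro h; rw [h] at du; omega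
    have h3 : u' ≠ s := by
      intro h; rw [h, e4] at h0
      rcases h0 with h0 | h0
      · exact n3.1 h0
      · exact ns' h0.symm
    simp only [List.mem_cons, List.not_mem_nil, or_false, not_or]
    exact ⟨n3.2.2.symm, nu, n3.2.1.symm, h3, nu', h1, h2⟩
  have i3 : f' ∉ [a, v, u, s, s', f, k] := by
    have h1 : f' ≠ a := by rintro rfl; have := b7.symm; rw [e1] at this; grind
    simp; refine ⟨?_, ?_, ?_, ?_, ?_, ?_, ?_⟩ <;> grind
  have i4 : k' ∉ [a, v, u, s, s', f, k] := by
    have h1 : k' ≠ a := by rintro rfl; have := b8.symm; rw [e1] at this; grind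
    simp; refine ⟨?_, ?_, ?_, ?_, ?_, ?_, ?_⟩ <;> grind
  have hvs : vs (DK7 a v u s s' f k v' u' f' k') = [a, v, u, s, s', f, k] := by simp [vs, DK7]
  have hhf : RD.hf (DK7 a v u s s' f k v' u' f' k') = [v', u', f', k'] := by simp [RD.hf, DK7]
  have hD : Patch G (DK7 a v u s s' f k v' u' f' k') := by
    refine ⟨by rw [hvs]; exact nd, ?_⟩
    rw [hvs]
    simp only [DK7]
    intro d hd
    rw [List.mem_cons, List.mem_cons, List.mem_cons, List.mem_cons, List.mem_cons, List.mem_cons, List.mem_singleton] at hd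
    rcases hd with rfl | rfl | rfl | rfl | rfl | rfl | rfl
    · exact ⟨ha, by simp, by simp, by simp⟩
    · exact ⟨hv, by simp, by simp, by intro z hz; rw [List.mem_singleton.1 hz]; exact i1⟩
    · exact ⟨hu, by simp, by simp, by intro z hz; rw [List.mem_singleton.1 hz]; exact i2⟩
    · exact ⟨hs, by simp, by simp, by simp⟩
    · exact ⟨hs', by simp, by simp, by simp⟩
    · exact ⟨hf, by simp, by simp, by intro z hz; rw [List.mem_singleton.1 hz]; exact i3⟩
    · exact ⟨hk, by simp, by simp, by intro z hz; rw [List.mem_singleton.1 hz]; exact i4⟩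
  have hX : ∀ z, z ∈ VS (DK7 a v u s s' f k v' u' f' k') ↔ z = a ∨ z = v ∨ z = u ∨ z = s ∨ z = s' ∨ z = f ∨ z = k := by
    intro z; rw [mem_VS, hvs]; simp
  have iff := In_two g m fL hf
  have ikk := In_two g m kL hk
  refine stepN g ih m hD v' u' 3 hne (by simp [hhf]) (by simp [hhf]) hA ?_ ?_ ?_ ?_ ?_
  · rw [hhf]
    have dv2 := g.dge b2.symm
    have q3 := hne.symm
    have fL' := iff.2 f' b7
    have kL' := ikk.2 k' b8
    clear hX hD e1 e2 e3 e4 e5 e6 e7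
    intro z hz
    simp only [List.mem_cons, List.not_mem_nil, or_false] at hz
    simp only [cnt, nw]
    rcases hz with rfl | rfl | rfl | rfl <;> split_ifs <;> grind
  · have fL' := iff.2 f' b7
    have kL' := ikk.2 k' b8
    simp [DK7]; grind
  · intro W w1 w2 w3 w4 w5
    rw [hhf] at w3
    have hfk : f' ∈ W ∧ k' ∈ W := cnt4 w1 w2 w3
    have hWX : ∀ z ∈ W, z ∉ VS (DK7 a v u s s' f k v' u' f' k') := fun z hz => (Finset.mem_sdiff.1 (w4 hz)).2
    have key : ∀ x y, x ∈ W ∪ {s, s', f, k} → y ∉ W ∪ {s, s', f, k} → G.Adj x y → x = s ∧ y = a := by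
      intro x y h1 h2 h3
      simp only [Finset.mem_union, Finset.mem_insert, Finset.mem_singleton, not_or] at h1 h2
      rcases h1 with h1 | h1 | h1 | h1 | h1
      · have h4 : y ∈ VS (DK7 a v u s s' f k v' u' f' k') := by by_contra h; exact h2.1 (w5 x h1 y h h3)
        have h5 := hWX x h1
        have h6 := h3.symm
        rw [hX] at h4 h5
        clear hX w5 hWX
        rcases h4 with rfl | rfl | rfl | rfl | rfl | rfl | rfl
        · rw [e1] at h6; grind
        · rw [e2] at h6; grind
        · rw [e3] at h6; grind
        · grind
        · grind
        · grind
        · grind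
      · subst h1; rw [e4] at h3; grind
      · subst h1; rw [e5] at h3; grind
      · subst h1; rw [e6] at h3; grind
      · subst h1; rw [e7] at h3; grind
    refine nobridge g m (M := W ∪ {s, s', f, k}) ?_ (m := s) (m' := a) (by simp) ?_ sL aL (hs.adj (by simp)) ?_
    · refine Finset.union_subset (w4.trans Finset.sdiff_subset) ?_
      simp [Finset.insert_subset_iff, m.sub sL, m.sub is'.1, m.sub fL, m.sub kL]
    · have : a ∉ W := fun h => hWX a h ((hX a).2 (by simp))
      simp at nd
      simp [this]; grind
    · intro x y x' y' h1 h2 h3 h4 h5 h6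
      have := key x y h1 h2 h3
      have := key x' y' h4 h5 h6
      grind
  · refine ext_claw7 hX nd a1 a2 a3 b4 b2 b3 b5 b6 b7 b8 ?_ ?_ ?_ ?_ <;> rw [mem_VS, hvs] <;> assumption
  · simp [DK7, drop]

theorem In3 {L : Finset V} {G : SimpleGraph V} {v a b c : V} (h : NL G v [a, b, c]) (hv : v ∈ L) (h1 : a ∈ L) (h2 : b ∈ L) (h3 : c ∈ L) :
    In G L v := by
  refine ⟨hv, fun z hz => ?_⟩
  rw [h.f3.2.2.2.2.2] at hz
  rcases hz with rfl | rfl | rfl <;> assumption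

theorem claw_core {U L : Finset V} {G : SimpleGraph V} (hC : Cx U L G) {a v u s v' u' s' : V} (aL : a ∈ L) (sL : s ∈ L) (is' : In G L s')
    (ha : NL G a [v, u, s]) (hv : NL G v [a, v']) (hu : NL G u [a, u']) (hs : NL G s [a, s']) (ds' : dg G s' = 3)
    (nv : v' ≠ u) (nv' : v' ≠ s') (nu : u' ≠ v) (nu' : u' ≠ s') (ns : s' ≠ v) (ns' : s' ≠ u)
    (hne : v' ≠ u') (hA : ¬ G.Adj v' u') (dv : v' ∈ L → dg G v' = 3) (du : dg G u' = 3) : False := by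
  obtain ⟨n4, d4, -, b4, e4⟩ := hs.f2
  obtain ⟨f, k, hs'⟩ := hC.g.d3 b4.symm ds'
  obtain ⟨n5, -, -, b5, b6, e5⟩ := hs'.f3
  rcases hC.g.dge b5.symm with df | df <;> rcases hC.g.dge b6.symm with dk | dk
  · exact claw7 hC aL sL is' ha hv hu hs hs' nv nv' nu nu' ns ns' hne hA dv du df dk
  · exact p3two hC is' hs' d4 df dk
  · exact p3two hC is' hs'.r132 d4 dk df
  · exact claw5 hC aL sL is' ha hv hu hs hs' nv nv' nu nu' ns ns' hne hA dv du df dk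

theorem claw_x {U L : Finset V} {G : SimpleGraph V} (hC : Cx U L G) {a v u s : V} (aL : a ∈ L) (vL : v ∉ L)
    (ha : NL G a [v, u, s]) (dv : dg G v = 2) (du : dg G u = 2) (ds : dg G s = 2) : False := by
  have ⟨g, ih, m, nb, n5⟩ := hC
  obtain ⟨n1, d1, a1, a2, a3, e1⟩ := ha.f3
  have uL : u ∈ L := by
    by_contra h; exact n1.2.2.2.1 (m.cut a v a u aL vL a1 aL h a2).2
  have sL : s ∈ L := by
    by_contra h; exact n1.2.2.2.2.1 (m.cut a v a s aL vL a1 aL h a3).2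
  obtain ⟨v', hv⟩ := g.d2 a1.symm dv
  obtain ⟨u', hu⟩ := g.d2 a2.symm du
  obtain ⟨s', hs⟩ := g.d2 a3.symm ds
  obtain ⟨n2, -, -, b2, e2⟩ := hv.f2
  obtain ⟨n3, -, -, b3, e3⟩ := hu.f2
  obtain ⟨n4, -, -, b4, e4⟩ := hs.f2
  have vL' : v' ∉ L := fun h => n2.2.2 (m.cut a v v' v aL vL a1 h vL b2.symm).1
  have uL' := (In_two g m uL hu).2 u' b3
  have sL' := (In_two g m sL hs).2 s' b4
  have du' : dg G u' = 3 := (g.dge b3.symm).resolve_left (thread hC uL b3 du)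
  have ds' : dg G s' = 3 := (g.dge b4.symm).resolve_left (thread hC sL b4 ds)
  have is' : In G L s' := (In_or m aL sL' n4.2.2).resolve_left (fun h => vL (h.2 v a1))
  refine claw_core hC aL sL is' ha hv hu hs ds' ?_ ?_ ?_ ?_ ?_ ?_ ?_ ?_ (fun h => absurd h vL') du'
  · rintro rfl; exact vL' uL
  · rintro rfl; exact vL' sL'
  · rintro rfl; exact vL uL'
  · rintro rfl; exact twins hC uL sL n1.2.2.2.2.2 hu hs
  · rintro rfl; exact vL sL'
  · rintro rfl; omega
  · rintro rfl; exact vL' uL'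
  · intro h; exact n3.2.2 (m.cut a v u' v' aL vL a1 uL' vL' h.symm).1

theorem claw_in {U L : Finset V} {G : SimpleGraph V} (hC : Cx U L G) {a v u s : V} (ia : In G L a)
    (ha : NL G a [v, u, s]) (dv : dg G v = 2) (du : dg G u = 2) (ds : dg G s = 2) : False := by
  have ⟨g, ih, m, nb, n5⟩ := hC
  obtain ⟨n1, d1, a1, a2, a3, e1⟩ := ha.f3
  have aL := ia.1
  have vL := ia.2 v a1
  have uL := ia.2 u a2
  have sL := ia.2 s a3
  obtain ⟨v', hv⟩ := g.d2 a1.symm dv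
  obtain ⟨u', hu⟩ := g.d2 a2.symm du
  obtain ⟨s', hs⟩ := g.d2 a3.symm ds
  obtain ⟨n2, -, -, b2, e2⟩ := hv.f2
  obtain ⟨n3, -, -, b3, e3⟩ := hu.f2
  obtain ⟨n4, -, -, b4, e4⟩ := hs.f2
  have vL' := (In_two g m vL hv).2 v' b2
  have uL' := (In_two g m uL hu).2 u' b3
  have sL' := (In_two g m sL hs).2 s' b4
  have dv' : dg G v' = 3 := (g.dge b2.symm).resolve_left (thread hC vL b2 dv)
  have du' : dg G u' = 3 := (g.dge b3.symm).resolve_left (thread hC uL b3 du)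
  have ds' : dg G s' = 3 := (g.dge b4.symm).resolve_left (thread hC sL b4 ds)
  have k1 : v' ≠ u' := by rintro rfl; exact twins hC vL uL n1.2.2.2.1 hv hu
  have k2 : v' ≠ s' := by rintro rfl; exact twins hC vL sL n1.2.2.2.2.1 hv hs
  have k3 : u' ≠ s' := by rintro rfl; exact twins hC uL sL n1.2.2.2.2.2 hu hs
  have ne : ∀ {x y : V}, dg G x = 3 → dg G y = 2 → x ≠ y := by rintro x y h1 h2 rfl; omega
  have c1 : In G L s' → G.Adj v' u' := by
    intro h
    by_contra hA
    exact claw_core hC aL sL h ha hv hu hs ds' (ne dv' du) k2 (ne du' dv) k3 (ne ds' dv) (ne ds' du) k1 hA (fun _ => dv') du'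
  have c2 : In G L u' → G.Adj v' s' := by
    intro h
    by_contra hA
    exact claw_core hC aL uL h ha.r132 hv hs hu du' (ne dv' ds) k1 (ne ds' dv) k3.symm (ne du' dv) (ne du' ds) k2 hA (fun _ => dv') ds'
  have c3 : In G L v' → G.Adj s' u' := by
    intro h
    by_contra hA
    exact claw_core hC aL vL h ha.r321 hs hu hv dv' (ne ds' du) k2.symm (ne du' ds) k1.symm (ne dv' ds) (ne dv' du) k3.symm hA (fun _ => ds') du'
  have i1 : In G L v' := by
    by_contra h
    have h1 := c1 ((In_or m vL' sL' k2).resolve_left h)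
    have h2 := c2 ((In_or m vL' uL' k1).resolve_left h)
    exact h (In3 (g.d33 b2.symm h1 h2 (ne du' dv).symm (ne ds' dv).symm k3) vL' vL uL' sL')
  have h3 := c3 i1
  have i2 : In G L u' := by
    by_contra h
    have h1 := c1 ((In_or m uL' sL' k3).resolve_left h)
    exact h (In3 (g.d33 b3.symm h1.symm h3.symm (ne dv' du).symm (ne ds' du).symm k2) uL' uL vL' sL')
  have h2 := c2 i2
  have i3 : In G L s' := In3 (g.d33 b4.symm h2.symm h3 (ne dv' ds).symm (ne du' ds).symm k1) sL' sL vL' uL'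
  have h1 := c1 i3
  refine nb (base_claw g ih (u := v) (v := u) (w := s) (p := v') (q := u') (r := s') (a := a) ?_ hv hu hs
    (g.d33 b2.symm h1 h2 (ne du' dv).symm (ne ds' dv).symm k3) (g.d33 b3.symm h1.symm h3.symm (ne dv' du).symm (ne ds' du).symm k2)
    (g.d33 b4.symm h2.symm h3 (ne dv' ds).symm (ne du' ds).symm k1) ha)
  have x1 := (ne dv' du).symm
  have x2 := (ne dv' ds).symm
  have x3 := (ne du' dv).symm
  have x4 := (ne du' ds).symm
  have x5 := (ne ds' dv).symm
  have x6 := (ne ds' du).symm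
  clear c1 c2 c3 e1 e2 e3 e4
  simp; grind

/-- A cubic vertex of a minimal set is not the centre of a claw of degree two vertices. -/
theorem claw {U L : Finset V} {G : SimpleGraph V} (hC : Cx U L G) {a v u s : V} (aL : a ∈ L)
    (ha : NL G a [v, u, s]) (dv : dg G v = 2) (du : dg G u = 2) (ds : dg G s = 2) : False := by
  by_cases ia : In G L a
  · exact claw_in hC ia ha dv du ds
  obtain ⟨z, h1, h2⟩ := nIn aL ia
  rw [ha.f3.2.2.2.2.2] at h1
  rcases h1 with rfl | rfl | rfl
  · exact claw_x hC aL h2 ha dv du ds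
  · exact claw_x hC aL h2 ha.r213 du dv ds
  · exact claw_x hC aL h2 ha.r321 ds du dv

/-- An interior cubic vertex has at most one neighbour of degree two. -/
theorem one2 {U L : Finset V} {G : SimpleGraph V} (hC : Cx U L G) {a v u s : V} (ia : In G L a)
    (ha : NL G a [v, u, s]) (dv : dg G v = 2) : dg G u = 3 ∧ dg G s = 3 := by
  obtain ⟨n1, d1, a1, a2, a3, e1⟩ := ha.f3
  rcases hC.g.dge a2.symm with df | df <;> rcases hC.g.dge a3.symm with dk | dk
  · exact (claw hC ia.1 ha dv df dk).elim
  · exact (p3two hC ia ha dv df dk).elim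
  · exact (p3two hC ia ha.r132 dv dk df).elim
  · exact ⟨df, dk⟩

theorem P4L {U L : Finset V} {G : SimpleGraph V} (hG : Good U G) (ih : IH U) (hL : MinL U G L)
    {a v b : V} {A C B : List V} (ha : NL G a (v :: A)) (hv : NL G v (a :: b :: C))
    (hb : NL G b (v :: B)) (hn : ¬ G.Adj a b)
    (ia : In G L a) (iv : In G L v) (ib : In G L b) (p q : V) (hA : p ∈ A) (hB : q ∈ B) (hne : p ≠ q) (hnpq : ¬ G.Adj p q)
    (hlen : A.length + (C.length + B.length) ≤ 4)
    (hdeg : ∀ z ∈ A ++ (C ++ B), 2 + cnt (· = z) (A ++ (C ++ B)) ≤ dg G z + nw p q z)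
    (hconn : ∀ W : Finset V, 2 ≤ cnt (· ∈ W) (A ++ (C ++ B)) → 2 ≤ cnt (· ∉ W) (A ++ (C ++ B)) →
      (∀ x y, x ∉ VS (DP a v b A C B) → y ∉ VS (DP a v b A C B) → G.Adj x y → (x ∈ W ↔ y ∈ W)) → (p ∈ W ↔ q ∈ W) → False) :
    Bd U G 4 := by
  have hD := patch_DP ha hv hb hn
  refine P3L4 hG ih hL ha hv hb hn p q hA hB hne hnpq hlen hdeg ?_
  intro W h1 h2 h3 h4 h5
  have hI : Int L (DP a v b A C B) := by
    apply int_of_In hD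
    simp [DP, vs, ia, iv, ib]
  obtain ⟨k1, k2⟩ := CL hG hL hD hI (by simp [DP]) h1 h2 h3 h4
  rw [hf_DP] at k1 k2
  refine hconn W k1 k2 ?_ h5
  intro x y hx hy hxy
  exact ⟨fun h => h4 x h y hy hxy, fun h => h4 y h x hx hxy.symm⟩

/-- Two crossing splits of four half edges cannot separate badly. -/
theorem cross {U L : Finset V} {G : SimpleGraph V} (hG : Good U G) (hL : MinL U G L) {D : Pt V} (hD : Patch G D)
    (hI : Int L D) {p q r s : V} (hp : p ∈ hf D) (hq : q ∈ hf D)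
    (hc : ∀ W : Finset V, cnt (· ∈ W) (hf D) = cnt (· ∈ W) [p, q, r, s])
    (hc' : ∀ W : Finset V, cnt (· ∉ W) (hf D) = cnt (· ∉ W) [p, q, r, s])
    {W W2 : Finset V} (w1 : 2 ≤ cnt (· ∈ W) (hf D)) (w2 : 2 ≤ cnt (· ∉ W) (hf D))
    (w3 : ∀ u v, u ∉ VS D → v ∉ VS D → G.Adj u v → (u ∈ W ↔ v ∈ W)) (pW : p ∈ W) (qW : q ∉ W)
    (x1 : 2 ≤ cnt (· ∈ W2) (hf D)) (x2 : 2 ≤ cnt (· ∉ W2) (hf D))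
    (x3 : ∀ u v, u ∉ VS D → v ∉ VS D → G.Adj u v → (u ∈ W2 ↔ v ∈ W2)) (x4 : p ∈ W2 ↔ q ∈ W2) : False := by
  have hn : D ≠ [] := by rintro rfl; simp [hf] at hp
  have pU := hD.hf_mem hG hp
  rw [hc] at w1 x1
  rw [hc'] at w2 x2
  have key : ∀ W3 : Finset V, (∀ u v, u ∉ VS D → v ∉ VS D → G.Adj u v → (u ∈ W3 ↔ v ∈ W3)) → p ∈ W3 → (r ∈ W3 → r ∈ W → False) →
      (s ∈ W3 → s ∈ W → False) → False := by
    intro W3 h1 h2 h3 h4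
    have := CL hG hL hD hI hn (W := (W ∩ W3) ∩ (U \ VS D)) Finset.inter_subset_right ⟨p, by
      rw [Finset.mem_inter]; exact ⟨by simp [pW, h2], pU⟩⟩ ?_ ?_
    · have h5 := this.1
      rw [hc] at h5
      by_cases hr : r ∈ (W ∩ W3) ∩ (U \ VS D)
      · simp only [Finset.mem_inter] at hr; exact h3 hr.1.2 hr.1.1
      by_cases hs : s ∈ (W ∩ W3) ∩ (U \ VS D)
      · simp only [Finset.mem_inter] at hs; exact h4 hs.1.2 hs.1.1
      have hq : q ∉ (W ∩ W3) ∩ (U \ VS D) := by simp [qW]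
      simp only [cnt, hr, hs, hq] at h5
      split_ifs at h5 <;> omega
    · intro h
      have hqU := hD.hf_mem hG hq
      rw [← h] at hqU
      simp [qW] at hqU
    · intro u hu v hv huv
      simp only [Finset.mem_inter, Finset.mem_sdiff] at hu ⊢
      exact ⟨⟨(w3 u v hu.2.2 hv huv).1 hu.1.1, (h1 u v hu.2.2 hv huv).1 hu.1.2⟩, hG.sub v u huv.symm, hv⟩
  by_cases hp2 : p ∈ W2
  · have hq2 := x4.1 hp2
    refine key W2 x3 hp2 ?_ ?_ <;> intro h1 h2 <;> simp only [cnt, hp2, hq2, h1] at x2 <;> split_ifs at x2 <;> simp_all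
  · have hq2 := fun h => hp2 (x4.2 h)
    refine key W2ᶜ ?_ (by simpa using hp2) ?_ ?_
    · intro u v h1 h2 h3; simp [x3 u v h1 h2 h3]
    · intro h1 h2
      simp at h1
      simp only [cnt, hp2, hq2, h1] at x1; split_ifs at x1 <;> simp_all
    · intro h1 h2
      simp at h1
      simp only [cnt, hp2, hq2, h1] at x1; split_ifs at x1 <;> simp_all

theorem A8s {U L : Finset V} {G : SimpleGraph V} (hC : Cx U L G) {v a b a1 a2 b1 b2 : V} (ia : In G L a) (ib : In G L b)
    (hv : NL G v [a, b]) (ha : NL G a [v, a1, a2]) (hb : NL G b [v, b1, b2]) (hn : ¬ G.Adj a b)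
    (da1 : dg G a1 = 3) (da2 : dg G a2 = 3) (db1 : dg G b1 = 3) (db2 : dg G b2 = 3)
    (n1 : a1 ≠ b1) (n2 : a2 ≠ b2) (hA : ¬ G.Adj a1 b1)
    (hconn : ∀ W : Finset V, 2 ≤ cnt (· ∈ W) [a1, a2, b1, b2] → 2 ≤ cnt (· ∉ W) [a1, a2, b1, b2] →
      (∀ x y, x ∉ VS (DP a v b [a1, a2] [] [b1, b2]) → y ∉ VS (DP a v b [a1, a2] [] [b1, b2]) → G.Adj x y → (x ∈ W ↔ y ∈ W)) →
      (a1 ∈ W ↔ b1 ∈ W) → False) : False := by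
  have ⟨g, ih, m, nb, n5⟩ := hC
  obtain ⟨e1, -⟩ := ha.f3
  obtain ⟨e2, -⟩ := hb.f3
  have iv : In G L v := In_two g m (ia.2 v (ha.adj (by simp))) hv
  refine nb (P4L g ih m ha hv hb hn ia iv ib a1 b1 (by simp) (by simp) n1 hA (by simp) ?_ ?_)
  · intro z hz
    simp only [List.mem_cons, List.not_mem_nil, or_false, List.cons_append, List.nil_append] at hz
    simp only [cnt, nw, List.cons_append, List.nil_append]
    rcases hz with rfl | rfl | rfl | rfl <;> split_ifs <;> grind
  · exact hconn

theorem A8in {U L : Finset V} {G : SimpleGraph V} (hC : Cx U L G) {v a b : V} (ia : In G L a) (ib : In G L b)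
    (hv : NL G v [a, b]) : False := by
  have ⟨g, ih, m, nb, n5⟩ := hC
  obtain ⟨n1, dv, av, bv, ev⟩ := hv.f2
  have vL := ia.2 v av.symm
  have da : dg G a = 3 := (g.dge av.symm).resolve_left (thread hC vL av dv)
  have db : dg G b = 3 := (g.dge bv.symm).resolve_left (thread hC vL bv dv)
  obtain ⟨a1, a2, ha⟩ := g.d3 av.symm da
  obtain ⟨b1, b2, hb⟩ := g.d3 bv.symm db
  have hn : ¬ G.Adj a b := T1 hC vL hv
  obtain ⟨da1, da2⟩ := one2 hC ia ha dv
  obtain ⟨db1, db2⟩ := one2 hC ib hb dv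
  -- one common neighbour
  have one : ∀ a1 a2 b1 b2, NL G a [v, a1, a2] → NL G b [v, b1, b2] → a1 ≠ b2 := by
    rintro z a2 b1 _ ha hb rfl
    obtain ⟨e1, -, -, f1, f1', -⟩ := ha.f3
    obtain ⟨e2, -, -, f2, f2', -⟩ := hb.f3
    obtain ⟨da1, da2⟩ := one2 hC ia ha dv
    obtain ⟨db1, db2⟩ := one2 hC ib hb dv
    have hab := n1.2.2
    have hA : ¬ G.Adj z b1 := by
      intro h
      have ne : a ≠ b1 := by rintro rfl; exact hn f2.symm
      have hz := g.d33 f1.symm f2'.symm h hab ne e2.2.1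
      have iz := In3 hz (ia.2 z f1) ia.1 ib.1 (ib.2 b1 f2)
      have := tri hC iz hz f2
      omega
    refine A8s hC ia ib hv ha hb hn da1 da2 db1 db2 e2.2.2.2.2.2.symm e1.2.2.2.2.2.symm hA ?_
    intro W w1 w2 w3 w4
    simp only [cnt] at w1 w2
    by_cases h : z ∈ W
    · have h2 := w4.1 h
      simp [h, h2] at w2
      split_ifs at w2 <;> omega
    · have h2 := fun h' => h (w4.2 h')
      simp [h, h2] at w1
      split_ifs at w1 <;> omega
  have c1 : a1 ≠ b2 := one _ _ _ _ ha hb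
  have c2 : a1 ≠ b1 := one _ _ _ _ ha hb.r132
  have c3 : a2 ≠ b2 := one _ _ _ _ ha.r132 hb
  have c4 : a2 ≠ b1 := one _ _ _ _ ha.r132 hb.r132
  obtain ⟨e1, -, -, f1, f1', -⟩ := ha.f3
  obtain ⟨e2, -, -, f2, f2', -⟩ := hb.f3
  have iv : In G L v := In_two g m vL hv
  by_cases hW : ∃ W : Finset V, 2 ≤ cnt (· ∈ W) [a1, a2, b1, b2] ∧ 2 ≤ cnt (· ∉ W) [a1, a2, b1, b2] ∧
      (∀ x y, x ∉ [a, v, b] → y ∉ [a, v, b] → G.Adj x y → (x ∈ W ↔ y ∈ W))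
  · obtain ⟨W, w1, w2, w3⟩ := hW
    have key : ∀ a1 a2 b1 b2, NL G a [v, a1, a2] → NL G b [v, b1, b2] → a1 ≠ b1 → a2 ≠ b2 → 2 ≤ cnt (· ∈ W) [a1, a2, b1, b2] →
        2 ≤ cnt (· ∉ W) [a1, a2, b1, b2] → ¬ (a1 ∈ W ↔ b1 ∈ W) → False := by
      intro a1 a2 b1 b2 ha hb c2 c3 w1 w2 hno
      obtain ⟨da1, da2⟩ := one2 hC ia ha dv
      obtain ⟨db1, db2⟩ := one2 hC ib hb dv
      have hD := patch_DP ha hv hb hn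
      have hI : Int L (DP a v b [a1, a2] [] [b1, b2]) := by
        apply int_of_In hD
        simp [DP, vs, ia, iv, ib]
      have hhf : hf (DP a v b [a1, a2] [] [b1, b2]) = [a1, a2, b1, b2] := by rw [hf_DP]; simp
      have hVS : ∀ z, z ∈ VS (DP a v b [a1, a2] [] [b1, b2]) ↔ z ∈ [a, v, b] := by intro z; rw [mem_VS]; simp [vs, DP]
      have hout : ∀ z ∈ hf (DP a v b [a1, a2] [] [b1, b2]), z ∉ [a, v, b] := by
        intro z hz; rw [← hVS]; exact (Finset.mem_sdiff.1 (hD.hf_mem g hz)).2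
      rw [hhf] at hout
      refine A8s hC ia ib hv ha hb hn da1 da2 db1 db2 c2 c3 ?_ ?_
      · intro h; exact hno (w3 _ _ (hout _ (by simp)) (hout _ (by simp)) h)
      · intro W2 x1 x2 x3 x4
        by_cases h1 : a1 ∈ W
        · have h2 : b1 ∉ W := fun h => hno ⟨fun _ => h, fun _ => h1⟩
          refine cross g m hD hI (p := a1) (q := b1) (r := a2) (s := b2) (by simp [hhf]) (by simp [hhf]) ?_ ?_ (W := W) (W2 := W2)
            (by rwa [hhf]) (by rwa [hhf]) ?_ h1 h2 (by rwa [hhf]) (by rwa [hhf]) x3 x4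
          · intro W; rw [hhf]; simp only [cnt]; omega
          · intro W; rw [hhf]; simp only [cnt]; omega
          · intro x y; rw [hVS, hVS]; exact w3 x y
        · have h2 : b1 ∈ W := by by_contra h; exact hno ⟨fun h' => absurd h' h1, fun h' => absurd h' h⟩
          refine cross g m hD hI (p := b1) (q := a1) (r := a2) (s := b2) (by simp [hhf]) (by simp [hhf]) ?_ ?_ (W := W) (W2 := W2)
            (by rwa [hhf]) (by rwa [hhf]) ?_ h2 h1 (by rwa [hhf]) (by rwa [hhf]) x3 x4.symm
          · intro W; rw [hhf]; simp only [cnt]; omega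
          · intro W; rw [hhf]; simp only [cnt]; omega
          · intro x y; rw [hVS, hVS]; exact w3 x y
    have k1 := key _ _ _ _ ha hb c2 c3 w1 w2
    have k2 := key _ _ _ _ ha hb.r132 c1 c4 (by simp only [cnt] at w1 ⊢; omega) (by simp only [cnt] at w2 ⊢; omega)
    have k3 := key _ _ _ _ ha.r132 hb c4 c1 (by simp only [cnt] at w1 ⊢; omega) (by simp only [cnt] at w2 ⊢; omega)
    replace k1 := not_not.1 k1
    replace k2 := not_not.1 k2
    replace k3 := not_not.1 k3
    by_cases h : a1 ∈ W
    · have h1 := k1.1 h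
      have h2 := k2.1 h
      simp [cnt, h, h1, h2] at w2
      split_ifs at w2 <;> omega
    · have h1 := fun h' => h (k1.2 h')
      have h2 := fun h' => h (k2.2 h')
      simp [cnt, h, h1, h2] at w1
      split_ifs at w1 <;> omega
  · have key : ∀ a1 a2 b1 b2, NL G a [v, a1, a2] → NL G b [v, b1, b2] → a1 ≠ b1 → a2 ≠ b2 →
        (∀ W : Finset V, 2 ≤ cnt (· ∈ W) [a1, a2, b1, b2] → 2 ≤ cnt (· ∉ W) [a1, a2, b1, b2] →
      (∀ x y, x ∉ [a, v, b] → y ∉ [a, v, b] → G.Adj x y → (x ∈ W ↔ y ∈ W)) → False) → G.Adj a1 b1 := by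
      intro a1 a2 b1 b2 ha hb c2 c3 hno
      by_contra hA
      obtain ⟨da1, da2⟩ := one2 hC ia ha dv
      obtain ⟨db1, db2⟩ := one2 hC ib hb dv
      refine A8s hC ia ib hv ha hb hn da1 da2 db1 db2 c2 c3 hA ?_
      intro W w1 w2 w3 w4
      refine hno W w1 w2 ?_
      intro x y hx hy
      exact w3 x y (by rw [mem_VS]; simpa [vs, DP] using hx) (by rw [mem_VS]; simpa [vs, DP] using hy)
    have k1 := key _ _ _ _ ha hb c2 c3 (fun W w1 w2 w3 => hW ⟨W, w1, w2, w3⟩)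
    have k2 := key _ _ _ _ ha hb.r132 c1 c4 (fun W w1 w2 w3 => hW ⟨W, by simp only [cnt] at w1 ⊢; omega, by simp only [cnt] at w2 ⊢; omega, w3⟩)
    have k3 := key _ _ _ _ ha.r132 hb c4 c1 (fun W w1 w2 w3 => hW ⟨W, by simp only [cnt] at w1 ⊢; omega, by simp only [cnt] at w2 ⊢; omega, w3⟩)
    have k4 := key _ _ _ _ ha.r132 hb.r132 c3 c2 (fun W w1 w2 w3 => hW ⟨W, by simp only [cnt] at w1 ⊢; omega, by simp only [cnt] at w2 ⊢; omega, w3⟩)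
    have hab := n1.2.2
    have m1 : a ≠ b1 := by rintro rfl; exact hn f2.symm
    have m2 : a ≠ b2 := by rintro rfl; exact hn f2'.symm
    have m3 : b ≠ a1 := by rintro rfl; exact hn f1
    have m4 : b ≠ a2 := by rintro rfl; exact hn f1'
    refine nb (base_A8 g ih (a := a) (b := b) (c := a1) (d := a2) (e := b1) (f := b2) (v := v) ?_ ha hb
      (g.d33 f1.symm k1 k2 m1 m2 e2.2.2.2.2.2) (g.d33 f1'.symm k3 k4 m1 m2 e2.2.2.2.2.2)
      (g.d33 f2.symm k1.symm k3.symm m3 m4 e1.2.2.2.2.2) (g.d33 f2'.symm k2.symm k4.symm m3 m4 e1.2.2.2.2.2) hv)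
    clear key one hW
    simp; grind

theorem A8xs {U L : Finset V} {G : SimpleGraph V} (hC : Cx U L G) {v a b y a2 b1 b2 : V} (aL : a ∈ L) (yL : y ∉ L) (vL : v ∈ L) (ib : In G L b)
    (hv : NL G v [a, b]) (ha : NL G a [v, y, a2]) (hb : NL G b [v, b1, b2]) (hn : ¬ G.Adj a b)
    (da2 : dg G a2 = 3) (db1 : dg G b1 = 3) (db2 : dg G b2 = 3) (hne : a2 ≠ b2) :
    ∃ W ⊆ U, y ∉ W ∧ b1 ∉ W ∧ a2 ∈ W ∧ b2 ∈ W ∧ (∀ z ∈ [a, v, b], z ∉ W) ∧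
      (∀ u ∈ W, ∀ z, z ∉ [a, v, b] → G.Adj u z → z ∈ W) := by
  have ⟨g, ih, m, nb, n5⟩ := hC
  obtain ⟨e1, -, -, f1, f1', -⟩ := ha.f3
  obtain ⟨e2, -, -, f2, f2', -⟩ := hb.f3
  have b1L := ib.2 b1 f2
  have b2L := ib.2 b2 f2'
  have a2L : a2 ∈ L := by
    by_contra h; exact e1.2.2.2.2.2 (m.cut a y a a2 aL yL f1 aL h f1').2
  by_contra hno
  have hVS : ∀ z, z ∈ VS (DP a v b [y, a2] [] [b1, b2]) ↔ z ∈ [a, v, b] := by intro z; rw [mem_VS]; simp [vs, DP]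
  have hhf : hf (DP a v b [y, a2] [] [b1, b2]) = [y, a2, b1, b2] := by rw [hf_DP]; simp
  have hyb : y ≠ b1 := by rintro rfl; exact yL b1L
  refine nb (stepN g ih m (patch_DP ha hv hb hn) y b1 1 hyb (by simp [hhf]) (by simp [hhf]) ?_ ?_ ?_ ?_
    (ext_DP ha hv hb hn (by simp) (by simp) (by simp)) (by simp [DP, drop]))
  · intro h
    have := (m.cut a y b1 y aL yL f1 b1L yL h.symm).1
    subst this; exact hn f2.symm
  · rw [hhf]
    have dy := g.dge f1.symm
    intro z hz
    simp only [List.mem_cons, List.not_mem_nil, or_false] at hz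
    simp only [cnt, nw]
    rcases hz with rfl | rfl | rfl | rfl <;> split_ifs <;> grind
  · simp [DP, aL, a2L, ib.1, b2L]
  · intro W w1 w2 w3 w4 w5
    rw [hhf] at w3
    have hw : a2 ∈ W ∧ b2 ∈ W := by
      by_cases hf : a2 ∈ W <;> by_cases hk : b2 ∈ W <;> simp [cnt, w1, w2, hf, hk] at w3 ⊢
    refine hno ⟨W, w4.trans Finset.sdiff_subset, w1, w2, hw.1, hw.2, ?_, ?_⟩
    · intro z hz h; exact (Finset.mem_sdiff.1 (w4 h)).2 ((hVS z).2 hz)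
    · intro u hu z hz; rw [← hVS] at hz; exact w5 u hu z hz

theorem A8x {U L : Finset V} {G : SimpleGraph V} (hC : Cx U L G) {v a b y a2 : V} (aL : a ∈ L) (yL : y ∉ L) (vL : v ∈ L)
    (hv : NL G v [a, b]) (ha : NL G a [v, y, a2]) (da2 : dg G a2 = 3) : False := by
  have ⟨g, ih, m, nb, n5⟩ := hC
  obtain ⟨n1, dv, av, bv, ev⟩ := hv.f2
  obtain ⟨e1, -, -, f1, f1', e3⟩ := ha.f3
  have bL := (In_two g m vL hv).2 b bv
  have ib : In G L b := (In_or m aL bL n1.2.2).resolve_left (fun h => yL (h.2 y f1))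
  have db : dg G b = 3 := (g.dge bv.symm).resolve_left (thread hC vL bv dv)
  obtain ⟨b1, b2, hb⟩ := g.d3 bv.symm db
  have hn : ¬ G.Adj a b := T1 hC vL hv
  obtain ⟨db1, db2⟩ := one2 hC ib hb dv
  obtain ⟨e2, -, -, f2, f2', e4⟩ := hb.f3
  have a2L : a2 ∈ L := by
    by_contra h; exact e1.2.2.2.2.2 (m.cut a y a a2 aL yL f1 aL h f1').2
  have bn := e2.2.2.2.2.2
  by_cases c1 : a2 = b2
  · subst c1
    obtain ⟨W, -, -, h1, h2, -⟩ := A8xs hC aL yL vL ib hv ha hb.r132 hn da2 db2 db1 bn.symm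
    exact h1 h2
  by_cases c2 : a2 = b1
  · subst c2
    obtain ⟨W, -, -, h1, h2, -⟩ := A8xs hC aL yL vL ib hv ha hb hn da2 db1 db2 bn
    exact h1 h2
  obtain ⟨W, w0, w1, w2, w3, w4, w5, w6⟩ := A8xs hC aL yL vL ib hv ha hb hn da2 db1 db2 c1
  obtain ⟨W', w0', w1', w2', w3', w4', w5', w6'⟩ := A8xs hC aL yL vL ib hv ha hb.r132 hn da2 db2 db1 c2
  have key : ∀ x z, x ∈ W ∩ W' → z ∉ W ∩ W' → G.Adj x z → x = a2 ∧ z = a := by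
    intro x z h1 h2 h3
    rw [Finset.mem_inter] at h1 h2
    have h4 : z ∈ [a, v, b] := by
      by_contra h; exact h2 ⟨w6 x h1.1 z h h3, w6' x h1.2 z h h3⟩
    have h5 : x ∉ [a, v, b] := fun h => w5 x h h1.1
    have h6 := h3.symm
    simp only [List.mem_cons, List.not_mem_nil, or_false, not_or] at h4 h5
    rcases h4 with rfl | rfl | rfl
    · rw [e3] at h6
      rcases h6 with rfl | rfl | rfl
      · exact absurd rfl h5.2.1
      · exact absurd h1.1 w1
      · exact ⟨rfl, rfl⟩
    · rw [ev] at h6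
      rcases h6 with rfl | rfl
      · exact absurd rfl h5.1
      · exact absurd rfl h5.2.2
    · rw [e4] at h6
      rcases h6 with rfl | rfl | rfl
      · exact absurd rfl h5.2.1
      · exact absurd h1.1 w2
      · exact absurd h1.2 w2'
  refine nobridge g m (M := W ∩ W') (Finset.inter_subset_left.trans w0) (m := a2) (m' := a) (by simp [w3, w3'])
    (fun h => w5 a (by simp) (Finset.mem_inter.1 h).1) a2L aL f1'.symm ?_
  intro x y x' y' h1 h2 h3 h4 h5 h6
  have k1 := key x y h1 h2 h3
  have k2 := key x' y' h4 h5 h6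
  rw [k1.1, k1.2, k2.1, k2.2]; simp

/-- A degree two vertex of a minimal set is adjacent to the exit vertex, whose inner neighbours have degree two. -/
theorem deg2_x {U L : Finset V} {G : SimpleGraph V} (hC : Cx U L G) {v : V} (vL : v ∈ L) (dv : dg G v = 2) :
    ∃ x b y u, In G L b ∧ ¬ In G L x ∧ y ∉ L ∧ x ∈ L ∧ u ∈ L ∧ NL G v [x, b] ∧ NL G x [v, y, u] ∧ dg G u = 2 := by
  have ⟨g, ih, m, nb, n5⟩ := hC
  have key : ∀ a b, NL G v [a, b] → ¬ In G L a →
     ∃ x b y u, In G L b ∧ ¬ In G L x ∧ y ∉ L ∧ x ∈ L ∧ u ∈ L ∧ NL G v [x, b] ∧ NL G x [v, y, u] ∧ dg G u = 2 := by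
    intro a b hv hna
    obtain ⟨n1, dv, av, bv, ev⟩ := hv.f2
    have aL := (In_two g m vL hv).2 a av
    have bL := (In_two g m vL hv).2 b bv
    have ib : In G L b := (In_or m aL bL n1.2.2).resolve_left hna
    obtain ⟨y, hy, yL⟩ := nIn aL hna
    have da : dg G a = 3 := (g.dge av.symm).resolve_left (thread hC vL av dv)
    obtain ⟨u, ha⟩ := g.d32 av.symm hy (by rintro rfl; exact yL vL) da
    obtain ⟨e1, -, -, f1, f1', e3⟩ := ha.f3
    have uL : u ∈ L := by
      by_contra h; exact e1.2.2.2.2.2 (m.cut a y a u aL yL f1 aL h f1').2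
    refine ⟨a, b, y, u, ib, hna, yL, aL, uL, hv, ha, (g.dge f1'.symm).resolve_right (A8x hC aL yL vL hv ha)⟩
  have vU := m.sub vL
  obtain ⟨l, hl⟩ : ∃ a b, NL G v [a, b] := by
    obtain ⟨a, b, h⟩ | ⟨a, b, c, h⟩ := g.nl vU
    · exact ⟨a, b, h⟩
    · have := h.f3.2.1; omega
  obtain ⟨b, hl⟩ := hl
  by_cases ia : In G L l
  · by_cases ib : In G L b
    · exact (A8in hC ia ib hl).elim
    · exact key _ _ hl.r21 ib
  · exact key _ _ hl ia

theorem A9 {U L : Finset V} {G : SimpleGraph V} (hC : Cx U L G) {v x b y u u' f k : V} (ib : In G L b) (nx : ¬ In G L x) (yL : y ∉ L)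
    (xL : x ∈ L) (uL : u ∈ L) (hv : NL G v [x, b]) (hx : NL G x [v, y, u]) (du : dg G u = 2) (hu : NL G u [x, u'])
    (hb : NL G b [v, f, k]) (hfu : f ≠ u') : False := by
  have ⟨g, ih, m, nb, n5⟩ := hC
  obtain ⟨n1, dv, av, bv, ev⟩ := hv.f2
  obtain ⟨e1, dx, -, f1, f1', e3⟩ := hx.f3
  obtain ⟨e2, db, -, f2, f2', e4⟩ := hb.f3
  obtain ⟨e5, -, -, f3, e6⟩ := hu.f2
  have vL := ib.2 v bv.symm
  have iv := In_two g m vL hv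
  obtain ⟨df, dk⟩ := one2 hC ib hb dv
  have fL := ib.2 f f2
  have kL := ib.2 k f2'
  have fx : f ≠ x := by
    rintro rfl; exact T1 hC vL hv f2.symm
  have kx : k ≠ x := by
    rintro rfl; exact T1 hC vL hv f2'.symm
  have if' : In G L f := (In_or m fL xL fx).resolve_right nx
  obtain ⟨q1, q2, hf⟩ := g.d3 f2.symm df
  obtain ⟨e7, -, -, f4, f5, e8⟩ := hf.f3
  have two : ∀ w ∈ L, dg G w = 2 → w = v ∨ w = u := by
    intro w wL dw
    obtain ⟨x', _, _, _, -, h1, -, h2, -, h3, h4, -⟩ := deg2_x hC wL dw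
    have : x' = x := by by_contra h; exact (In_or m h2 xL h).elim h1 nx
    subst this
    have := (h3.adj (z := x') (by simp)).symm
    rw [e3] at this
    rcases this with rfl | rfl | rfl
    · exact Or.inl rfl
    · exact absurd wL yL
    · exact Or.inr rfl
  have qd : ∀ q, G.Adj f q → dg G q = 3 := by
    intro q hq
    refine (g.dge hq.symm).resolve_left (fun h => ?_)
    rcases two q (if'.2 q hq) h with rfl | rfl
    · have := hq.symm
      rw [ev] at this
      rcases this with rfl | rfl
      · exact fx rfl
      · exact hf.f3.1.1 rfl
    · have := hq.symm
      rw [e6] at this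
      rcases this with rfl | rfl
      · exact fx rfl
      · exact hfu rfl
  have dq1 := qd q1 f4
  have dq2 := qd q2 f5
  have hvf : ¬ G.Adj v f := by
    rw [ev]; rintro (h | h)
    · exact fx h
    · exact hf.f3.1.1 h
  have gq1 : k ≠ q1 := by
    rintro rfl; have := tri hC if' hf.r312 f2'; omega
  have gq2 : k ≠ q2 := by
    rintro rfl; have := tri hC if' hf.r213 f2'; omega
  have xf : ¬ G.Adj x f := by
    rw [e3]; rintro (rfl | rfl | rfl)
    · omega
    · exact yL fL
    · omega
  have xq : ∀ q, G.Adj f q → ¬ G.Adj x q := by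
    intro q hq h
    have := qd q hq
    rw [e3] at h
    rcases h with rfl | rfl | rfl
    · omega
    · exact yL (if'.2 _ hq)
    · omega
  have xq1 : x ≠ q1 := by rintro rfl; exact xf f4.symm
  have xq2 : x ≠ q2 := by rintro rfl; exact xf f5.symm
  -- core
  have core : ∀ q1 q2, NL G f [b, q1, q2] → k ≠ q1 → k ≠ q2 → x ≠ q1 → x ≠ q2 →
      (∀ W : Finset V, 2 ≤ cnt (· ∈ W) [x, k, q1, q2] → 2 ≤ cnt (· ∉ W) [x, k, q1, q2] →
        (∀ z w, z ∉ [v, b, f] → w ∉ [v, b, f] → G.Adj z w → (z ∈ W ↔ w ∈ W)) → (x ∈ W ↔ q1 ∈ W) → False) → False := by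
    intro q1 q2 hf gq1 gq2 xq1 xq2 hconn
    obtain ⟨e7, -, -, f4, f5, e8⟩ := hf.f3
    have dq1 := qd q1 f4
    have dq2 := qd q2 f5
    refine nb (P4L g ih m (a := v) (v := b) (b := f) (A := [x]) (C := [k]) (B := [q1, q2]) hv.r21 hb hf hvf iv ib if' x q1 (by simp) (by simp) xq1
      (xq q1 f4) (by simp) ?_ ?_)
    · have w1 := e7.2.2.2.2.2
      simp [cnt, nw, dq1, dq2, dk, dx, gq1, gq2, xq1, xq2, kx, gq1.symm, gq2.symm, xq1.symm, xq2.symm, kx.symm, w1, w1.symm]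
    · intro W w1 w2 w3 w4
      refine hconn W w1 w2 ?_ w4
      intro z w hz hw
      exact w3 z w (by rw [mem_VS]; simpa [vs, DP] using hz) (by rw [mem_VS]; simpa [vs, DP] using hw)
  have hnoW : ∀ W : Finset V, 2 ≤ cnt (· ∈ W) [x, k, q1, q2] → 2 ≤ cnt (· ∉ W) [x, k, q1, q2] →
        (∀ z w, z ∉ [v, b, f] → w ∉ [v, b, f] → G.Adj z w → (z ∈ W ↔ w ∈ W)) → False := by
    intro W w1 w2 w3
    have key : ∀ q1 q2, NL G f [b, q1, q2] → k ≠ q1 → k ≠ q2 → x ≠ q1 → x ≠ q2 → 2 ≤ cnt (· ∈ W) [x, k, q1, q2] →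
        2 ≤ cnt (· ∉ W) [x, k, q1, q2] → ¬ (x ∈ W ↔ q1 ∈ W) → False := by
      intro q1 q2 hf gq1 gq2 xq1 xq2 w1 w2 hno
      have hD := patch_DP (a := v) (v := b) (b := f) (A := [x]) (C := [k]) (B := [q1, q2]) hv.r21 hb hf hvf
      have hI : Int L (DP v b f [x] [k] [q1, q2]) := by
        apply int_of_In hD
        simp [DP, vs, iv, ib, if']
      have hhf : RD.hf (DP v b f [x] [k] [q1, q2]) = [x, k, q1, q2] := by rw [hf_DP]; simp
      have hVS : ∀ z, z ∈ VS (DP v b f [x] [k] [q1, q2]) ↔ z ∈ [v, b, f] := by intro z; rw [mem_VS]; simp [vs, DP]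
      refine core q1 q2 hf gq1 gq2 xq1 xq2 ?_
      intro W2 x1 x2 x3 x4
      have w3' : ∀ z w, z ∉ VS (DP v b f [x] [k] [q1, q2]) → w ∉ VS (DP v b f [x] [k] [q1, q2]) → G.Adj z w → (z ∈ W ↔ w ∈ W) := by
        intro z w; rw [hVS, hVS]; exact w3 z w
      have x3' : ∀ z w, z ∉ VS (DP v b f [x] [k] [q1, q2]) → w ∉ VS (DP v b f [x] [k] [q1, q2]) → G.Adj z w → (z ∈ W2 ↔ w ∈ W2) := by
        intro z w; rw [hVS, hVS]; exact x3 z w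
      by_cases h1 : x ∈ W
      · have h2 : q1 ∉ W := fun h => hno ⟨fun _ => h, fun _ => h1⟩
        refine cross g m hD hI (p := x) (q := q1) (r := k) (s := q2) (by simp [hhf]) (by simp [hhf]) ?_ ?_ (W := W) (W2 := W2)
          (by rwa [hhf]) (by rwa [hhf]) w3' h1 h2 (by rwa [hhf]) (by rwa [hhf]) x3' x4
        · intro W; rw [hhf]; simp only [cnt]; omega
        · intro W; rw [hhf]; simp only [cnt]; omega
      · have h2 : q1 ∈ W := by by_contra h; exact hno ⟨fun h' => absurd h' h1, fun h' => absurd h' h⟩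
        refine cross g m hD hI (p := q1) (q := x) (r := k) (s := q2) (by simp [hhf]) (by simp [hhf]) ?_ ?_ (W := W) (W2 := W2)
          (by rwa [hhf]) (by rwa [hhf]) w3' h2 h1 (by rwa [hhf]) (by rwa [hhf]) x3' x4.symm
        · intro W; rw [hhf]; simp only [cnt]; omega
        · intro W; rw [hhf]; simp only [cnt]; omega
    have k1 := key _ _ hf gq1 gq2 xq1 xq2 w1 w2
    have k2 := key _ _ hf.r132 gq2 gq1 xq2 xq1 (by simp only [cnt] at w1 ⊢; omega) (by simp only [cnt] at w2 ⊢; omega)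
    replace k1 := not_not.1 k1
    replace k2 := not_not.1 k2
    by_cases h : x ∈ W
    · have h1 := k1.1 h
      have h2 := k2.1 h
      simp [cnt, h, h1, h2] at w2
      split_ifs at w2 <;> omega
    · have h1 := fun h' => h (k1.2 h')
      have h2 := fun h' => h (k2.2 h')
      simp [cnt, h, h1, h2] at w1
      split_ifs at w1 <;> omega
  exact core q1 q2 hf gq1 gq2 xq1 xq2 (fun W w1 w2 w3 _ => hnoW W w1 w2 w3)

/-- No working context has a degree two vertex in the minimal set. -/
theorem A_all {U L : Finset V} {G : SimpleGraph V} (hC : Cx U L G) {v : V} (vL : v ∈ L) (dv : dg G v = 2) : False := by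
  have ⟨g, ih, m, nb, n5⟩ := hC
  obtain ⟨x, b, y, u, ib, nx, yL, xL, uL, hv, hx, du⟩ := deg2_x hC vL dv
  obtain ⟨n1, -, av, bv, ev⟩ := hv.f2
  have db : dg G b = 3 := (g.dge bv.symm).resolve_left (thread hC vL bv dv)
  obtain ⟨f, k, hb⟩ := g.d3 bv.symm db
  obtain ⟨u', hu⟩ := g.d2 (hx.adj (z := u) (by simp)).symm du
  by_cases h : f = u'
  · exact A9 hC ib nx yL xL uL hv hx du hu hb.r132 (by rw [← h]; exact hb.f3.1.2.2.2.2.2.symm)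
  · exact A9 hC ib nx yL xL uL hv hx du hu hb h

theorem claim2 {U L : Finset V} {G : SimpleGraph V} (g : Good U G) (ih : IH U) (m : MinL U G L) {v : V} (vL : v ∈ L) (dv : dg G v = 2) :
    Bd U G 4 ∨ (U.card = 5 ∧ wt G U = 25) := by
  by_contra h
  rw [not_or] at h
  exact A_all ⟨g, ih, m, h.1, h.2⟩ vL dv

theorem card5 {U : Finset V} {G : SimpleGraph V} (g : Good U G) (h5 : U.card = 5) (hw : wt G U = 25) : Bd U G 5 := by
  obtain ⟨a, aU⟩ := g.ne
  have key : ∀ a ∈ U, ∀ z, ∃ b, b ≠ z ∧ G.Adj a b := by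
    intro a aU z
    obtain ⟨c, d, h⟩ | ⟨c, d, e, h⟩ := g.nl aU
    · obtain ⟨n, -, h1, h2, -⟩ := h.f2
      by_cases hz : c = z
      · exact ⟨d, by rw [← hz]; exact n.2.2.symm, h2⟩
      · exact ⟨c, hz, h1⟩
    · obtain ⟨n, -, h1, h2, -⟩ := h.f3
      by_cases hz : c = z
      · exact ⟨d, by rw [← hz]; exact n.2.2.2.1.symm, h2⟩
      · exact ⟨c, hz, h1⟩
  obtain ⟨b, -, hab⟩ := key a aU a
  have bU := g.sub b a hab.symm
  have hne : a ≠ b := hab.ne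
  refine ⟨U \ {a, b}, ⟨Finset.sdiff_subset, ?_⟩, ?_⟩
  · have main : ∀ a ∈ U, ∀ b, G.Adj a b → (∃ u ∈ U \ {a, b}, G.Adj a u) ∧ (∃ u, u ∉ U \ {a, b} ∧ G.Adj a u) := by
      intro a aU b hab
      obtain ⟨c, h1, h2⟩ := key a aU b
      refine ⟨⟨c, ?_, h2⟩, b, by simp, hab⟩
      simp [g.sub c a h2.symm, h1, h2.ne.symm]
    intro v vU hv
    have : v = a ∨ v = b := by simpa [vU, or_iff_not_imp_left] using hv
    rcases this with rfl | rfl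
    · exact main _ aU _ hab
    · rw [Finset.pair_comm]; exact main _ bU _ hab.symm
  · have : (U \ {a, b}).card = 3 := by
      rw [Finset.card_sdiff_of_subset (by simp [Finset.insert_subset_iff, aU, bU]), Finset.card_pair hne, h5]
    rw [this, hw]; norm_num

theorem stepB {U : Finset V} {G : SimpleGraph V} (hG : Good U G) (ih : IH U) {D : Pt V} (hD : Patch G D) {p q : V}
    (hne : p ≠ q) (hp : p ∈ hf D) (hq : q ∈ hf D) (hpq : ¬ G.Adj p q)
    (hgood : Good (U \ VS D) (red G (VS D) p q))
    (hext : Ext G (VS D) p q 1) (hdrop : 7 ≤ drop D) {M : Finset V} (hM : MinL (U \ VS D) (red G (VS D) p q) M)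
    {z : V} (hz : z ∈ M) (dz : dg (red G (VS D) p q) z = 2)
    (hno : ¬ ((U \ VS D).card = 5 ∧ wt (red G (VS D) p q) (U \ VS D) = 25)) : Bd U G 5 := by
  have hlt := card_lt hG hD (List.ne_nil_of_mem hp)
  have ih' : IH (U \ VS D) := fun U' G' h => ih U' G' (h.trans hlt)
  have hb := (claim2 hgood ih' hM hz dz).resolve_right hno
  refine red_bd (hD.sub hG) (fun _ => ⟨hD.hf_mem hG hp, hD.hf_mem hG hq, hpq⟩) hext hb ?_
  rw [hD.drop hG, if_neg hne]
  push_cast; linarith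

theorem one_cnt {G : SimpleGraph V} {D : Pt V} (hD : Patch G D) {x z : V} (hx : x ∈ VS D)
    (hz : z ∉ VS D) (h : G.Adj x z) : 1 ≤ cnt (· = z) (hf D) := by
  rw [cnt_hf]
  exact cnt_pos _ (hD.hf_of_adj hx hz h) rfl

theorem Mpq {U : Finset V} {G : SimpleGraph V} (hG : Good U G) {D : Pt V} (hD : Patch G D) {p q : V}
    (hne : p ≠ q) (hp : p ∈ hf D) (hq : q ∈ hf D) (hpq : ¬ G.Adj p q) {M : Finset V} (hM : M ⊆ U \ VS D)
    (hc : cut1 (red G (VS D) p q) M) (h3 : ∀ z ∈ M, dg (red G (VS D) p q) z = 3) : (p ∈ M ∧ q ∈ M) ∨ cut1 G M := by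
  have hpX := (Finset.mem_sdiff.1 (hD.hf_mem hG hp)).2
  have hqX := (Finset.mem_sdiff.1 (hD.hf_mem hG hq)).2
  have hcnt : ∀ z ∈ M, cnt (· = z) (hf D) ≤ nw p q z := by
    intro z hz
    have hz' := Finset.mem_sdiff.1 (hM hz)
    have h1 := red_dg (G := G) (U := U) (p := p) (q := q) (fun _ => ⟨hpX, hqX, hpq⟩) hz'.2
    rw [hD.io hz'.2, h3 z hz] at h1
    have := hG.deg z hz'.1
    omega
  have hout : ∀ z ∈ M, z ∉ VS D := fun z hz => (Finset.mem_sdiff.1 (hM hz)).2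
  -- a half edge in M is at p or q
  have key : ∀ u ∈ M, ∀ w ∈ VS D, G.Adj u w → u = p ∨ u = q := by
    intro u hu w hw huw
    have h1 := one_cnt hD hw (hout u hu) huw.symm
    have h2 := hcnt u hu
    by_contra h
    have : nw p q u = 0 := by simp [nw]; tauto
    omega
  have side : ∀ p q, p ≠ q → p ∉ VS D → q ∉ VS D → ¬ G.Adj p q → cut1 (red G (VS D) p q) M → (∀ z ∈ M, cnt (· = z) (hf D) ≤ nw p q z) →
      (∀ u ∈ M, ∀ w ∈ VS D, G.Adj u w → u = p ∨ u = q) → p ∈ M → q ∉ M → cut1 G M := by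
    intro p q hne hpX hqX hpq hc hcnt key pM qM
    have k2 : ∀ u w, u ∈ M → w ∉ M → G.Adj u w → u = p ∧ w ∈ VS D := by
      intro u w hu hw huw
      by_cases hwX : w ∈ VS D
      · rcases key u hu w hwX huw with h | h
        · exact ⟨h, hwX⟩
        · exact absurd hu (h ▸ qM)
      · have := hc u w p q hu hw ⟨hout u hu, hwX, Or.inl huw⟩ pM qM ⟨hpX, hqX, Or.inr ⟨hne, Or.inl ⟨rfl, rfl⟩⟩⟩
        rw [this.1, this.2] at huw
        exact absurd huw hpq
    intro u w u' w' a1 a2 a3 a4 a5 a6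
    have k3 := k2 u w a1 a2 a3
    have k4 := k2 u' w' a4 a5 a6
    refine ⟨k3.1.trans k4.1.symm, ?_⟩
    by_contra hww
    have := hD.two (· = p) k3.2 (hout u a1) a3.symm k4.2 (hout u' a4) a6.symm (by tauto) k3.1 k4.1
    have h1 := hcnt p pM
    have : nw p q p ≤ 1 := by unfold nw; split_ifs <;> simp
    omega
  by_cases pM : p ∈ M <;> by_cases qM : q ∈ M
  · exact Or.inl ⟨pM, qM⟩
  · exact Or.inr (side p q hne hpX hqX hpq hc hcnt key pM qM)
  · right
    refine side q p hne.symm hqX hpX (fun h => hpq h.symm) ?_ ?_ (fun u hu w hw huw => (key u hu w hw huw).symm) qM pM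
    · have : red G (VS D) q p = red G (VS D) p q := by
        ext u w; simp only [red]
        constructor <;> rintro ⟨h1, h2, h3⟩ <;> refine ⟨h1, h2, h3.imp id ?_⟩ <;> rintro ⟨h4, h5⟩ <;> exact ⟨h4.symm, h5.symm⟩
      rw [this]; exact hc
    · intro z hz; have := hcnt z hz
      have h2 : nw q p z = nw p q z := by unfold nw; simp only [ne_comm, or_comm]
      omega
  · right
    intro u w u' w' a1 a2 a3 a4 a5 a6
    have k2 : ∀ u w, u ∈ M → w ∉ M → G.Adj u w → (red G (VS D) p q).Adj u w := by
      intro u w hu hw huw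
      refine ⟨hout u hu, fun hwX => ?_, Or.inl huw⟩
      rcases key u hu w hwX huw with h | h
      · exact pM (h ▸ hu)
      · exact qM (h ▸ hu)
    exact hc u w u' w' a1 a2 (k2 _ _ a1 a2 a3) a4 a5 (k2 _ _ a4 a5 a6)

theorem trif {U L : Finset V} {G : SimpleGraph V} (hC : Cx U L G) (h3 : ∀ z ∈ L, dg G z = 3) {a b c d : V} (ia : In G L a)
    (h : NL G a [d, b, c]) : ¬ G.Adj b c := by
  intro hbc
  have h1 := tri hC ia h hbc
  have h2 := h3 d (ia.2 d (h.adj (by simp)))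
  omega

theorem sideP {U L : Finset V} {G : SimpleGraph V} (g : Good U G) (m : MinL U G L) {x q r p q2 y r1 r2 : V}
    (hx : NL G x [q, y, p]) (hq : NL G q [x, r, q2]) (hr : NL G r [q, r1, r2]) (xL : x ∈ L) (qL : q ∈ L) (ir : In G L r) (yL : y ∉ L)
    {W : Finset V} (hW : W ⊆ L) (hWn : W.Nonempty) (hWX : ∀ z ∈ [x, q, r], z ∉ W)
    (hcl : ∀ u ∈ W, ∀ w, w ∉ [x, q, r] → G.Adj u w → w ∈ W) (h2 : q2 ∉ W) : p ∈ W := by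
  by_contra hp
  obtain ⟨n1, -, a1, a2, a3, e1⟩ := hx.f3
  obtain ⟨n2, -, b1, b2, b3, e2⟩ := hq.f3
  obtain ⟨n3, -, c1, c2, c3, e3⟩ := hr.f3
  have xW := hWX x (by simp)
  have qW := hWX q (by simp)
  have rW := hWX r (by simp)
  have key : ∀ u ∈ W, ∀ w, w ∉ W → G.Adj u w → w = r ∧ (u = r1 ∨ u = r2) := by
    intro u hu w hw huw
    have h : w ∈ [x, q, r] := by by_contra h; exact hw (hcl u hu w h huw)
    simp only [List.mem_cons, List.not_mem_nil, or_false] at h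
    have h' := huw.symm
    rcases h with rfl | rfl | rfl
    · rw [e1] at h'
      rcases h' with rfl | rfl | rfl
      · exact absurd hu qW
      · exact absurd (hW hu) yL
      · exact absurd hu hp
    · rw [e2] at h'
      rcases h' with rfl | rfl | rfl
      · exact absurd hu xW
      · exact absurd hu rW
      · exact absurd hu h2
    · rw [e3] at h'
      rcases h' with rfl | h | h
      · exact absurd hu qW
      · exact ⟨rfl, Or.inl h⟩
      · exact ⟨rfl, Or.inr h⟩
  have hWU := hW.trans m.sub
  have one : ∀ s t, G.Adj r s → s ∈ W → t ∉ W → (∀ u ∈ W, ∀ w, w ∉ W → G.Adj u w → w = r ∧ (u = s ∨ u = t)) → False := by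
    intro s t h1 h2 h3 h4
    refine nobridge g m hWU h2 rW (hW h2) ir.1 h1.symm ?_
    intro u w u' w' a1 a2 a3 a4 a5 a6
    have k1 := h4 u a1 w a2 a3
    have k2 := h4 u' a4 w' a5 a6
    grind
  by_cases h1 : r1 ∈ W <;> by_cases h2' : r2 ∈ W
  · refine nobridge g m (M := insert r W) (m := r) (m' := q) ?_ (by simp) ?_ ir.1 qL c1 ?_
    · simp [Finset.insert_subset_iff, m.sub ir.1, hWU]
    · simp [qW, n3.1.symm]
    · have k : ∀ u ∈ insert r W, ∀ w, w ∉ insert r W → G.Adj u w → u = r ∧ w = q := by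
        intro u hu w hw huw
        simp only [Finset.mem_insert, not_or] at hu hw
        rcases hu with rfl | hu
        · rw [e3] at huw
          rcases huw with rfl | rfl | rfl
          · exact ⟨rfl, rfl⟩
          · exact absurd h1 hw.2
          · exact absurd h2' hw.2
        · exact absurd (key u hu w hw.2 huw).1 hw.1
      intro u w u' w' a1 a2 a3 a4 a5 a6
      have k1 := k u a1 w a2 a3
      have k2 := k u' a4 w' a5 a6
      rw [k1.1, k1.2, k2.1, k2.2]; simp
  · exact one r1 r2 c2 h1 h2' key
  · exact one r2 r1 c3 h2' h1 (fun u hu w hw huw => ⟨(key u hu w hw huw).1, (key u hu w hw huw).2.symm⟩)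
  · have : W = U := by
      refine g.conn W hWU hWn (fun u hu w huw => ?_)
      by_contra hw
      rcases (key u hu w hw huw).2 with rfl | rfl
      · exact h1 hu
      · exact h2' hu
    exact xW (this ▸ m.sub xL)

/-- Obstruction to connectivity of `L` minus a path. -/
def Sp (G : SimpleGraph V) (L : Finset V) (x q r q2 : V) : Prop :=
  ∃ W ⊆ L, W.Nonempty ∧ (∀ z ∈ [x, q, r], z ∉ W) ∧ (∀ u ∈ W, ∀ w, w ∉ [x, q, r] → G.Adj u w → w ∈ W) ∧ q2 ∉ W

theorem notSp {U L : Finset V} {G : SimpleGraph V} (g : Good U G) (m : MinL U G L) {x q r p q2 y r1 r2 s1 s2 : V}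
    (hx : NL G x [q, y, p]) (hq : NL G q [x, r, q2]) (hr : NL G r [q, r1, r2]) (hq2 : NL G q2 [q, s1, s2])
    (xL : x ∈ L) (qL : q ∈ L) (ir : In G L r) (iq2 : In G L q2) (yL : y ∉ L)
    (h1 : Sp G L x q r q2) (h2 : Sp G L x q q2 r) : False := by
  obtain ⟨W, w1, w2, w3, w4, w5⟩ := h1
  obtain ⟨Z, z1, z2, z3, z4, z5⟩ := h2
  have pW := sideP g m hx hq hr xL qL ir yL w1 w2 w3 w4 w5
  have pZ := sideP g m hx hq.r132 hq2 xL qL iq2 yL z1 z2 z3 z4 z5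
  obtain ⟨n1, -, a1, a2, a3, e1⟩ := hx.f3
  obtain ⟨n2, -, b1, b2, b3, e2⟩ := hq.f3
  obtain ⟨n3, -, c1, c2, c3, e3⟩ := hr.f3
  have key : ∀ u ∈ W ∩ Z, ∀ w, w ∉ W ∩ Z → G.Adj u w → u = p ∧ w = x := by
    intro u hu w hw huw
    rw [Finset.mem_inter] at hu hw
    have xW := w3 x (by simp)
    have qW := w3 q (by simp)
    have rW := w3 r (by simp)
    have h' := huw.symm
    by_cases hx1 : w = x
    · subst hx1
      rw [e1] at h'
      rcases h' with rfl | rfl | rfl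
      · exact absurd hu.1 qW
      · exact absurd (w1 hu.1) yL
      · exact ⟨rfl, rfl⟩
    by_cases hq1 : w = q
    · subst hq1
      rw [e2] at h'
      rcases h' with rfl | rfl | rfl
      · exact absurd hu.1 xW
      · exact absurd hu.1 rW
      · exact absurd hu.1 w5
    by_cases hr1 : w = r
    · subst hr1
      exact absurd (z4 u hu.2 w (by simp [hx1, hq1, n2.2.2.2.2.2]) huw) z5
    have hwW := w4 u hu.1 w (by simp [hx1, hq1, hr1]) huw
    have hwq : w ≠ q2 := by rintro rfl; exact w5 hwW
    exact absurd ⟨hwW, z4 u hu.2 w (by simp [hx1, hq1, hwq]) huw⟩ hw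
  refine nobridge g m (M := W ∩ Z) (Finset.inter_subset_left.trans (w1.trans m.sub)) (m := p) (m' := x) (by simp [pW, pZ]) ?_
    (w1 pW) xL a3.symm ?_
  · intro h; exact w3 x (by simp) (Finset.mem_inter.1 h).1
  intro u w u' w' a1 a2 a3 a4 a5 a6
  have k1 := key u a1 w a2 a3
  have k2 := key u' a4 w' a5 a6
  rw [k1.1, k1.2, k2.1, k2.2]; simp

theorem lobe0 {U L : Finset V} {G : SimpleGraph V} (hC : Cx U L G) (h3 : ∀ z ∈ L, dg G z = 3)
    {x q r p q2 y r1 r2 : V}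
    (hx : NL G x [q, y, p]) (hq : NL G q [x, r, q2]) (hr : NL G r [q, r1, r2])
    (xL : x ∈ L) (iq : In G L q) (ir : In G L r) (yL : y ∉ L) (h2p : r2 ≠ p)
    (hS : ¬ Sp G L x q r q2) : Bd U G 5 := by
  have g := hC.g
  have m := hC.m
  obtain ⟨n1, -, a1, a2, a3, e1⟩ := hx.f3
  obtain ⟨n2, -, b1, b2, b3, e2⟩ := hq.f3
  obtain ⟨n3, -, c1, c2, c3, e3⟩ := hr.f3
  have hxr : ¬ G.Adj x r := trif hC h3 iq hq.r312
  have hxq2 : ¬ G.Adj x q2 := trif hC h3 iq hq.r213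
  have hrq2 : ¬ G.Adj r q2 := trif hC h3 iq hq
  have exit : ∀ u v, u ∈ L → v ∉ L → G.Adj u v → u = x ∧ v = y := fun u v hu hv h => m.cut u v x y hu hv h xL yL a2
  have qL := iq.1
  have rL := ir.1
  have r1L := ir.2 _ c2
  have r2L := ir.2 _ c3
  have q2L := iq.2 _ b3
  have pL : p ∈ L := by
    by_contra h; exact n1.2.2.2.2.2 (exit x p xL h a3).2.symm
  have yr1 : ¬ G.Adj y r1 := fun h => by
    have := (exit r1 y r1L yL h.symm).1
    rw [this] at c2; exact hxr c2.symm
  have hne : y ≠ r1 := by rintro rfl; exact yL r1L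
  have hyp : y ≠ p := n1.2.2.2.2.2
  have hyr2 : y ≠ r2 := by rintro rfl; exact yL r2L
  have hyq2 : y ≠ q2 := by rintro rfl; exact yL q2L
  have hpq2 : p ≠ q2 := by rintro rfl; exact hxq2 a3
  have h12 : q2 ≠ r1 := by rintro rfl; exact hrq2 c2
  have h22 : q2 ≠ r2 := by rintro rfl; exact hrq2 c3
  have hrr : r1 ≠ r2 := n3.2.2.2.2.2
  have hD := patch_DP (A := [y, p]) (C := [q2]) (B := [r1, r2]) hx hq hr hxr
  have hhf := hf_DP x q r [y, p] [q2] [r1, r2]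
  set D := DP x q r [y, p] [q2] [r1, r2] with hDd
  have hVS : ∀ z, z ∈ VS D ↔ z = x ∨ z = q ∨ z = r := by
    intro z; rw [mem_VS]; simp [vs, hDd, DP]; try grind
  have VL : ∀ z ∈ VS D, z ∈ L := by
    intro z hz; rcases (hVS z).1 hz with rfl | rfl | rfl <;> assumption
  have hp : y ∈ hf D := by rw [hhf]; simp
  have hq' : r1 ∈ hf D := by rw [hhf]; simp
  have hX : ∀ z ∈ hf D, z ∈ U \ VS D := fun z hz => hD.hf_mem g hz
  have noW : ∀ W ⊆ U \ VS D, W.Nonempty → (∀ u ∈ W, ∀ v, v ∉ VS D → G.Adj u v → v ∈ W) → y ∉ W → r1 ∉ W → False := by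
    intro W hW hWn hcl yW rW
    have out : ∀ z ∈ W, z ∉ VS D := fun z hz => (Finset.mem_sdiff.1 (hW hz)).2
    have hWL : W ⊆ L := by
      intro z hz
      by_contra hzL
      have : W \ L = U := by
        refine g.conn _ (Finset.sdiff_subset.trans (hW.trans Finset.sdiff_subset)) ⟨z, by simp [hz, hzL]⟩ ?_
        intro u hu v huv
        rw [Finset.mem_sdiff] at hu ⊢
        have vL : v ∉ L := by
          intro vL
          have := (exit v u vL hu.2 huv.symm).2
          exact yW (this ▸ hu.1)
        exact ⟨hcl u hu.1 v (fun h => vL (VL v h)) huv, vL⟩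
      have h1 : x ∈ W \ L := by rw [this]; exact m.sub xL
      exact (Finset.mem_sdiff.1 h1).2 xL
    have hcl' : ∀ u ∈ W, ∀ w, w ∉ [x, q, r] → G.Adj u w → w ∈ W := by
      intro u hu w hw huw
      exact hcl u hu w (by rw [hVS]; simpa using hw) huw
    have q2W : q2 ∈ W := by
      by_contra h
      refine hS ⟨W, hWL, hWn, ?_, hcl', h⟩
      intro z hz hzW
      exact out z hzW ((hVS z).2 (by simpa using hz))
    refine hS ⟨(L \ VS D) \ W, Finset.sdiff_subset.trans Finset.sdiff_subset, ⟨r1, ?_⟩, ?_, ?_, ?_⟩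
    · have := (Finset.mem_sdiff.1 (hX r1 hq')).2
      simp [r1L, this, rW]
    · intro z hz h
      have : z ∈ VS D := (hVS z).2 (by simpa using hz)
      simp [this] at h
    · intro u hu w hw huw
      simp only [Finset.mem_sdiff] at hu ⊢
      have hwV : w ∉ VS D := by rw [hVS]; simpa using hw
      refine ⟨⟨?_, hwV⟩, fun h => hu.2 (hcl w h u hu.1.2 huw.symm)⟩
      by_contra hwL
      have := (exit u w hu.1.1 hwL huw).1
      exact hu.1.2 ((hVS u).2 (Or.inl this))
    · simp [q2W]
  have hgood : Good (U \ VS D) (red G (VS D) y r1) := by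
    refine Patch.good g hD (List.ne_nil_of_mem hp) y r1 (fun _ => ⟨hp, hq', yr1⟩) ?_ ?_
    · intro z hz
      have dz : 2 ≤ dg G z := by
        have := g.deg z (Finset.mem_sdiff.1 (hX z hz)).1; omega
      have dz3 : z ∈ L → dg G z = 3 := h3 z
      rw [hhf] at hz ⊢
      simp only [List.cons_append, List.nil_append, List.mem_cons, List.not_mem_nil, or_false] at hz
      simp only [List.cons_append, List.nil_append, cnt, nw]
      rcases hz with rfl | rfl | rfl | rfl | rfl
      · simp [hne, hne.symm, hyp.symm, hyr2.symm, hyq2.symm]; omega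
      · have := dz3 pL
        by_cases h : z = r1
        · subst h; simp [hne, hyp, hpq2.symm, hrr.symm, this]
        · simp [hne, hyp, hpq2.symm, h, Ne.symm h, h2p, this]
      · have := dz3 q2L
        simp [hne, hyq2, hpq2, h12.symm, h22.symm, this]
      · have := dz3 r1L
        by_cases h : p = z
        · subst h; simp [hne, hyp, hpq2.symm, hrr.symm, this, h12]
        · simp [hne, h12, h, hrr.symm, this]
      · have := dz3 r2L
        simp [hyr2, h2p.symm, h22, hrr, this]
    · intro W hW hWn hWp hcl hiff
      have hiff := hiff hne
      by_cases yW : y ∈ W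
      · refine noW ((U \ VS D) \ W) Finset.sdiff_subset ?_ ?_ (by simp [yW]) (by simp [hiff.1 yW])
        · rw [Finset.sdiff_nonempty]; intro h; exact hWp (Finset.Subset.antisymm hW h)
        · intro u hu v hv huv
          rw [Finset.mem_sdiff, Finset.mem_sdiff] at hu ⊢
          exact ⟨⟨g.sub v u huv.symm, hv⟩, fun h => hu.2 (hcl v h u hu.1.2 huv.symm)⟩
      · exact noW W hW hWn hcl yW (fun h => yW (hiff.2 h))
  have hc : cut1 (red G (VS D) y r1) (L \ VS D) := by
    have key : ∀ u v, u ∈ L \ VS D → v ∉ L \ VS D → (red G (VS D) y r1).Adj u v → u = r1 ∧ v = y := by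
      rintro u v hu hv ⟨k1, k2, k3⟩
      have vL : v ∉ L := fun h => hv (by simp [h, k2])
      have uL := (Finset.mem_sdiff.1 hu).1
      rcases k3 with h | ⟨-, ⟨h, h'⟩ | h⟩
      · exact absurd ((hVS u).2 (Or.inl (exit u v uL vL h).1)) k1
      · exact absurd (h ▸ uL) yL
      · exact h
    intro u v u' v' d1 d2 d3 d4 d5 d6
    have := key u v d1 d2 d3
    have := key u' v' d4 d5 d6
    grind
  have pX := hX p (by rw [hhf]; simp)
  have q2X := hX q2 (by rw [hhf]; simp)
  have r2X := hX r2 (by rw [hhf]; simp)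
  have yX := hX y hp
  obtain ⟨M, hML, hM⟩ := exists_minL (U := U \ VS D) (L \ VS D) (Finset.sdiff_subset_sdiff m.sub (le_refl _))
    ⟨p, by simp [pL, (Finset.mem_sdiff.1 pX).2]⟩ hc
  have hext : Ext G (VS D) y r1 1 := ext_DP hx hq hr hxr (by simp) (by simp) (fun _ => by simp)
  have hdrop : 7 ≤ drop D := by simp [hDd, DP, drop]
  by_cases hz : ∃ z ∈ M, dg (red G (VS D) y r1) z = 2
  · obtain ⟨z, zM, dz⟩ := hz
    refine stepB g hC.ih hD hne hp hq' yr1 hgood hext hdrop hM zM dz ?_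
    rintro ⟨h5, -⟩
    have step1 : ∀ a ∈ U, ∀ z, ∃ b, b ≠ z ∧ G.Adj a b := by
      intro a aU z
      obtain ⟨c, d, h⟩ | ⟨c, d, e, h⟩ := g.nl aU
      · obtain ⟨n, -, h1, h2, -⟩ := h.f2
        by_cases hz : c = z
        · exact ⟨d, by rw [← hz]; exact n.2.2.symm, h2⟩
        · exact ⟨c, hz, h1⟩
      · obtain ⟨n, -, h1, h2, -⟩ := h.f3
        by_cases hz : c = z
        · exact ⟨d, by rw [← hz]; exact n.2.2.2.1.symm, h2⟩
        · exact ⟨c, hz, h1⟩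
    obtain ⟨y1, hy1, ay1⟩ := step1 y (Finset.mem_sdiff.1 yX).1 x
    have y1U := g.sub y1 y ay1.symm
    have y1L : y1 ∉ L := fun h => hy1 (exit y1 y h yL ay1.symm).1
    obtain ⟨y2, hy2, ay2⟩ := step1 y1 y1U y
    have y2U := g.sub y2 y1 ay2.symm
    have y2L : y2 ∉ L := fun h => ay1.ne (exit y2 y1 h y1L ay2.symm).2.symm
    have hsub : ({y, y1, y2, p, q2, r2} : Finset V) ⊆ U \ VS D := by
      have k1 : y1 ∈ U \ VS D := Finset.mem_sdiff.2 ⟨y1U, fun h => y1L (VL _ h)⟩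
      have k2 : y2 ∈ U \ VS D := Finset.mem_sdiff.2 ⟨y2U, fun h => y2L (VL _ h)⟩
      simp only [Finset.insert_subset_iff, Finset.singleton_subset_iff]
      exact ⟨yX, k1, k2, pX, q2X, r2X⟩
    have h6 : ({y, y1, y2, p, q2, r2} : Finset V).card = 6 := by
      have k1 := ay1.ne
      have k2 := ay2.ne
      have f1 : y1 ≠ p := by rintro rfl; exact y1L pL
      have f2 : y1 ≠ q2 := by rintro rfl; exact y1L q2L
      have f3 : y1 ≠ r2 := by rintro rfl; exact y1L r2L
      have f4 : y2 ≠ p := by rintro rfl; exact y2L pL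
      have f5 : y2 ≠ q2 := by rintro rfl; exact y2L q2L
      have f6 : y2 ≠ r2 := by rintro rfl; exact y2L r2L
      repeat rw [Finset.card_insert_of_notMem]
      · simp
      · simp [h22]
      · simp [hpq2, h2p.symm]
      · simp [f4, f5, f6]
      · simp [k2, f1, f2, f3]
      · simp [k1, hy2.symm, hyp, hyq2, hyr2]
    have := Finset.card_le_card hsub
    omega
  · exfalso
    push_neg at hz
    have h3M : ∀ z ∈ M, dg (red G (VS D) y r1) z = 3 := fun z hzM =>
      (hgood.deg z (hM.sub hzM)).resolve_left (hz z hzM)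
    rcases Mpq g hD hne hp hq' yr1 hM.sub hM.cut h3M with h | h
    · exact yL (Finset.mem_sdiff.1 (hML h.1)).1
    · refine m.min M (hML.trans Finset.sdiff_subset) hM.ne ?_ h
      rintro rfl
      exact (Finset.mem_sdiff.1 (hML xL)).2 ((hVS x).2 (Or.inl rfl))

theorem lobe1 {U L : Finset V} {G : SimpleGraph V} (hC : Cx U L G) (h3 : ∀ z ∈ L, dg G z = 3)
    {x q r p q2 y : V}
    (hx : NL G x [q, y, p]) (hq : NL G q [x, r, q2])
    (xL : x ∈ L) (iq : In G L q) (ir : In G L r) (yL : y ∉ L)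
    (hS : ¬ Sp G L x q r q2) : Bd U G 5 := by
  obtain ⟨r1, r2, hr⟩ := hC.g.d3 (hq.adj (by simp)).symm (h3 r ir.1)
  by_cases h : r2 = p
  · refine lobe0 hC h3 hx hq hr.r132 xL iq ir yL ?_ hS
    rw [← h]; exact hr.f3.1.2.2.2.2.2
  · exact lobe0 hC h3 hx hq hr xL iq ir yL h hS

theorem lobe {U L : Finset V} {G : SimpleGraph V} (hC : Cx U L G) (h3 : ∀ z ∈ L, dg G z = 3)
    {x : V} (xL : x ∈ L) (hx : ¬ In G L x) : Bd U G 5 := by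
  have g := hC.g
  have m := hC.m
  obtain ⟨y, ay, yL⟩ := nIn xL hx
  obtain ⟨p, q, hn⟩ := g.d3 ay (h3 x xL)
  obtain ⟨n1, -, a1, a2, a3, e1⟩ := hn.f3
  have inL : ∀ z, z ∈ L → z ≠ x → In G L z := by
    intro z hz hzx
    by_contra h
    obtain ⟨w, aw, wL⟩ := nIn hz h
    exact hzx (m.cut z w x y hz wL aw xL yL ay).1
  have qL : q ∈ L := by
    by_contra h
    exact n1.2.2.2.2.1 (m.cut x q x y xL h a3 xL yL ay).2.symm
  have iq := inL q qL a3.ne.symm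
  obtain ⟨r, q2, hq⟩ := g.d3 a3.symm (h3 q qL)
  obtain ⟨n2, -, b1, b2, b3, e2⟩ := hq.f3
  have ir := inL r (iq.2 r b2) n2.2.2.2.1.symm
  have iq2 := inL q2 (iq.2 q2 b3) n2.2.2.2.2.1.symm
  by_cases h1 : Sp G L x q r q2
  · by_cases h2 : Sp G L x q q2 r
    · obtain ⟨r1, r2, hr⟩ := g.d3 b2.symm (h3 r ir.1)
      obtain ⟨s1, s2, hs⟩ := g.d3 b3.symm (h3 q2 iq2.1)
      exact (notSp g m hn.r312 hq hr hs xL qL ir iq2 yL h1 h2).elim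
    · exact lobe1 hC h3 hn.r312 hq.r132 xL iq iq2 yL h2
  · exact lobe1 hC h3 hn.r312 hq xL iq ir yL h1

theorem closed0 {U : Finset V} {G : SimpleGraph V} (hC : Cx U U G) (h3 : ∀ z ∈ U, dg G z = 3)
    {a v b c a1 a2 b1 b2 : V} (ha : NL G a [v, a1, a2]) (hv : NL G v [a, b, c]) (hb : NL G b [v, b1, b2])
    (hab : ¬ G.Adj a b) (hac : ¬ G.Adj a c) (hbc : ¬ G.Adj b c)
    (e1 : a1 ≠ b1) (e2 : a2 ≠ b2) (na : ¬ G.Adj a1 b1)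
    (hconn : ∀ W ⊆ U \ VS (DP a v b [a1, a2] [c] [b1, b2]), W.Nonempty → W ≠ U \ VS (DP a v b [a1, a2] [c] [b1, b2]) →
      (∀ u ∈ W, ∀ z, z ∉ VS (DP a v b [a1, a2] [c] [b1, b2]) → G.Adj u z → z ∈ W) → (a1 ∈ W ↔ b1 ∈ W) → False) : Bd U G 5 := by
  have g := hC.g
  have m := hC.m
  obtain ⟨n1, -, p1, p2, p3, -⟩ := ha.f3
  obtain ⟨n2, -, q1, q2, q3, -⟩ := hv.f3
  obtain ⟨n3, -, r1, r2, r3, -⟩ := hb.f3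
  have hD := patch_DP (A := [a1, a2]) (C := [c]) (B := [b1, b2]) ha hv hb hab
  have hhf := hf_DP a v b [a1, a2] [c] [b1, b2]
  have hext : Ext G (VS (DP a v b [a1, a2] [c] [b1, b2])) a1 b1 1 := ext_DP ha hv hb hab (by simp) (by simp) (fun _ => by simp)
  have hdrop : drop (DP a v b [a1, a2] [c] [b1, b2]) = 7 := by simp [DP, drop]
  have hVS := VS_DP a v b [a1, a2] [c] [b1, b2]
  have hcard : (VS (DP a v b [a1, a2] [c] [b1, b2])).card = 3 := by
    have : VS (DP a v b [a1, a2] [c] [b1, b2]) = {a, v, b} := by ext z; rw [hVS]; simp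
    rw [this, Finset.card_insert_of_notMem (by simp [n1.1, n2.2.2.2.1]), Finset.card_pair n2.2.1]
  generalize DP a v b [a1, a2] [c] [b1, b2] = D at *
  have hp : a1 ∈ hf D := by rw [hhf]; simp
  have hq : b1 ∈ hf D := by rw [hhf]; simp
  have hX : ∀ z ∈ hf D, z ∈ U \ VS D := fun z hz => hD.hf_mem g hz
  have c1 : c ≠ a1 := by rintro rfl; exact hac p2
  have c2 : c ≠ a2 := by rintro rfl; exact hac p3
  have c3 : c ≠ b1 := by rintro rfl; exact hbc r2
  have c4 : c ≠ b2 := by rintro rfl; exact hbc r3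
  have aa : a1 ≠ a2 := n1.2.2.2.2.2
  have bb : b1 ≠ b2 := n3.2.2.2.2.2
  have cX := hX c (by rw [hhf]; simp)
  have hgood : Good (U \ VS D) (red G (VS D) a1 b1) := by
    refine Patch.good g hD (List.ne_nil_of_mem hp) a1 b1 (fun _ => ⟨hp, hq, na⟩) ?_ ?_
    · intro z hz
      rw [h3 z (Finset.mem_sdiff.1 (hX z hz)).1]
      rw [hhf] at hz ⊢
      simp only [List.cons_append, List.nil_append, List.mem_cons, List.not_mem_nil, or_false] at hz
      simp only [List.cons_append, List.nil_append, cnt, nw]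
      clear hconn
      split_ifs <;> grind
    · intro W w1 w2 w3 w4 w5
      exact hconn W w1 w2 w3 w4 (w5 e1)
  have hno : ¬ ((U \ VS D).card = 5 ∧ wt (red G (VS D) a1 b1) (U \ VS D) = 25) := by
    rintro ⟨k1, k2⟩
    have h8 : U.card = 8 := by
      rw [Finset.card_sdiff_of_subset (hD.sub g), hcard] at k1; omega
    have hw : wt G U = 32 := by
      unfold wt
      rw [Finset.sum_congr rfl (g := fun _ => (4 : ℤ)) (fun z hz => by rw [h3 z hz]; norm_num)]
      simp [h8]
    rw [red_wt (hD.sub g) (fun _ => ⟨hX _ hp, hX _ hq, na⟩), hD.drop g, if_neg e1, hw, hdrop] at k2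
    norm_num at k2
  have vV : v ∈ VS D := (hVS v).2 (by simp)
  have fin : ∀ M, MinL (U \ VS D) (red G (VS D) a1 b1) M → (a1 ∈ M ∧ b1 ∈ M → Bd U G 5) → Bd U G 5 := by
    intro M hM hh
    by_cases hz : ∃ z ∈ M, dg (red G (VS D) a1 b1) z = 2
    · obtain ⟨z, zM, dz⟩ := hz
      exact stepB g hC.ih hD e1 hp hq na hgood hext hdrop.ge hM zM dz hno
    · push Not at hz
      have h3M : ∀ z ∈ M, dg (red G (VS D) a1 b1) z = 3 := fun z hzM =>
        (hgood.deg z (hM.sub hzM)).resolve_left (hz z hzM)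
      rcases Mpq g hD e1 hp hq na hM.sub hM.cut h3M with h | h
      · exact hh h
      · refine (m.min M (hM.sub.trans Finset.sdiff_subset) hM.ne ?_ h).elim
        rintro rfl
        exact (Finset.mem_sdiff.1 (hM.sub (m.sub (g.sub v a q1)))).2 vV
  obtain ⟨M, -, hM⟩ := exists_minL (U := U \ VS D) (G := red G (VS D) a1 b1) (U \ VS D) (le_refl _) hgood.ne
    (fun u w u' w' d1 d2 d3 => absurd (hgood.sub w u d3.symm) d2)
  by_cases hz : ∃ z ∈ M, dg (red G (VS D) a1 b1) z = 2
  · obtain ⟨z, zM, dz⟩ := hz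
    exact stepB g hC.ih hD e1 hp hq na hgood hext hdrop.ge hM zM dz hno
  refine fin M hM (fun hpq => ?_)
  have cM : c ∉ M := by
    intro h
    refine hz ⟨c, h, ?_⟩
    have h1 := red_dg (G := G) (U := U) (p := a1) (q := b1)
      (fun _ => ⟨(Finset.mem_sdiff.1 (hX _ hp)).2, (Finset.mem_sdiff.1 (hX _ hq)).2, na⟩) (Finset.mem_sdiff.1 cX).2
    rw [hD.io (Finset.mem_sdiff.1 cX).2, h3 c (Finset.mem_sdiff.1 cX).1, hhf] at h1
    simp [cnt, nw, c1, c2, c3, c4, c1.symm, c2.symm, c3.symm, c4.symm] at h1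
    omega
  obtain ⟨M2, hM2, hM2'⟩ := exists_minL (U := U \ VS D) (G := red G (VS D) a1 b1) ((U \ VS D) \ M) Finset.sdiff_subset
    ⟨c, Finset.mem_sdiff.2 ⟨cX, cM⟩⟩ (by
      have key : ∀ u w, u ∈ (U \ VS D) \ M → w ∉ (U \ VS D) \ M → (red G (VS D) a1 b1).Adj u w → u ∉ M ∧ w ∈ M := by
        intro u w hu hw huw
        refine ⟨(Finset.mem_sdiff.1 hu).2, ?_⟩
        by_contra h
        exact hw (Finset.mem_sdiff.2 ⟨hgood.sub w u huw.symm, h⟩)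
      intro u w u' w' d1 d2 d3 d4 d5 d6
      have k1 := key u w d1 d2 d3
      have k2 := key u' w' d4 d5 d6
      exact (hM.cut w u w' u' k1.2 k1.1 d3.symm k2.2 k2.1 d6.symm).symm)
  exact fin M2 hM2' (fun h => absurd hpq.1 (Finset.mem_sdiff.1 (hM2 h.1)).2)

theorem closed1 {U : Finset V} {G : SimpleGraph V} (hC : Cx U U G) (h3 : ∀ z ∈ U, dg G z = 3)
    {a v b c a1 a2 b1 b2 : V} (ha : NL G a [v, a1, a2]) (hv : NL G v [a, b, c]) (hb : NL G b [v, b1, b2])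
    (hab : ¬ G.Adj a b) (hac : ¬ G.Adj a c) (hbc : ¬ G.Adj b c)
    {W : Finset V} (hW : ∀ u z, u ∉ VS (DP a v b [a1, a2] [c] [b1, b2]) → z ∉ VS (DP a v b [a1, a2] [c] [b1, b2]) → G.Adj u z → (u ∈ W ↔ z ∈ W))
    (hs : ¬ (a1 ∈ W ↔ b1 ∈ W)) (e2 : a2 ≠ b2) : Bd U G 5 := by
  have g := hC.g
  have m := hC.m
  have hD := patch_DP (A := [a1, a2]) (C := [c]) (B := [b1, b2]) ha hv hb hab
  have hhf := hf_DP a v b [a1, a2] [c] [b1, b2]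
  have hp : a1 ∈ hf (DP a v b [a1, a2] [c] [b1, b2]) := by rw [hhf]; simp
  have hq : b1 ∈ hf (DP a v b [a1, a2] [c] [b1, b2]) := by rw [hhf]; simp
  have pX := hD.hf_mem g hp
  have qX := hD.hf_mem g hq
  refine closed0 hC h3 ha hv hb hab hac hbc (by rintro rfl; exact hs Iff.rfl) e2
    (fun h => hs (hW _ _ (Finset.mem_sdiff.1 pX).2 (Finset.mem_sdiff.1 qX).2 h)) ?_
  have hI : Int U (DP a v b [a1, a2] [c] [b1, b2]) :=
    ⟨fun z hz => hD.sub g (mem_VS.2 hz), fun z hz => (Finset.mem_sdiff.1 (hD.hf_mem g hz)).1⟩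
  have hn : DP a v b [a1, a2] [c] [b1, b2] ≠ [] := by simp [DP]
  have hlen : (hf (DP a v b [a1, a2] [c] [b1, b2])).length = 5 := by rw [hhf]; simp
  generalize DP a v b [a1, a2] [c] [b1, b2] = D at *
  have main : ∀ T ⊆ U \ VS D, T.Nonempty → T ≠ U \ VS D → (∀ u ∈ T, ∀ z, z ∉ VS D → G.Adj u z → z ∈ T) → a1 ∈ T → b1 ∈ T → False := by
    intro T t1 t2 t3 t4 t5 t6
    have out : ∀ z ∈ T, z ∉ VS D := fun z hz => (Finset.mem_sdiff.1 (t1 hz)).2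
    have k1 : 2 ≤ cnt (· ∈ T ∩ W) (hf D) := by
      refine (CL g m hD hI hn (W := T ∩ W) (Finset.inter_subset_left.trans t1) ?_ ?_ ?_).1
      · by_cases h : a1 ∈ W
        · exact ⟨a1, by simp [t5, h]⟩
        · exact ⟨b1, by simp [t6]; tauto⟩
      · intro h
        rw [← h] at pX qX
        simp only [Finset.mem_inter] at pX qX
        tauto
      · intro u hu z hz huz
        rw [Finset.mem_inter] at hu ⊢
        exact ⟨t4 u hu.1 z hz huz, (hW u z (out u hu.1) hz huz).1 hu.2⟩
    have k2 : 2 ≤ cnt (· ∈ T \ W) (hf D) := by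
      refine (CL g m hD hI hn (W := T \ W) (Finset.sdiff_subset.trans t1) ?_ ?_ ?_).1
      · by_cases h : a1 ∈ W
        · exact ⟨b1, by simp [t6]; tauto⟩
        · exact ⟨a1, by simp [t5, h]⟩
      · intro h
        rw [← h] at pX qX
        simp only [Finset.mem_sdiff] at pX qX
        tauto
      · intro u hu z hz huz
        rw [Finset.mem_sdiff] at hu ⊢
        exact ⟨t4 u hu.1 z hz huz, fun h => hu.2 ((hW u z (out u hu.1) hz huz).2 h)⟩
    have k3 := (CL g m hD hI hn t1 t2 t3 t4).2
    have : ∀ l : List V, cnt (· ∈ T ∩ W) l + cnt (· ∈ T \ W) l + cnt (· ∉ T) l = l.length := by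
      intro l
      induction l with
      | nil => rfl
      | cons z l ih =>
        simp only [cnt, List.length_cons, ← ih, Finset.mem_inter, Finset.mem_sdiff]
        by_cases h1 : z ∈ T <;> by_cases h2 : z ∈ W <;> simp [h1, h2] <;> omega
    have := this (hf D)
    omega
  intro T t1 t2 t3 t4 t5
  by_cases h : a1 ∈ T
  · exact main T t1 t2 t3 t4 h (t5.1 h)
  · refine main ((U \ VS D) \ T) Finset.sdiff_subset ?_ ?_ ?_ (Finset.mem_sdiff.2 ⟨pX, h⟩) (Finset.mem_sdiff.2 ⟨qX, fun h' => h (t5.2 h')⟩)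
    · exact ⟨a1, Finset.mem_sdiff.2 ⟨pX, h⟩⟩
    · intro h'
      obtain ⟨z, hz⟩ := t2
      have := t1 hz
      rw [← h'] at this
      exact (Finset.mem_sdiff.1 this).2 hz
    · intro u hu z hz huz
      rw [Finset.mem_sdiff, Finset.mem_sdiff] at hu ⊢
      exact ⟨⟨g.sub z u huz.symm, hz⟩, fun h => hu.2 (t4 z h u hu.1.2 huz.symm)⟩

theorem bclosed {U : Finset V} {G : SimpleGraph V} (hC : Cx U U G) (h3 : ∀ z ∈ U, dg G z = 3) : Bd U G 5 := by
  have g := hC.g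
  have m := hC.m
  have iU : ∀ z ∈ U, In G U z := fun z hz => ⟨hz, fun w h => g.sub w z h.symm⟩
  obtain ⟨v, vU⟩ := g.ne
  obtain ⟨a, b, c, hv⟩ : ∃ a b c, NL G v [a, b, c] := by
    rcases g.nl vU with ⟨a, b, h⟩ | h
    · have := h.f2.2.1; have := h3 v vU; omega
    · exact h
  obtain ⟨n2, -, q1, q2, q3, ev⟩ := hv.f3
  have aU := g.sub a v q1.symm
  have bU := g.sub b v q2.symm
  obtain ⟨a1, a2, ha⟩ := g.d3 q1.symm (h3 a aU)
  obtain ⟨b1, b2, hb⟩ := g.d3 q2.symm (h3 b bU)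
  obtain ⟨n1, -, p1, p2, p3, ea⟩ := ha.f3
  obtain ⟨n3, -, r1, r2, r3, eb⟩ := hb.f3
  have hab : ¬ G.Adj a b := trif hC h3 (iU v vU) hv.r312
  have hac : ¬ G.Adj a c := trif hC h3 (iU v vU) hv.r213
  have hbc : ¬ G.Adj b c := trif hC h3 (iU v vU) hv
  have haa : ¬ G.Adj a1 a2 := trif hC h3 (iU a aU) ha
  have hbb : ¬ G.Adj b1 b2 := trif hC h3 (iU b bU) hb
  have aa : a1 ≠ a2 := n1.2.2.2.2.2
  have bb : b1 ≠ b2 := n3.2.2.2.2.2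
  have hVS : ∀ x1 x2 y1 y2 z, z ∈ VS (DP a v b [x1, x2] [c] [y1, y2]) ↔ z = a ∨ z = v ∨ z = b :=
    fun x1 x2 y1 y2 z => VS_DP a v b [x1, x2] [c] [y1, y2] z
  have hVE : ∀ x1 x2 y1 y2, VS (DP a v b [x1, x2] [c] [y1, y2]) = {a, v, b} := by
    intro x1 x2 y1 y2; ext z; rw [hVS]; simp
  by_cases hsp : ∃ W ⊆ U \ {a, v, b}, W.Nonempty ∧ W ≠ U \ {a, v, b} ∧ (∀ u ∈ W, ∀ z, z ∉ ({a, v, b} : Finset V) → G.Adj u z → z ∈ W)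
  · obtain ⟨W, w1, w2, w3, w4⟩ := hsp
    have hD := patch_DP (A := [a1, a2]) (C := [c]) (B := [b1, b2]) ha hv hb hab
    have hI : Int U (DP a v b [a1, a2] [c] [b1, b2]) :=
      ⟨fun z hz => hD.sub g (mem_VS.2 hz), fun z hz => (Finset.mem_sdiff.1 (hD.hf_mem g hz)).1⟩
    have hn : DP a v b [a1, a2] [c] [b1, b2] ≠ [] := by simp [DP]
    rw [← hVE a1 a2 b1 b2] at w1 w3 w4
    have hcl := CL g m hD hI hn w1 w2 w3 w4
    rw [hf_DP] at hcl
    rw [hVE] at w1 w3 w4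
    have hW : ∀ u z, u ∉ ({a, v, b} : Finset V) → z ∉ ({a, v, b} : Finset V) → G.Adj u z → (u ∈ W ↔ z ∈ W) :=
      fun u z hu hz h => ⟨fun k => w4 u k z hz h, fun k => w4 z k u hu h.symm⟩
    have hsel : (¬ (a1 ∈ W ↔ b1 ∈ W) ∧ a2 ≠ b2) ∨ (¬ (a1 ∈ W ↔ b2 ∈ W) ∧ a2 ≠ b1) ∨
        (¬ (a2 ∈ W ↔ b1 ∈ W) ∧ a1 ≠ b2) ∨ (¬ (a2 ∈ W ↔ b2 ∈ W) ∧ a1 ≠ b1) := by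
      simp only [List.cons_append, List.nil_append, cnt] at hcl
      clear hW w1 w3 w4 hVS hVE iU
      by_cases k1 : a1 ∈ W <;> by_cases k2 : a2 ∈ W <;> by_cases k3 : b1 ∈ W <;> by_cases k4 : b2 ∈ W <;>
        simp only [k1, k2, k3, k4, if_true, if_false] at hcl ⊢ <;> first | grind | (exfalso; split_ifs at hcl <;> omega)
    rcases hsel with h | h | h | h
    · exact closed1 hC h3 ha hv hb hab hac hbc (by rw [hVE]; exact hW) h.1 h.2
    · exact closed1 hC h3 ha hv hb.r132 hab hac hbc (by rw [hVE]; exact hW) h.1 h.2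
    · exact closed1 hC h3 ha.r132 hv hb hab hac hbc (by rw [hVE]; exact hW) h.1 h.2
    · exact closed1 hC h3 ha.r132 hv hb.r132 hab hac hbc (by rw [hVE]; exact hW) h.1 h.2
  · have fin : ∀ x1 x2 y1 y2, NL G a [v, x1, x2] → NL G b [v, y1, y2] → x1 ≠ y1 → x2 ≠ y2 → ¬ G.Adj x1 y1 → Bd U G 5 := by
      intro x1 x2 y1 y2 hx hy e1 e2 hn
      refine closed0 hC h3 hx hv hy hab hac hbc e1 e2 hn ?_
      rw [hVE]
      intro W w1 w2 w3 w4 _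
      exact hsp ⟨W, w1, w2, w3, w4⟩
    have com : ∀ x1 x2 y1 y2, NL G a [v, x1, x2] → NL G b [v, y1, y2] → x1 = y1 → Bd U G 5 := by
      intro x1 x2 y1 y2 hx hy e
      subst e
      refine fin x1 x2 y2 x1 hx hy.r132 hy.f3.1.2.2.2.2.2 hx.f3.1.2.2.2.2.2.symm (trif hC h3 (iU b bU) hy)
    by_cases k1 : a1 = b1
    · exact com _ _ _ _ ha hb k1
    by_cases k2 : a1 = b2
    · exact com _ _ _ _ ha hb.r132 k2
    by_cases k3 : a2 = b1
    · exact com _ _ _ _ ha.r132 hb k3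
    by_cases k4 : a2 = b2
    · exact com _ _ _ _ ha.r132 hb.r132 k4
    by_cases l1 : G.Adj a1 b1
    swap
    · exact fin _ _ _ _ ha hb k1 k4 l1
    by_cases l2 : G.Adj a1 b2
    swap
    · exact fin _ _ _ _ ha hb.r132 k2 k3 l2
    by_cases l3 : G.Adj a2 b1
    swap
    · exact fin _ _ _ _ ha.r132 hb k3 k2 l3
    by_cases l4 : G.Adj a2 b2
    swap
    · exact fin _ _ _ _ ha.r132 hb.r132 k4 k1 l4
    exfalso
    have nb : ∀ w x y z, G.Adj w x → G.Adj w y → G.Adj w z → x ≠ y → x ≠ z → y ≠ z → ∀ t, G.Adj w t → t = x ∨ t = y ∨ t = z := by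
      intro w x y z h1 h2 h4 h5 h6 h7 t ht
      obtain ⟨t', hw⟩ := g.d32 h1 h2 h5 (h3 w (g.sub w x h1))
      have e := hw.f3.2.2.2.2.2
      have := (e z).1 h4
      have : t' = z := by grind
      subst this
      exact (e t).1 ht
    have x1 : a ≠ b1 := by rintro rfl; exact hab r2.symm
    have x2 : a ≠ b2 := by rintro rfl; exact hab r3.symm
    have x3 : b ≠ a1 := by rintro rfl; exact hab p2
    have x4 : b ≠ a2 := by rintro rfl; exact hab p3
    have o1 := nb a1 a b1 b2 p2.symm l1 l2 x1 x2 bb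
    have o2 := nb a2 a b1 b2 p3.symm l3 l4 x1 x2 bb
    have o3 := nb b1 b a1 a2 r2.symm l1.symm l3.symm x3 x4 aa
    have o4 := nb b2 b a1 a2 r3.symm l2.symm l4.symm x3 x4 aa
    have cM : c ∉ ({v, a, b, a1, a2, b1, b2} : Finset V) := by
      have c1 : c ≠ a1 := by rintro rfl; exact hac p2
      have c2 : c ≠ a2 := by rintro rfl; exact hac p3
      have c3 : c ≠ b1 := by rintro rfl; exact hbc r2
      have c4 : c ≠ b2 := by rintro rfl; exact hbc r3
      have := q3.ne
      have := n2
      simp only [Finset.mem_insert, Finset.mem_singleton]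
      grind
    refine m.min {v, a, b, a1, a2, b1, b2} ?_ ⟨v, by simp⟩ ?_ ?_
    · simp only [Finset.insert_subset_iff, Finset.singleton_subset_iff]
      exact ⟨vU, aU, bU, g.sub _ _ p2.symm, g.sub _ _ p3.symm, g.sub _ _ r2.symm, g.sub _ _ r3.symm⟩
    · intro h; rw [h] at cM; exact cM (g.sub c v q3.symm)
    · have key : ∀ u w, u ∈ ({v, a, b, a1, a2, b1, b2} : Finset V) → w ∉ ({v, a, b, a1, a2, b1, b2} : Finset V) → G.Adj u w → u = v ∧ w = c := by
        intro u w hu hw huw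
        simp only [Finset.mem_insert, Finset.mem_singleton, not_or] at hu hw
        clear fin com hsp hVS hVE iU nb
        rcases hu with rfl | rfl | rfl | rfl | rfl | rfl | rfl
        · have := (ev w).1 huw; grind
        · have := (ea w).1 huw; grind
        · have := (eb w).1 huw; grind
        · have := o1 w huw; grind
        · have := o2 w huw; grind
        · have := o3 w huw; grind
        · have := o4 w huw; grind
      intro u w u' w' d1 d2 d3 d4 d5 d6
      have k1 := key u w d1 d2 d3
      have k2 := key u' w' d4 d5 d6
      rw [k1.1, k1.2, k2.1, k2.2]; simp

theorem claim1 : ∀ (n : ℕ) (U : Finset V) (G : SimpleGraph V), U.card = n → Good U G → Bd U G 5 := by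
  intro n
  induction n using Nat.strong_induction_on with
  | _ n hind =>
  intro U G hn g
  have ih : IH U := fun U' G' h hg => hind U'.card (hn ▸ h) U' G' rfl hg
  obtain ⟨L, -, m⟩ := exists_minL (U := U) (G := G) U (le_refl _) g.ne
    (fun u w u' w' d1 d2 d3 => absurd (g.sub w u d3.symm) d2)
  by_cases h2 : ∃ v ∈ L, dg G v = 2
  · obtain ⟨v, vL, dv⟩ := h2
    rcases claim2 g ih m vL dv with h | h
    · exact h.mono (by norm_num)
    · exact card5 g h.1 h.2
  push Not at h2
  have h3 : ∀ z ∈ L, dg G z = 3 := fun z hz => (g.deg z (m.sub hz)).resolve_left (h2 z hz)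
  by_contra hb
  have hC : Cx U L G := ⟨g, ih, m, fun h => hb (h.mono (by norm_num)), fun h => hb (card5 g h.1 h.2)⟩
  by_cases hin : ∃ x ∈ L, ¬ In G L x
  · obtain ⟨x, xL, hx⟩ := hin
    exact hb (lobe hC h3 xL hx)
  · push Not at hin
    have hLU : L = U := g.conn L m.sub m.ne (fun u hu w huw => (hin u hu).2 w huw)
    subst hLU
    exact hb (bclosed hC h3)

theorem dg_eq (G : SimpleGraph V) (v : V) : dg G v = (G.neighborSet v).ncard := by
  unfold dg
  rw [← Set.ncard_coe_finset]
  congr 1; ext z; simp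

theorem final (G : SimpleGraph V) (hconn : G.Connected)
    (hdeg : ∀ v, (G.neighborSet v).ncard = 2 ∨ (G.neighborSet v).ncard = 3) :
    ∃ S : Finset V, (∀ v, v ∉ S → (∃ u ∈ S, G.Adj v u) ∧ ∃ u, u ∉ S ∧ G.Adj v u) ∧
      10 * S.card ≤ 5 * {v | (G.neighborSet v).ncard = 2}.ncard + 4 * {v | (G.neighborSet v).ncard = 3}.ncard + 5 := by
  have hg : Good Finset.univ G := by
    refine ⟨fun _ _ _ => Finset.mem_univ _, fun v _ => by rw [dg_eq]; exact hdeg v, ?_, ?_⟩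
    · haveI := hconn.nonempty
      exact Finset.univ_nonempty
    · rintro W - ⟨w, hw⟩ hcl
      rw [Finset.eq_univ_iff_forall]
      intro z
      obtain ⟨p⟩ := hconn.preconnected w z
      induction p with
      | nil => exact hw
      | cons h _ ih => exact ih (hcl _ hw _ h)
  obtain ⟨S, hS, hc⟩ := claim1 _ _ G rfl hg
  refine ⟨S, fun v hv => hS.2 v (Finset.mem_univ v) hv, ?_⟩
  have hw : wt G Finset.univ = 5 * ({v | (G.neighborSet v).ncard = 2}.ncard : ℤ) + 4 * ({v | (G.neighborSet v).ncard = 3}.ncard : ℤ) := by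
    have h2 : {v | (G.neighborSet v).ncard = 2}.ncard = (Finset.univ.filter (fun v => (G.neighborSet v).ncard = 2)).card := by
      rw [← Set.ncard_coe_finset]; congr 1; ext z; simp
    have h3 : {v | (G.neighborSet v).ncard = 3}.ncard = (Finset.univ.filter (fun v => (G.neighborSet v).ncard = 3)).card := by
      rw [← Set.ncard_coe_finset]; congr 1; ext z; simp
    rw [h2, h3, Finset.card_filter, Finset.card_filter]
    push_cast
    rw [Finset.mul_sum, Finset.mul_sum, ← Finset.sum_add_distrib]
    unfold wt
    refine Finset.sum_congr rfl (fun v _ => ?_)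
    rw [dg_eq]
    rcases hdeg v with h | h <;> simp [h]
  rw [hw] at hc
  exact_mod_cast hc

end
end RD

/-- If `G` is a finite connected simple graph with all degrees `2` or `3`, then
`10·γ_r(G) ≤ 5·n₂(G) + 4·n₃(G) + 5`. -/
theorem ten_mul_restrainedDominationNumber_le_of_connected
    {V : Type*} [Fintype V] (G : SimpleGraph V) (hconn : G.Connected)
    (hdeg : ∀ v : V, (G.neighborSet v).ncard = 2 ∨ (G.neighborSet v).ncard = 3) :
    10 * restrainedDominationNumber G ≤
      5 * {v : V | (G.neighborSet v).ncard = 2}.ncard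
        + 4 * {v : V | (G.neighborSet v).ncard = 3}.ncard + 5 := by
  obtain ⟨S, hS, hc⟩ := RD.final G hconn hdeg
  refine le_trans (Nat.mul_le_mul_left 10 (Nat.sInf_le ⟨(S : Set V), ⟨?_, ?_⟩, Set.ncard_coe_finset S⟩)) hc
  · intro v hv
    obtain ⟨u, h1, h2⟩ := (hS v (by simpa using hv)).1
    exact ⟨u, by simpa using h1, h2⟩
  · intro v hv
    obtain ⟨u, h1, h2⟩ := (hS v (by simpa using hv)).2
    exact ⟨u, by simpa using h1, h2⟩
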